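/- Define I_2^{oe}(N; α, β) = (1/#H_{2g+1}) ∑_{D ∈ H_{2g+1}} ∑ d(P) d(Q) χ_D(P^{2k+1} Q^{2l}) / ( |P|^{(2k+1)(1/2+α)} |Q|^{l(1+2β)} ), the inner sum running over monic irreducibles P, Q (not necessarily distinct) and integers k ≥ 0, l ≥ 1 with (2k+1)d(P) + 2l d(Q) ≤ N. Then for every ε ∈ (0, 1) there is C(ε, q) such that for all integers g ≥ 1 and 1 ≤ N < 4g, and all complex α, β with |α|, |β| ≤ 1/g, with r = q^{−ε} one has | I_2^{oe}(N; α, β) − (1/2πi) ∮_{|u|=r} q^{−2gα} u^{2g} A_2(u, α) K(u; α, β) du/(u^{N+1}(1 − u)) | ≤ C(ε, q) ( N² q^{N/2 − 2g} + g q^{−g/2 + εg} ), where A_2(u, α) = u²/(u² − q^{2α}) + 1/(q − 1) and K(u; α, β) = ∑_{Q monic irreducible, d(Q) < g} d(Q) (|Q|^{2(1−α)} − |Q|^{1−2α}) u^{4 d(Q)} / ( (|Q|^{2(1−α)} u^{2 d(Q)} − 1)(|Q|^{1+2β} − u^{2 d(Q)}) ), and the contour is the circle |u| = r traversed once counterclockwise.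 -/

import Mathlib

open Polynomial UniqueFactorizationMonoid
open scoped Classical

noncomputable section

/-- The quadratic residue symbol `(a/P)` for `P` a monic irreducible polynomial:
`0` if `P ∣ a`, `1` if `a` is a nonzero square mod `P`, `-1` otherwise. -/
def resSym (q : ℕ) (a P : Polynomial (ZMod q)) : ℤ :=
  if P ∣ a then 0 else if ∃ b : Polynomial (ZMod q), P ∣ (a - b ^ 2) then 1 else -1

/-- The symbol `(a/b)`, extended multiplicatively over the monic irreducible factors
of `b` (with multiplicity); by convention `(a/0) = 0`.  In particular `χ_D(f) = (D/f)`
is `jacSym q D f`, and `χ_f(h) = (f/h)` is `jacSym q f h`. -/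
def jacSym (q : ℕ) [Fact q.Prime] (a b : Polynomial (ZMod q)) : ℤ :=
  if b = 0 then 0 else ((normalizedFactors b).map fun P => resSym q a P).prod

/-- The monic polynomial of degree `n` determined by the vector `v` of its
lower-order coefficients. -/
def monicOfDeg (q : ℕ) (n : ℕ) (v : Fin n → ZMod q) : Polynomial (ZMod q) :=
  X ^ n + ∑ i : Fin n, C (v i) * X ^ (i : ℕ)

/-- The polynomial of degree `< n` with coefficient vector `v`. -/
def polyLT (q : ℕ) (n : ℕ) (v : Fin n → ZMod q) : Polynomial (ZMod q) :=
  ∑ i : Fin n, C (v i) * X ^ (i : ℕ)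

/-- Sum of `F` over all monic polynomials of degree `m`; empty for `m < 0`. -/
def sumMonic (q : ℕ) [NeZero q] {M : Type*} [AddCommMonoid M] (m : ℤ)
    (F : Polynomial (ZMod q) → M) : M :=
  if 0 ≤ m then ∑ v : Fin m.toNat → ZMod q, F (monicOfDeg q m.toNat v) else 0

/-- Sum of `F` over all monic polynomials of degree `≤ n`; empty for `n < 0`. -/
def sumMonicLE (q : ℕ) [NeZero q] {M : Type*} [AddCommMonoid M] (n : ℤ)
    (F : Polynomial (ZMod q) → M) : M :=
  if 0 ≤ n then ∑ m ∈ Finset.range (n.toNat + 1), sumMonic q (m : ℤ) F else 0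

/-- Sum of `F` over the set `H_{2g+1}` of monic squarefree polynomials of degree `2g+1`. -/
def sumH (q : ℕ) [NeZero q] {M : Type*} [AddCommMonoid M] (g : ℕ)
    (F : Polynomial (ZMod q) → M) : M :=
  ∑ v : Fin (2 * g + 1) → ZMod q,
    if Squarefree (monicOfDeg q (2 * g + 1) v) then F (monicOfDeg q (2 * g + 1) v) else 0

/-- `e(a/f)` for monic `f`: the additive character `exp(2πi a₁/q)` where `a₁` is the
coefficient of `t⁻¹` in the expansion of `a/f` at infinity, namely the coefficient of
`t^{deg f - 1}` in `a mod f`. -/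
def ePoly (q : ℕ) (a f : Polynomial (ZMod q)) : ℂ :=
  Complex.exp (2 * Real.pi * Complex.I *
    (((a %ₘ f).coeff (f.natDegree - 1)).val : ℂ) / q)

/-- The generalized Gauss sum `G(V, f) = ∑_{u mod f} χ_f(u) e(uV/f)`, the sum running
over the residues `u` modulo `f`, i.e. the polynomials of degree `< deg f`. -/
def gaussS (q : ℕ) [Fact q.Prime] (V f : Polynomial (ZMod q)) : ℂ :=
  ∑ v : Fin f.natDegree → ZMod q,
    (jacSym q f (polyLT q f.natDegree v) : ℂ) * ePoly q (polyLT q f.natDegree v * V) f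

/-- The von Mangoldt function: `Λ(f) = deg P` if `f = P^k` with `P` monic irreducible
and `k ≥ 1`, and `0` otherwise. -/
def vM (q : ℕ) (f : Polynomial (ZMod q)) : ℕ :=
  if h : ∃ P : Polynomial (ZMod q), (∃ k : ℕ, 1 ≤ k ∧ f = P ^ k) ∧ P.Monic ∧ Irreducible P
  then h.choose.natDegree else 0

/-- The monic irreducible polynomials of `F_q[t]`. -/
abbrev MonicIrr (q : ℕ) := {P : Polynomial (ZMod q) // P.Monic ∧ Irreducible P}

/-- `B(α) = ∑_P d(P) / ((|P|^{1+2α} - 1)(|P| + 1))`, over monic irreducible `P`. -/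
def Bsum (q : ℕ) (α : ℂ) : ℂ :=
  ∑' P : MonicIrr q, (P.1.natDegree : ℂ) /
    (((q : ℂ) ^ ((P.1.natDegree : ℂ) * (1 + 2 * α)) - 1) * ((q : ℂ) ^ P.1.natDegree + 1))

end

noncomputable section

/-- `A₂(u, γ) = u²/(u² - q^{2γ}) + 1/(q-1)`. -/
def A2 (q : ℕ) (u γ : ℂ) : ℂ :=
  u ^ 2 / (u ^ 2 - (q : ℂ) ^ (2 * γ)) + 1 / ((q : ℂ) - 1)

/-- `K(u; α, β) = ∑_{d(Q) < g} d(Q)(|Q|^{2(1-α)} - |Q|^{1-2α}) u^{4d(Q)}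
/ ((|Q|^{2(1-α)} u^{2d(Q)} - 1)(|Q|^{1+2β} - u^{2d(Q)}))`, over monic irreducible `Q`
of degree `< g`. -/
def Kfun (q g : ℕ) (α β u : ℂ) : ℂ :=
  ∑' Q : MonicIrr q,
    if Q.1.natDegree < g then
      (Q.1.natDegree : ℂ) *
        ((q : ℂ) ^ ((Q.1.natDegree : ℂ) * (2 * (1 - α)))
          - (q : ℂ) ^ ((Q.1.natDegree : ℂ) * (1 - 2 * α))) *
        u ^ (4 * Q.1.natDegree) /
        (((q : ℂ) ^ ((Q.1.natDegree : ℂ) * (2 * (1 - α))) * u ^ (2 * Q.1.natDegree) - 1) *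
          ((q : ℂ) ^ ((Q.1.natDegree : ℂ) * (1 + 2 * β)) - u ^ (2 * Q.1.natDegree)))
    else 0

section Stepanov

variable {K : Type*} [Field K]

lemma pow_sub_dvd_hasseDeriv_pow_mul (f r : K[X]) (n k : ℕ) :
    f ^ (n - k) ∣ hasseDeriv k (f ^ n * r) := by
  induction n generalizing k with
  | zero => simp
  | succ n ih =>
    rw [pow_succ', mul_assoc, hasseDeriv_mul]
    refine Finset.dvd_sum fun ij hij => ?_
    rw [Finset.HasAntidiagonal.mem_antidiagonal] at hij
    rcases Nat.eq_zero_or_pos ij.1 with h0 | h0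
    · have hk : ij.2 = k := by omega
      rw [h0, hk, hasseDeriv_zero']
      refine (pow_dvd_pow f (show n + 1 - k ≤ (n - k) + 1 by omega)).trans ?_
      rw [pow_succ']
      exact mul_dvd_mul_left _ (ih k)
    · exact ((pow_dvd_pow f (show n + 1 - k ≤ n - ij.2 by omega)).trans (ih ij.2)).mul_left _

lemma exists_hasseDeriv_pow_mul_eq {f : K[X]} (hf : f.Monic) (r : K[X]) {n k : ℕ} (hk : k ≤ n) :
    ∃ p : K[X], hasseDeriv k (f ^ n * r) = f ^ (n - k) * p ∧
      p.natDegree ≤ r.natDegree + k * f.natDegree := by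
  obtain ⟨p, hp⟩ := pow_sub_dvd_hasseDeriv_pow_mul f r n k
  refine ⟨p, hp, ?_⟩
  by_cases hp0 : p = 0
  · simp [hp0]
  have h1 := natDegree_hasseDeriv_le (f ^ n * r) k
  have h2 : (f ^ n * r).natDegree ≤ n * f.natDegree + r.natDegree := by
    refine natDegree_mul_le.trans ?_
    rw [natDegree_pow]
  rw [hp, (hf.pow _).natDegree_mul' hp0, natDegree_pow] at h1
  have h3 : (n - k) * f.natDegree + k * f.natDegree = n * f.natDegree := by
    rw [← add_mul]; congr 1; omega
  omega

/-- The polynomial of degree less than `D` with a given coefficient vector. -/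
def polyOfVec (D : ℕ) (w : Fin D → K) : K[X] := ∑ i : Fin D, C (w i) * X ^ (i : ℕ)

lemma polyOfVec_sub (D : ℕ) (v w : Fin D → K) :
    polyOfVec D (v - w) = polyOfVec D v - polyOfVec D w := by
  simp [polyOfVec, sub_mul, Finset.sum_sub_distrib]

lemma polyOfVec_degree_lt (D : ℕ) (w : Fin D → K) : (polyOfVec D w).degree < D := by
  exact degree_sum_fin_lt w

lemma polyOfVec_coeff (D : ℕ) (w : Fin D → K) (i : Fin D) :
    (polyOfVec D w).coeff i = w i := by
  simp only [polyOfVec, finsetSum_coeff, coeff_C_mul, coeff_X_pow]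
  rw [Finset.sum_eq_single i]
  · simp
  · intro j _ hj
    have : (i : ℕ) ≠ j := fun h => hj (Fin.ext h.symm)
    simp [this]
  · simp

lemma polyOfVec_eq_zero {D : ℕ} {w : Fin D → K} (h : polyOfVec D w = 0) : w = 0 := by
  funext i
  rw [← polyOfVec_coeff D w i, h]; simp

lemma isSquare_of_mul_sq_eq {f r s : K[X]} {a : K} (hf : f.Monic) (hr : r ≠ 0)
    (h : r ^ 2 * f = C a * s ^ 2) : IsSquare f := by
  have ha : a ≠ 0 := by
    rintro rfl
    have : r ^ 2 * f ≠ 0 := mul_ne_zero (pow_ne_zero _ hr) hf.ne_zero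
    exact this (by simpa using h)
  have h1 : s ^ 2 = r ^ 2 * (C a⁻¹ * f) := by
    have : C a⁻¹ * (C a * s ^ 2) = s ^ 2 := by
      rw [← mul_assoc, ← C_mul, inv_mul_cancel₀ ha]; simp
    rw [← this, ← h]; ring
  have h2 : r ∣ s := by
    have : r ^ 2 ∣ s ^ 2 := ⟨_, h1⟩
    exact (IsIntegrallyClosed.pow_dvd_pow_iff two_ne_zero).1 this
  obtain ⟨t, rfl⟩ := h2
  have h3 : f = C a * t ^ 2 := by
    have : r ^ 2 * f = r ^ 2 * (C a * t ^ 2) := by rw [h]; ring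
    exact mul_left_cancel₀ (pow_ne_zero _ hr) this
  have h4 : a * t.leadingCoeff ^ 2 = 1 := by
    have := hf.leadingCoeff
    rw [h3] at this
    simpa [leadingCoeff_mul, leadingCoeff_pow] using this
  have h5 : t.leadingCoeff ≠ 0 := by
    intro h0; rw [h0] at h4; simp at h4
  refine ⟨C t.leadingCoeff⁻¹ * t, ?_⟩
  have h6 : a = t.leadingCoeff⁻¹ ^ 2 := by
    field_simp; exact h4
  rw [h3, h6]
  simp only [C_pow]
  ring

lemma X_sub_C_pow_dvd_of_hasseDeriv {R : K[X]} {x : K} {l : ℕ}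
    (h : ∀ k < l, (hasseDeriv k R).eval x = 0) : (X - C x) ^ l ∣ R := by
  have h1 : X ^ l ∣ taylor x R := by
    rw [X_pow_dvd_iff]
    intro d hd
    rw [taylor_coeff]; exact h d hd
  obtain ⟨g, hg⟩ := h1
  refine ⟨taylor (-x) g, ?_⟩
  have h2 := congrArg (taylor (-x)) hg
  rw [taylor_taylor, neg_add_cancel, taylor_zero, taylor_mul, taylor_pow, taylor_X] at h2
  rw [h2]; simp [sub_eq_add_neg]

variable [Fintype K]

lemma X_pow_card_dvd_pow_card_sub (f : K[X]) :
    X ^ Fintype.card K ∣ f ^ Fintype.card K - C (f.eval 0) := by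
  rw [← FiniteField.expand_card f]
  have h : X ∣ f - C (f.eval 0) := by
    rw [X_dvd_iff]; simp [coeff_zero_eq_eval_zero]
  obtain ⟨g, hg⟩ := h
  have h2 : f = X * g + C (f.eval 0) := by rw [← hg]; ring
  have h3 := congrArg (expand K (Fintype.card K)) h2
  rw [map_add, map_mul, expand_X, expand_C] at h3
  rw [h3, add_sub_cancel_right]
  exact dvd_mul_right _ _

/-- The auxiliary polynomials `r + s f^c` of Stepanov's method have no nontrivial relation
over the `q`-th powers. -/
lemma stepanov_independent {f : K[X]} (hf : f.Monic) (hns : ¬ IsSquare f) (h0 : f.eval 0 ≠ 0)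
    {c D : ℕ} (hc : 2 * c + 1 = Fintype.card K) (hD : 2 * D + f.natDegree ≤ Fintype.card K)
    (J : ℕ) (r s : ℕ → K[X]) (hr : ∀ j, (r j).degree < D) (hs : ∀ j, (s j).degree < D)
    (h : ∑ j ∈ Finset.range J, (r j + s j * f ^ c) * X ^ (j * Fintype.card K) = 0) :
    ∀ j < J, r j = 0 ∧ s j = 0 := by
  by_contra hcon
  push Not at hcon
  have hex : ∃ j, j < J ∧ ¬ (r j = 0 ∧ s j = 0) := by
    obtain ⟨j, hj, h2⟩ := hcon
    exact ⟨j, hj, fun h3 => h2 h3.1 h3.2⟩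
  set j0 := Nat.find hex
  obtain ⟨hj0, hne⟩ := Nat.find_spec hex
  have hmin : ∀ j < j0, r j = 0 ∧ s j = 0 := fun j hj => by
    have := Nat.find_min hex hj
    by_contra h3
    exact this ⟨hj.trans hj0, h3⟩
  set Q := Fintype.card K
  have hdvd : X ^ Q ∣ r j0 + s j0 * f ^ c := by
    have h1 : X ^ ((j0 + 1) * Q) ∣ (r j0 + s j0 * f ^ c) * X ^ (j0 * Q) := by
      rw [← Finset.add_sum_erase _ _ (Finset.mem_range.2 hj0)] at h
      rw [eq_neg_of_add_eq_zero_left h, dvd_neg]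
      refine Finset.dvd_sum fun j hj => ?_
      rw [Finset.mem_erase] at hj
      rcases lt_or_gt_of_ne hj.1 with hlt | hgt
      · obtain ⟨h2, h3⟩ := hmin j hlt
        simp [h2, h3]
      · exact (pow_dvd_pow X (Nat.mul_le_mul_right Q hgt)).mul_left _
    rw [add_mul, one_mul, pow_add, mul_comm (X ^ (j0 * Q))] at h1
    exact (mul_dvd_mul_iff_right (pow_ne_zero _ X_ne_zero)).1 h1
  have h2 : X ^ Q ∣ (r j0) ^ 2 * f - C (f.eval 0) * (s j0) ^ 2 := by
    have h3 : (r j0) ^ 2 * f - C (f.eval 0) * (s j0) ^ 2 =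
        (r j0 + s j0 * f ^ c) * ((r j0 - s j0 * f ^ c) * f)
          + (f ^ Q - C (f.eval 0)) * (s j0) ^ 2 := by
      have : f ^ Q = f ^ c * f ^ c * f := by rw [← hc]; ring
      rw [this]; ring
    rw [h3]
    exact dvd_add (hdvd.mul_right _) ((X_pow_card_dvd_pow_card_sub f).mul_right _)
  have nd : ∀ p : K[X], p.degree < D → p ≠ 0 → p.natDegree < D := fun p hp hp0 =>
    (natDegree_lt_iff_degree_lt hp0).2 hp
  have hQ : 0 < Q := Fintype.card_pos
  have hDpos : 0 < D := by
    by_contra hD0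
    have : D = 0 := by omega
    apply hne
    have h1 := hr j0; have h2 := hs j0
    rw [this] at h1 h2
    exact ⟨degree_eq_bot.1 (Nat.WithBot.lt_zero_iff.1 h1),
      degree_eq_bot.1 (Nat.WithBot.lt_zero_iff.1 h2)⟩
  have nd' : ∀ p : K[X], p.degree < D → p.natDegree ≤ D - 1 := fun p hp => by
    by_cases hp0 : p = 0
    · simp [hp0]
    · have := nd p hp hp0; omega
  have h4 : (r j0) ^ 2 * f - C (f.eval 0) * (s j0) ^ 2 = 0 := by
    refine eq_zero_of_dvd_of_natDegree_lt h2 ?_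
    rw [natDegree_X_pow]
    refine (natDegree_sub_le _ _).trans_lt (max_lt ?_ ?_)
    · refine natDegree_mul_le.trans_lt ?_
      rw [natDegree_pow]
      have := nd' _ (hr j0)
      omega
    · refine (natDegree_C_mul_le _ _).trans_lt ?_
      rw [natDegree_pow]
      have := nd' _ (hs j0)
      omega
  by_cases hr0 : r j0 = 0
  · rw [hr0] at h4
    simp [h0] at h4
    exact hne ⟨hr0, h4⟩
  · exact hns (isSquare_of_mul_sq_eq hf hr0 (sub_eq_zero.1 h4))

lemma X_pow_mul_card_sub_dvd (x : K) (j : ℕ) :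
    (X - C x) ^ Fintype.card K ∣ (X : K[X]) ^ (j * Fintype.card K) - C (x ^ j) := by
  have h1 : (X - C x) ^ Fintype.card K = X ^ Fintype.card K - C x := by
    rw [← FiniteField.expand_card]; simp
  rw [h1, mul_comm, pow_mul, C_pow]
  exact sub_dvd_pow_sub_pow _ _ j

set_option maxHeartbeats 2000000 in
/-- The number of points where `f ^ ((Q - 1) / 2)` takes the value `a ≠ 0`, bounded through an
auxiliary polynomial vanishing to order `l` at each of them. -/
lemma stepanov_count {f : K[X]} (hf : f.Monic) (hns : ¬ IsSquare f) (h0 : f.eval 0 ≠ 0)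
    {c D l J : ℕ} (hc : 2 * c + 1 = Fintype.card K) (hD : 2 * D + f.natDegree ≤ Fintype.card K)
    (hl : l ≤ Fintype.card K) (hpar : l * (D + l * f.natDegree + J) < 2 * (J * D))
    {a : K} (ha : a ≠ 0) :
    l * (Finset.univ.filter fun x : K => (f.eval x) ^ c = a).card ≤
      l * f.natDegree + (D + c * f.natDegree) + J * Fintype.card K := by
  set Q := Fintype.card K
  set m := f.natDegree
  set E := D + l * m + J
  have hJ : 0 < J := by
    rcases Nat.eq_zero_or_pos J with h | h
    · rw [h] at hpar; simp at hpar
    · exact h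
  have hDpos : 0 < D := by
    rcases Nat.eq_zero_or_pos D with h | h
    · rw [h] at hpar; simp at hpar
    · exact h
  let rr : (Fin J → (Fin D → K) × (Fin D → K)) → ℕ → K[X] := fun v j =>
    if h : j < J then polyOfVec D (v ⟨j, h⟩).1 else 0
  let ss : (Fin J → (Fin D → K) × (Fin D → K)) → ℕ → K[X] := fun v j =>
    if h : j < J then polyOfVec D (v ⟨j, h⟩).2 else 0
  have rr_sub : ∀ v w j, rr (v - w) j = rr v j - rr w j := by
    intro v w j
    by_cases h : j < J <;> simp [rr, h, polyOfVec_sub]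
  have ss_sub : ∀ v w j, ss (v - w) j = ss v j - ss w j := by
    intro v w j
    by_cases h : j < J <;> simp [ss, h, polyOfVec_sub]
  have rr_deg : ∀ v j, (rr v j).degree < D := by
    intro v j
    by_cases h : j < J
    · simp only [rr, h, dif_pos]; exact polyOfVec_degree_lt _ _
    · simp only [rr, h, dif_neg, not_false_eq_true, degree_zero]; exact WithBot.bot_lt_coe _
  have ss_deg : ∀ v j, (ss v j).degree < D := by
    intro v j
    by_cases h : j < J
    · simp only [ss, h, dif_pos]; exact polyOfVec_degree_lt _ _
    · simp only [ss, h, dif_neg, not_false_eq_true, degree_zero]; exact WithBot.bot_lt_coe _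
  have nd : ∀ p : K[X], p.degree < D → p.natDegree ≤ D - 1 := fun p hp => by
    by_cases hp0 : p = 0
    · simp [hp0]
    · have := (natDegree_lt_iff_degree_lt hp0).2 hp; omega
  let Φ : (Fin J → (Fin D → K) × (Fin D → K)) → ℕ → K[X] := fun v k =>
    ∑ j ∈ Finset.range J, C a * (hasseDeriv k (f ^ (l + c) * ss v j) * X ^ j)
      + ∑ j ∈ Finset.range J, f ^ c * (hasseDeriv k (f ^ l * rr v j) * X ^ j)
  have Φ_sub : ∀ v w k, Φ (v - w) k = Φ v k - Φ w k := by
    intro v w k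
    simp only [Φ, rr_sub, ss_sub, mul_sub, sub_mul, map_sub, Finset.sum_sub_distrib]
    ring
  have hσ : ∀ v k, ∃ σ : K[X], k ≤ l → (Φ v k = f ^ (l + c - k) * σ ∧ σ.natDegree < E) := by
    intro v k
    by_cases hk : k ≤ l
    swap
    · exact ⟨0, fun h => absurd h hk⟩
    choose p hp hpd using fun j => exists_hasseDeriv_pow_mul_eq hf (rr v j) hk
    choose p' hp' hpd' using fun j =>
      exists_hasseDeriv_pow_mul_eq hf (ss v j) (show k ≤ l + c by omega)
    refine ⟨∑ j ∈ Finset.range J, C a * (p' j * X ^ j) + ∑ j ∈ Finset.range J, p j * X ^ j,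
      fun _ => ⟨?_, ?_⟩⟩
    · simp only [Φ, hp, hp', mul_add, Finset.mul_sum]
      congr 1
      · refine Finset.sum_congr rfl fun j _ => ?_
        ring
      · refine Finset.sum_congr rfl fun j _ => ?_
        rw [show l + c - k = c + (l - k) by omega, pow_add]; ring
    · have key : ∀ g : K[X], g.natDegree ≤ D - 1 + k * m → ∀ j ∈ Finset.range J,
          (g * X ^ j).natDegree ≤ E - 1 := by
        intro g hg j hj
        rw [Finset.mem_range] at hj
        refine natDegree_mul_le.trans ?_
        rw [natDegree_X_pow]
        have := Nat.mul_le_mul_right m hk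
        omega
      have h1 : (∑ j ∈ Finset.range J, C a * (p' j * X ^ j)).natDegree ≤ E - 1 := by
        refine natDegree_sum_le_of_forall_le _ _ fun j hj => ?_
        exact (natDegree_C_mul_le _ _).trans
          (key _ ((hpd' j).trans (Nat.add_le_add_right (nd _ (ss_deg v j)) _)) j hj)
      have h2 : (∑ j ∈ Finset.range J, p j * X ^ j).natDegree ≤ E - 1 :=
        natDegree_sum_le_of_forall_le _ _ fun j hj =>
          key _ ((hpd j).trans (Nat.add_le_add_right (nd _ (rr_deg v j)) _)) j hj
      have h3 := natDegree_add_le_of_degree_le h1 h2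
      omega
  choose σ hσ using hσ
  obtain ⟨v, w, hvw, hmap⟩ := Fintype.exists_ne_map_eq_of_card_lt
    (fun (v : Fin J → (Fin D → K) × (Fin D → K)) (k : Fin l) (i : Fin E) => (σ v k).coeff i)
    (by
      simp only [Fintype.card_fun, Fintype.card_prod, Fintype.card_fin]
      rw [← pow_add, ← pow_mul, ← pow_mul]
      refine Nat.pow_lt_pow_right Fintype.one_lt_card ?_
      nlinarith)
  set u := v - w
  have hu : u ≠ 0 := sub_ne_zero.2 hvw
  have hΦu : ∀ k < l, Φ u k = 0 := by
    intro k hk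
    have h1 := hσ v k hk.le
    have h2 := hσ w k hk.le
    have h3 : σ v k = σ w k := by
      ext i
      by_cases hi : i < E
      · exact congrFun (congrFun hmap ⟨k, hk⟩) ⟨i, hi⟩
      · rw [coeff_eq_zero_of_natDegree_lt (by omega), coeff_eq_zero_of_natDegree_lt (by omega)]
    rw [Φ_sub, h1.1, h2.1, h3, sub_self]
  set S : K[X] := ∑ j ∈ Finset.range J, (rr u j + ss u j * f ^ c) * X ^ (j * Q) with hS
  have hSne : S ≠ 0 := by
    intro hS0
    have h1 := stepanov_independent hf hns h0 hc hD J (rr u) (ss u) (rr_deg u) (ss_deg u) hS0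
    apply hu
    funext j
    have h2 := h1 j j.2
    simp only [rr, ss, j.2, dif_pos] at h2
    exact Prod.ext (polyOfVec_eq_zero h2.1) (polyOfVec_eq_zero h2.2)
  have hdvd : ∀ x ∈ Finset.univ.filter (fun x : K => (f.eval x) ^ c = a),
      (X - C x) ^ l ∣ f ^ l * S := by
    intro x hx
    rw [Finset.mem_filter] at hx
    have hfx := hx.2
    set G : K[X] := ∑ j ∈ Finset.range J, f ^ l * (rr u j + ss u j * f ^ c) * C (x ^ j) with hG
    have h1 : (X - C x) ^ l ∣ f ^ l * S - G := by
      rw [hS, hG, Finset.mul_sum, ← Finset.sum_sub_distrib]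
      refine Finset.dvd_sum fun j _ => ?_
      rw [← mul_assoc, ← mul_sub]
      exact ((pow_dvd_pow _ hl).trans (X_pow_mul_card_sub_dvd x j)).mul_left _
    have h2 : (X - C x) ^ l ∣ G := by
      refine X_sub_C_pow_dvd_of_hasseDeriv fun k hk => ?_
      have h3 := congrArg (eval x) (hΦu k hk)
      have h4 : a * (hasseDeriv k G).eval x = (Φ u k).eval x := by
        simp only [Φ, hG, map_sum, eval_finsetSum, eval_add, eval_mul, eval_C, eval_pow, hfx,
          eval_X, Finset.mul_sum]
        rw [← Finset.sum_add_distrib]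
        refine Finset.sum_congr rfl fun j _ => ?_
        have h5 : f ^ l * (rr u j + ss u j * f ^ c) * C (x ^ j)
            = (x ^ j) • (f ^ (l + c) * ss u j + f ^ l * rr u j) := by
          rw [smul_eq_C_mul, pow_add]; ring
        rw [h5, map_smul, map_add, eval_smul, eval_add, smul_eq_mul]
        ring
      rw [h3, eval_zero] at h4
      exact (mul_eq_zero.1 h4).resolve_left ha
    simpa using dvd_add h1 h2
  have hprod : ∏ x ∈ Finset.univ.filter (fun x : K => (f.eval x) ^ c = a), (X - C x) ^ l
      ∣ f ^ l * S := by
    refine Finset.prod_dvd_of_coprime ?_ hdvd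
    intro x _ y _ hxy
    exact (pairwise_coprime_X_sub_C (s := fun x : K => x) Function.injective_id hxy).pow
  have hne : f ^ l * S ≠ 0 := mul_ne_zero (pow_ne_zero _ hf.ne_zero) hSne
  have hdeg := natDegree_le_of_dvd hprod hne
  rw [natDegree_prod_of_monic _ _ fun x _ => (monic_X_sub_C x).pow l] at hdeg
  simp only [natDegree_pow, natDegree_X_sub_C, mul_one, Finset.sum_const, smul_eq_mul] at hdeg
  have hSdeg : S.natDegree ≤ (D + c * m) + J * Q := by
    refine natDegree_sum_le_of_forall_le _ _ fun j hj => ?_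
    rw [Finset.mem_range] at hj
    refine natDegree_mul_le.trans ?_
    rw [natDegree_X_pow]
    refine add_le_add ?_ (Nat.mul_le_mul_right Q hj.le)
    refine natDegree_add_le_of_degree_le ?_ ?_
    · have := nd _ (rr_deg u j)
      omega
    · refine natDegree_mul_le.trans ?_
      rw [natDegree_pow]
      exact add_le_add ((nd _ (ss_deg u j)).trans (Nat.sub_le _ _)) le_rfl
  have h6 : (f ^ l * S).natDegree ≤ l * m + S.natDegree := by
    refine natDegree_mul_le.trans ?_
    rw [natDegree_pow]
  rw [mul_comm l]
  omega

end Stepanov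

section Stepanov

variable {K : Type*} [Field K] [Fintype K]

lemma quadraticChar_le_of_count (f : K[X]) (hf0 : f ≠ 0) (hch : ringChar K ≠ 2) {B : ℝ}
    (hB : ∀ a : K, a ≠ 0 → ((Finset.univ.filter fun x : K =>
      (f.eval x) ^ (Fintype.card K / 2) = a).card : ℝ) ≤ Fintype.card K / 2 + B) :
    |((∑ x : K, quadraticChar K (f.eval x) : ℤ) : ℝ)| ≤ 2 * B + f.natDegree := by
  set χ := quadraticChar K
  set N1 := (Finset.univ.filter fun x : K => χ (f.eval x) = 1).card with hN1
  set N2 := (Finset.univ.filter fun x : K => χ (f.eval x) = -1).card with hN2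
  set N0 := (Finset.univ.filter fun x : K => f.eval x = 0).card with hN0
  have e1 : (∑ x : K, χ (f.eval x)) = (N1 : ℤ) - N2 := by
    rw [hN1, hN2, Finset.card_filter, Finset.card_filter]
    push_cast
    rw [← Finset.sum_sub_distrib]
    refine Finset.sum_congr rfl fun x _ => ?_
    by_cases h : f.eval x = 0
    · simp [h, χ]
    · rcases quadraticChar_dichotomy h with h1 | h1 <;> simp [χ, h1]
  have e2 : (Fintype.card K : ℤ) = N0 + N1 + N2 := by
    rw [hN0, hN1, hN2, Finset.card_filter, Finset.card_filter, Finset.card_filter]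
    push_cast
    rw [← Finset.sum_add_distrib, ← Finset.sum_add_distrib, Fintype.card, Finset.card_eq_sum_ones]
    push_cast
    refine Finset.sum_congr rfl fun x _ => ?_
    by_cases h : f.eval x = 0
    · simp [h, χ]
    · rcases quadraticChar_dichotomy h with h1 | h1 <;> simp [χ, h1, h]
  have h0 : N0 ≤ f.natDegree := by
    refine le_trans ?_ (card_roots' f)
    refine le_trans (Finset.card_le_card (t := f.roots.toFinset) ?_) (Multiset.toFinset_card_le _)
    intro x hx
    rw [Finset.mem_filter] at hx
    rw [Multiset.mem_toFinset, mem_roots hf0]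
    exact hx.2
  have hs1 : (N1 : ℝ) ≤ Fintype.card K / 2 + B := by
    refine le_trans ?_ (hB 1 one_ne_zero)
    rw [hN1]
    exact_mod_cast Finset.card_le_card (fun x hx => by
      rw [Finset.mem_filter] at hx ⊢
      refine ⟨hx.1, ?_⟩
      rw [← quadraticChar_eq_pow_of_char_ne_two' hch]
      have := hx.2
      simp only [χ] at this
      simp [this])
  have hs2 : (N2 : ℝ) ≤ Fintype.card K / 2 + B := by
    refine le_trans ?_ (hB (-1) (by simp))
    rw [hN2]
    exact_mod_cast Finset.card_le_card (fun x hx => by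
      rw [Finset.mem_filter] at hx ⊢
      refine ⟨hx.1, ?_⟩
      rw [← quadraticChar_eq_pow_of_char_ne_two' hch]
      have := hx.2
      simp only [χ] at this
      simp [this])
  rw [e1]
  have e3 : (Fintype.card K : ℝ) = N0 + N1 + N2 := by exact_mod_cast e2
  have h0' : (N0 : ℝ) ≤ f.natDegree := by exact_mod_cast h0
  push_cast
  rw [abs_le]
  constructor <;> linarith

lemma weil_numeric_count {m b c w Q D : ℝ} (hm1 : 1 ≤ m) (hD : D = c - m) (hww : w * w = Q)
    (hb1 : 2 * b ≤ w) (hw8 : 8 ≤ w) (hb2 : w ≤ 4 * b) (hQm : 8 * m ≤ Q) (hcR : 2 * c + 1 = Q) :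
    (2 * b) * (D + 2 * b * m + (b + 5 * m)) < 2 * ((b + 5 * m) * D) := by
  subst hD
  have hbb : 4 * b * b ≤ Q := by nlinarith
  have hbpos : 0 < b := by linarith
  have hb16 : 16 * b ≤ Q := by nlinarith
  have h1 : 4 * b * b * m ≤ Q * m := mul_le_mul_of_nonneg_right hbb (by linarith)
  have h2 : 16 * b * m ≤ Q * m := mul_le_mul_of_nonneg_right hb16 (by linarith)
  have h3 : (3 / 8 * Q - 1 / 2) * m ≤ (c - m) * m := by
    apply mul_le_mul_of_nonneg_right _ (by linarith)
    linarith
  have h4 : Q ≤ Q * m := le_mul_of_one_le_right (by nlinarith) hm1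
  nlinarith

lemma weil_numeric_bound {m b c w Q D N : ℝ} (hm1 : 1 ≤ m) (hD : D = c - m) (hww : w * w = Q)
    (hw8 : 8 ≤ w) (hb2 : w ≤ 4 * b) (hcR : 2 * c + 1 = Q)
    (h1 : 2 * b * N ≤ 2 * b * m + (D + c * m) + (b + 5 * m) * Q) :
    N ≤ Q / 2 + (m + 12 * m * w) := by
  subst hD
  have h2 : c - m + c * m ≤ Q * m := by nlinarith
  have h3 : 6 * m * Q ≤ 24 * m * w * b := by
    rw [← hww]
    have := mul_le_mul_of_nonneg_left hb2 (show 0 ≤ 6 * m * w by nlinarith)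
    linarith
  have h4 : 2 * b * N ≤ 2 * b * (Q / 2 + (m + 12 * m * w)) := by nlinarith
  exact le_of_mul_le_mul_left h4 (by linarith)

/-- Weil's bound for quadratic character sums over a finite field, with an unspecified constant. -/
theorem weil_quadratic (hch : ringChar K ≠ 2) {f : K[X]} (hf : f.Monic) (hns : ¬ IsSquare f) :
    |((∑ x : K, quadraticChar K (f.eval x) : ℤ) : ℝ)|
      ≤ 27 * f.natDegree * √(Fintype.card K : ℝ) := by
  set m := f.natDegree with hm
  set Q := Fintype.card K with hQdef
  have hm1 : 1 ≤ m := by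
    by_contra h
    have : f = 1 := hf.natDegree_eq_zero.1 (by omega)
    exact hns (this ▸ IsSquare.one)
  have hm1' : (1 : ℝ) ≤ m := by exact_mod_cast hm1
  have hQ1 : 1 < Q := Fintype.one_lt_card
  have hQ1' : (1 : ℝ) < Q := by exact_mod_cast hQ1
  set w := √(Q : ℝ) with hw
  have hww : w * w = Q := Real.mul_self_sqrt (by positivity)
  have hw1 : 1 < w := by rw [hw]; exact Real.lt_sqrt_of_sq_lt (by simpa using hQ1')
  have triv : |((∑ x : K, quadraticChar K (f.eval x) : ℤ) : ℝ)| ≤ Q := by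
    rw [← Int.cast_abs]
    have : |∑ x : K, quadraticChar K (f.eval x)| ≤ (Q : ℤ) := by
      refine (Finset.abs_sum_le_sum_abs _ _).trans ?_
      rw [hQdef, Fintype.card, Finset.card_eq_sum_ones]
      push_cast
      refine Finset.sum_le_sum fun x _ => ?_
      by_cases h : f.eval x = 0
      · simp [h]
      · rcases quadraticChar_dichotomy h with h1 | h1 <;> simp [h1]
    exact_mod_cast this
  by_cases hQm : Q < 8 * m
  · have : (Q : ℝ) ≤ 8 * m := by exact_mod_cast hQm.le
    nlinarith
  by_cases hQ64 : Q < 64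
  · have h1 : w ≤ 8 := by
      rw [hw, show (8 : ℝ) = √64 by rw [show (64 : ℝ) = 8 ^ 2 by norm_num]; simp]
      exact Real.sqrt_le_sqrt (by exact_mod_cast hQ64.le)
    nlinarith [mul_pos (show (0:ℝ) < m by linarith) (show 0 < w by linarith)]
  push Not at hQm hQ64
  -- translate so that the constant coefficient does not vanish
  obtain ⟨x0, hx0⟩ : ∃ x0 : K, f.eval x0 ≠ 0 := by
    by_contra hcon
    push Not at hcon
    have := card_le_degree_of_subset_roots (p := f) (Z := Finset.univ) (by
      intro x _
      rw [mem_roots hf.ne_zero]; exact hcon x)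
    rw [Finset.card_univ] at this
    omega
  set F := f.comp (X + C x0) with hF
  have hFm : F.Monic := hf.comp_X_add_C x0
  have hFd : F.natDegree = m := by rw [hF, natDegree_comp]; simp [hm]
  have hFns : ¬ IsSquare F := by
    rintro ⟨g, hg⟩
    refine hns ⟨g.comp (X - C x0), ?_⟩
    rw [← mul_comp, ← hg, hF, comp_assoc]; simp
  have hF0 : F.eval 0 ≠ 0 := by simpa [hF] using hx0
  have hsum : ∑ x : K, quadraticChar K (f.eval x) = ∑ x : K, quadraticChar K (F.eval x) := by
    refine (Fintype.sum_equiv (Equiv.addRight x0) _ _ fun x => ?_).symm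
    simp [hF]
  rw [hsum]
  have hodd : 2 * (Q / 2) + 1 = Q := by
    have := FiniteField.odd_card_of_char_ne_two hch
    omega
  set c := Q / 2 with hc
  set b := Nat.sqrt Q / 2 with hb
  have hw8 : 8 ≤ w := by
    rw [hw, show (8 : ℝ) = √64 by rw [show (64 : ℝ) = 8 ^ 2 by norm_num]; simp]
    exact Real.sqrt_le_sqrt (by exact_mod_cast hQ64)
  have hb1 : 2 * (b : ℝ) ≤ w := by
    have h1 : 2 * b ≤ Nat.sqrt Q := by omega
    have h2 : ((2 * b : ℕ) : ℝ) ≤ (Nat.sqrt Q : ℝ) := by exact_mod_cast h1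
    push_cast at h2
    exact h2.trans (Real.nat_sqrt_le_real_sqrt)
  have hb2 : w ≤ 4 * b := by
    have h1 : w ≤ Nat.sqrt Q + 1 := Real.real_sqrt_le_nat_sqrt_succ
    have h2 : (Nat.sqrt Q : ℝ) ≤ 2 * b + 1 := by
      have : Nat.sqrt Q ≤ 2 * b + 1 := by omega
      exact_mod_cast this
    linarith
  have hmc : m ≤ c := by omega
  have hQm' : 8 * (m : ℝ) ≤ Q := by exact_mod_cast hQm
  have hcR : 2 * (c : ℝ) + 1 = Q := by exact_mod_cast hodd
  have hDR : ((c - m : ℕ) : ℝ) = c - m := by push_cast [hmc]; ring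
  have hbw : 2 * (b : ℝ) ≤ Q := by nlinarith
  have main := quadraticChar_le_of_count F hFm.ne_zero hch (B := m + 12 * m * w) (by
    intro a ha
    have := stepanov_count hFm hFns hF0 (c := c) (D := c - m) (l := 2 * b) (J := b + 5 * m)
      hodd (by rw [hFd]; omega) (by
        exact_mod_cast hbw) (by
        rw [hFd]
        have := weil_numeric_count hm1' hDR hww hb1 hw8 hb2 hQm' hcR
        exact_mod_cast this) ha
    rw [hFd] at this
    have h1 : (2 * b : ℝ) * ((Finset.univ.filter fun x : K => (F.eval x) ^ c = a).card : ℝ)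
        ≤ 2 * b * m + ((c - m : ℕ) + c * m) + (b + 5 * m) * Q := by exact_mod_cast this
    exact weil_numeric_bound hm1' hDR hww hw8 hb2 hcR h1)
  rw [hFd] at main
  refine main.trans ?_
  nlinarith

end Stepanov

section FiniteSets

variable {q : ℕ} [Fact q.Prime]

lemma degree_polyLT_lt (n : ℕ) (v : Fin n → ZMod q) : (polyLT q n v).degree < n := by
  unfold polyLT
  exact degree_sum_fin_lt v

lemma polyLT_coeff (n : ℕ) (v : Fin n → ZMod q) (i : Fin n) : (polyLT q n v).coeff i = v i :=
  polyOfVec_coeff n v i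

lemma polyLT_injective (n : ℕ) : Function.Injective (polyLT q n) := fun v w h => by
  ext i
  rw [← polyLT_coeff n v i, h, polyLT_coeff]

lemma monicOfDeg_eq (n : ℕ) (v : Fin n → ZMod q) : monicOfDeg q n v = X ^ n + polyLT q n v := rfl

lemma monicOfDeg_injective (n : ℕ) : Function.Injective (monicOfDeg q n) := fun v w h => by
  rw [monicOfDeg_eq, monicOfDeg_eq, add_right_inj] at h
  exact polyLT_injective n h

lemma exists_polyLT_eq {n : ℕ} {f : (ZMod q)[X]} (hf : f.degree < n) :
    ∃ v, polyLT q n v = f := by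
  refine ⟨fun i => f.coeff i, ?_⟩
  ext i
  by_cases hi : i < n
  · exact polyLT_coeff n _ ⟨i, hi⟩
  · rw [coeff_eq_zero_of_degree_lt
        ((degree_polyLT_lt n _).trans_le (by exact_mod_cast not_lt.1 hi)),
      coeff_eq_zero_of_degree_lt (hf.trans_le (by exact_mod_cast not_lt.1 hi))]

variable (q) in
/-- The monic polynomials of degree `n`. -/
def monicFin (n : ℕ) : Finset (ZMod q)[X] := Finset.univ.image (monicOfDeg q n)

variable (q) in
/-- The polynomials of degree less than `n`. -/
def ltFin (n : ℕ) : Finset (ZMod q)[X] := Finset.univ.image (polyLT q n)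

lemma mem_ltFin {n : ℕ} {f : (ZMod q)[X]} : f ∈ ltFin q n ↔ f.degree < n := by
  simp only [ltFin, Finset.mem_image, Finset.mem_univ, true_and]
  exact ⟨fun ⟨v, hv⟩ => hv ▸ degree_polyLT_lt n v, exists_polyLT_eq⟩

lemma mem_monicFin {n : ℕ} {f : (ZMod q)[X]} : f ∈ monicFin q n ↔ f.Monic ∧ f.natDegree = n := by
  simp only [monicFin, Finset.mem_image, Finset.mem_univ, true_and, monicOfDeg_eq]
  constructor
  · rintro ⟨v, rfl⟩
    exact ⟨monic_X_pow_add (degree_polyLT_lt n v), by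
      rw [natDegree_add_eq_left_of_degree_lt, natDegree_X_pow]
      rw [degree_X_pow]; exact degree_polyLT_lt n v⟩
  · rintro ⟨hm, rfl⟩
    obtain ⟨v, hv⟩ := exists_polyLT_eq (q := q) (n := f.natDegree) (f := f - X ^ f.natDegree) (by
      rw [← degree_eq_natDegree hm.ne_zero]
      exact degree_sub_lt_left (by rw [degree_X_pow, degree_eq_natDegree hm.ne_zero]) hm.ne_zero
        (by rw [hm.leadingCoeff, (monic_X_pow _).leadingCoeff]))
    exact ⟨v, by rw [hv]; ring⟩

lemma card_monicFin (n : ℕ) : (monicFin q n).card = q ^ n := by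
  rw [monicFin, Finset.card_image_of_injective _ (monicOfDeg_injective n), Finset.card_univ]
  simp [ZMod.card]

lemma card_ltFin (n : ℕ) : (ltFin q n).card = q ^ n := by
  rw [ltFin, Finset.card_image_of_injective _ (polyLT_injective n), Finset.card_univ]
  simp [ZMod.card]

lemma sum_monicFin {M : Type*} [AddCommMonoid M] (n : ℕ) (F : (ZMod q)[X] → M) :
    ∑ f ∈ monicFin q n, F f = ∑ v : Fin n → ZMod q, F (monicOfDeg q n v) :=
  Finset.sum_image fun _ _ _ _ h => monicOfDeg_injective n h

variable (q) in
/-- The monic irreducible polynomials of degree `n`. -/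
def irrFin (n : ℕ) : Finset (ZMod q)[X] := (monicFin q n).filter Irreducible

lemma mem_irrFin {n : ℕ} {f : (ZMod q)[X]} :
    f ∈ irrFin q n ↔ f.Monic ∧ f.natDegree = n ∧ Irreducible f := by
  rw [irrFin, Finset.mem_filter, mem_monicFin, and_assoc]

variable (q) in
/-- The monic squarefree polynomials of degree `n`. -/
def sqfFin (n : ℕ) : Finset (ZMod q)[X] := (monicFin q n).filter Squarefree

lemma mem_sqfFin {n : ℕ} {f : (ZMod q)[X]} :
    f ∈ sqfFin q n ↔ f.Monic ∧ f.natDegree = n ∧ Squarefree f := by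
  rw [sqfFin, Finset.mem_filter, mem_monicFin, and_assoc]

lemma sumH_eq {M : Type*} [AddCommMonoid M] (g : ℕ) (F : (ZMod q)[X] → M) :
    sumH q g F = ∑ D ∈ sqfFin q (2 * g + 1), F D := by
  rw [sqfFin, Finset.sum_filter, sum_monicFin, sumH]

lemma irrFin_zero : irrFin q 0 = ∅ := by
  ext f
  simp only [mem_irrFin, Finset.notMem_empty, iff_false]
  rintro ⟨hm, hd, hi⟩
  exact hi.not_isUnit (by rw [hm.natDegree_eq_zero.1 hd]; exact isUnit_one)

end FiniteSets

section Symbol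

variable {q : ℕ} [Fact q.Prime]

/-- A root of an irreducible polynomial generates the finite field of the matching cardinality. -/
lemma exists_aeval_eq {K : Type*} [Field K] [Algebra (ZMod q) K] {P : (ZMod q)[X]}
    (hP : P.Monic) (hi : Irreducible P) [Fintype K] (hK : Fintype.card K = q ^ P.natDegree) {x : K}
    (hx : aeval x P = 0) (y : K) : ∃ f : (ZMod q)[X], f.degree < P.degree ∧ aeval x f = y := by
  have hmin : P = minpoly (ZMod q) x := minpoly.eq_of_irreducible_of_monic hi hx hP
  have hinj : Function.Injective fun v : Fin P.natDegree → ZMod q =>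
      aeval x (polyLT q P.natDegree v) := by
    intro v w h
    apply polyLT_injective
    rw [← sub_eq_zero]
    by_contra hne
    have h1 : aeval x (polyLT q P.natDegree v - polyLT q P.natDegree w) = 0 := by
      rw [map_sub, sub_eq_zero]; exact h
    have h2 := minpoly.degree_le_of_ne_zero (ZMod q) x hne h1
    rw [← hmin] at h2
    refine absurd (h2.trans_lt ?_) (lt_irrefl P.degree)
    rw [degree_eq_natDegree hP.ne_zero]
    exact (degree_sub_le _ _).trans_lt (max_lt (degree_polyLT_lt _ _) (degree_polyLT_lt _ _))
  have hbij := (Fintype.bijective_iff_injective_and_card _).2 ⟨hinj, by simp [hK, ZMod.card]⟩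
  obtain ⟨v, hv⟩ := hbij.2 y
  exact ⟨_, by rw [degree_eq_natDegree hP.ne_zero]; exact degree_polyLT_lt _ v, hv⟩

lemma resSym_eq_quadraticChar {K : Type*} [Field K] [Algebra (ZMod q) K] {P : (ZMod q)[X]}
    (hP : P.Monic) (hi : Irreducible P) [Fintype K] (hK : Fintype.card K = q ^ P.natDegree) {x : K}
    (hx : aeval x P = 0) (f : (ZMod q)[X]) : resSym q f P = quadraticChar K (aeval x f) := by
  have hmin : P = minpoly (ZMod q) x := minpoly.eq_of_irreducible_of_monic hi hx hP
  have hdvd : ∀ f, P ∣ f ↔ aeval x f = 0 := fun f => by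
    rw [hmin]; exact (minpoly.dvd_iff)
  have hsq : (∃ b, P ∣ f - b ^ 2) ↔ IsSquare (aeval x f) := by
    constructor
    · rintro ⟨b, hb⟩
      rw [hdvd, map_sub, sub_eq_zero, map_pow] at hb
      exact ⟨aeval x b, by rw [hb, sq]⟩
    · rintro ⟨y, hy⟩
      obtain ⟨b, -, hb⟩ := exists_aeval_eq hP hi hK hx y
      exact ⟨b, by rw [hdvd, map_sub, map_pow, hb, hy]; ring⟩
  rw [resSym, quadraticChar_apply, quadraticCharFun]
  simp only [hsq]
  simp only [hdvd]

lemma card_adjoinRoot {P : (ZMod q)[X]} (hP : P.Monic) :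
    Nat.card (AdjoinRoot P) = q ^ P.natDegree := by
  rw [← Nat.card_congr (AdjoinRoot.powerBasis' hP).basis.equivFun.toEquiv.symm]
  simp

lemma exists_field_root {P : (ZMod q)[X]} (hP : P.Monic) (hi : Irreducible P) :
    ∃ (K : Type) (_ : Field K) (_ : Algebra (ZMod q) K) (_ : Fintype K) (x : K),
      Fintype.card K = q ^ P.natDegree ∧ aeval x P = 0 := by
  have : Fact (Irreducible P) := ⟨hi⟩
  have hc := card_adjoinRoot hP
  have : Finite (AdjoinRoot P) := Nat.finite_of_card_ne_zero (by
    rw [hc]; exact pow_ne_zero _ (Fact.out : q.Prime).ne_zero)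
  have := Fintype.ofFinite (AdjoinRoot P)
  refine ⟨AdjoinRoot P, inferInstance, inferInstance, inferInstance, AdjoinRoot.root P, ?_, ?_⟩
  · rw [← hc, Nat.card_eq_fintype_card]
  · rw [AdjoinRoot.aeval_eq, AdjoinRoot.mk_self]

lemma resSym_mul {P : (ZMod q)[X]} (hP : P.Monic) (hi : Irreducible P) (a b : (ZMod q)[X]) :
    resSym q (a * b) P = resSym q a P * resSym q b P := by
  obtain ⟨K, _, _, _, x, hK, hx⟩ := exists_field_root hP hi
  simp only [resSym_eq_quadraticChar hP hi hK hx, map_mul]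

lemma resSym_one {P : (ZMod q)[X]} (hP : P.Monic) (hi : Irreducible P) : resSym q 1 P = 1 := by
  obtain ⟨K, _, _, _, x, hK, hx⟩ := exists_field_root hP hi
  simp only [resSym_eq_quadraticChar hP hi hK hx, map_one]

lemma abs_resSym_le (a P : (ZMod q)[X]) : |resSym q a P| ≤ 1 := by
  unfold resSym; split_ifs <;> simp

lemma resSym_sq {P : (ZMod q)[X]} (hP : P.Monic) (hi : Irreducible P) (a : (ZMod q)[X]) :
    resSym q (a ^ 2) P = if P ∣ a then 0 else 1 := by
  rw [sq, resSym_mul hP hi]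
  unfold resSym; split_ifs <;> simp

lemma resSym_pow {P : (ZMod q)[X]} (hP : P.Monic) (hi : Irreducible P) (a : (ZMod q)[X]) (k : ℕ) :
    resSym q (a ^ k) P = resSym q a P ^ k := by
  induction k with
  | zero => simp [resSym_one hP hi]
  | succ k ih => rw [pow_succ, resSym_mul hP hi, ih, pow_succ]

lemma resSym_eq_of_dvd_sub {P : (ZMod q)[X]} (hP : P.Monic) (hi : Irreducible P)
    {a b : (ZMod q)[X]} (h : P ∣ a - b) : resSym q a P = resSym q b P := by
  obtain ⟨K, _, _, _, x, hK, hx⟩ := exists_field_root hP hi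
  have hmin : P = minpoly (ZMod q) x := minpoly.eq_of_irreducible_of_monic hi hx hP
  have : aeval x a = aeval x b := by
    rw [← sub_eq_zero, ← map_sub, ← minpoly.dvd_iff, ← hmin]; exact h
  simp only [resSym_eq_quadraticChar hP hi hK hx, this]

end Symbol

section PrimeSums

lemma exists_squarefree_mul_sq {F : Type*} [Field F] {f : F[X]} (hf : f.Monic) :
    ∃ D h : F[X], D.Monic ∧ h.Monic ∧ Squarefree D ∧ f = D * h ^ 2 := by
  induction hn : f.natDegree using Nat.strong_induction_on generalizing f with
  | _ n ih =>
    by_cases hs : Squarefree f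
    · exact ⟨f, 1, hf, monic_one, hs, by simp⟩
    rw [Squarefree] at hs
    push Not at hs
    obtain ⟨x, ⟨y, hy⟩, hu⟩ := hs
    have hx0 : x ≠ 0 := by
      rintro rfl
      exact hf.ne_zero (by simpa using hy)
    have hl : x.leadingCoeff ≠ 0 := leadingCoeff_ne_zero.2 hx0
    set z := x * C x.leadingCoeff⁻¹ with hz
    have hzm : z.Monic := monic_mul_leadingCoeff_inv hx0
    set w := y * C (x.leadingCoeff ^ 2) with hw
    have hfw : f = z ^ 2 * w := by
      rw [hy, hz, hw]
      have : C x.leadingCoeff⁻¹ ^ 2 * C (x.leadingCoeff ^ 2) = 1 := by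
        rw [← C_pow, ← C_mul, ← mul_pow, inv_mul_cancel₀ hl]; simp
      linear_combination (-(x * x * y)) * this
    have hwm : w.Monic := (hzm.pow 2).of_mul_monic_left (hfw ▸ hf)
    have hzd : z.natDegree = x.natDegree := natDegree_mul_leadingCoeff_inv x hx0
    have hxd : 1 ≤ x.natDegree := by
      by_contra h
      exact hu (isUnit_iff_degree_eq_zero.2 (by
        rw [degree_eq_natDegree hx0]; simp; omega))
    have hd : n = 2 * z.natDegree + w.natDegree := by
      rw [← hn, hfw, (hzm.pow 2).natDegree_mul hwm, hzm.natDegree_pow]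
    obtain ⟨D, h, hD, hh, hsq, he⟩ := ih w.natDegree (by omega) hwm rfl
    exact ⟨D, z * h, hD, hzm.mul hh, hsq, by rw [hfw, he]; ring⟩

/-- A monic nonsquare over a perfect field stays a nonsquare over any extension. -/
lemma not_isSquare_map {F K : Type*} [Field F] [PerfectField F] [Field K] [Algebra F K] {f : F[X]}
    (hf : f.Monic) (hns : ¬ IsSquare f) : ¬ IsSquare (f.map (algebraMap F K)) := by
  rintro ⟨s, hs⟩
  obtain ⟨D, h, hD, hh, hsq, rfl⟩ := exists_squarefree_mul_sq hf
  have hsep : (D.map (algebraMap F K)).Separable :=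
    (PerfectField.separable_iff_squarefree.2 hsq).map
  rw [Polynomial.map_mul, Polynomial.map_pow] at hs
  have h1 : h.map (algebraMap F K) ∣ s := by
    rw [← IsIntegrallyClosed.pow_dvd_pow_iff two_ne_zero]
    exact ⟨_, by rw [sq s, ← hs, mul_comm]⟩
  obtain ⟨t, rfl⟩ := h1
  have hh0 : h.map (algebraMap F K) ≠ 0 := (hh.map _).ne_zero
  have h2 : D.map (algebraMap F K) = t * t := by
    apply mul_right_cancel₀ (pow_ne_zero 2 hh0)
    rw [hs]; ring
  have h3 : IsUnit t := hsep.squarefree t ⟨1, by rw [h2, mul_one]⟩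
  have h4 : IsUnit (D.map (algebraMap F K)) := h2 ▸ h3.mul h3
  have h5 : D.natDegree = 0 := by
    rw [← natDegree_map (algebraMap F K)]; exact natDegree_eq_zero_of_isUnit h4
  rw [hD.natDegree_eq_zero.1 h5, one_mul] at hns
  exact hns ⟨h, sq h⟩

variable {q : ℕ} [Fact q.Prime]

section

variable {K : Type*} [Field K] [Algebra (ZMod q) K] [Fintype K]

lemma card_roots_irreducible {n : ℕ} (hK : Fintype.card K = q ^ n) {P : (ZMod q)[X]}
    (hP : P ∈ irrFin q n) : (Finset.univ.filter fun x : K => aeval x P = 0).card = n := by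
  obtain ⟨hm, hd, hi⟩ := mem_irrFin.1 hP
  have h1 : P.map (algebraMap (ZMod q) K) ∣ X ^ Fintype.card K - X := by
    have := hi.natDegree_dvd_iff_dvd_X_pow_card_pow_sub_X.1 (dvd_of_eq hd)
    rw [Nat.card_zmod, ← hK] at this
    simpa using Polynomial.map_dvd (algebraMap (ZMod q) K) this
  have hne : (X ^ Fintype.card K - X : K[X]) ≠ 0 :=
    FiniteField.X_pow_card_sub_X_ne_zero _ Fintype.one_lt_card
  have hspl : (X ^ Fintype.card K - X : K[X]).Splits := by
    simpa using FiniteField.splits_X_pow_card_sub_X q (K := K)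
  have h2 := splits_iff_card_roots.1 (hspl.of_dvd hne h1)
  have h3 : (P.map (algebraMap (ZMod q) K)).roots.Nodup := by
    refine Multiset.nodup_of_le (roots.le_of_dvd hne h1) ?_
    rw [FiniteField.roots_X_pow_card_sub_X]
    exact Finset.univ.nodup
  rw [natDegree_map, hd] at h2
  rw [← h2, ← Multiset.toFinset_card_of_nodup h3]
  congr 1
  ext x
  rw [Finset.mem_filter, Multiset.mem_toFinset,
    mem_roots (Polynomial.map_ne_zero hm.ne_zero), IsRoot.def, aeval_def, eval₂_eq_eval_map]
  exact and_iff_right (Finset.mem_univ x)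

lemma sum_irrFin_resSym {n : ℕ} (hK : Fintype.card K = q ^ n) (f : (ZMod q)[X]) :
    ∑ P ∈ irrFin q n, (n : ℤ) * resSym q f P
      = ∑ x ∈ Finset.univ.filter (fun x : K => (minpoly (ZMod q) x).natDegree = n),
          quadraticChar K (aeval x f) := by
  rw [← Finset.sum_fiberwise_of_maps_to (t := irrFin q n) (g := fun x : K => minpoly (ZMod q) x)]
  · refine Finset.sum_congr rfl fun P hP => ?_
    obtain ⟨hm, hd, hi⟩ := mem_irrFin.1 hP
    rw [← hd] at hK
    have hset : (Finset.univ.filter (fun x : K => (minpoly (ZMod q) x).natDegree = n)).filter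
        (fun x => minpoly (ZMod q) x = P) = Finset.univ.filter fun x : K => aeval x P = 0 := by
      ext x
      simp only [Finset.mem_filter, Finset.mem_univ, true_and]
      constructor
      · rintro ⟨-, rfl⟩
        exact minpoly.aeval _ _
      · intro hx
        rw [← minpoly.eq_of_irreducible_of_monic hi hx hm]
        exact ⟨hd, rfl⟩
    rw [hset, Finset.sum_congr rfl (g := fun _ => resSym q f P), Finset.sum_const,
      card_roots_irreducible (hd ▸ hK) hP, nsmul_eq_mul]
    · intro x hx
      exact (resSym_eq_quadraticChar hm hi hK (Finset.mem_filter.1 hx).2 f).symm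
  · intro x hx
    have hint : IsIntegral (ZMod q) x := Algebra.IsIntegral.isIntegral x
    exact mem_irrFin.2 ⟨minpoly.monic hint, (Finset.mem_filter.1 hx).2, minpoly.irreducible hint⟩

lemma card_minpoly_degree_ne {n : ℕ} (hn : 1 ≤ n) (hK : Fintype.card K = q ^ n) :
    (Finset.univ.filter (fun x : K => (minpoly (ZMod q) x).natDegree ≠ n)).card
      ≤ 2 * q ^ (n / 2) := by
  have hq := (Fact.out : q.Prime).two_le
  have hsub : (Finset.univ.filter (fun x : K => (minpoly (ZMod q) x).natDegree ≠ n)) ⊆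
      (Finset.Icc 1 (n / 2)).biUnion fun e => (X ^ q ^ e - X : K[X]).roots.toFinset := by
    intro x hx
    rw [Finset.mem_filter] at hx
    have hint : IsIntegral (ZMod q) x := Algebra.IsIntegral.isIntegral x
    have hi := minpoly.irreducible hint
    have hpos := minpoly.natDegree_pos hint
    have hdvd : ∀ m, (minpoly (ZMod q) x).natDegree ∣ m ↔ x ^ q ^ m = x := by
      intro m
      rw [hi.natDegree_dvd_iff_dvd_X_pow_card_pow_sub_X, minpoly.dvd_iff, Nat.card_zmod]
      simp [sub_eq_zero]
    obtain ⟨c, hc⟩ := (hdvd n).2 (by rw [← hK]; exact FiniteField.pow_card x)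
    have hc2 : 2 ≤ c := by
      rcases c with _ | _ | c
      · omega
      · exact absurd (by omega) hx.2
      · omega
    have hle : (minpoly (ZMod q) x).natDegree ≤ n / 2 := by
      rw [Nat.le_div_iff_mul_le two_pos, hc]
      exact Nat.mul_le_mul_left _ hc2
    rw [Finset.mem_biUnion]
    refine ⟨(minpoly (ZMod q) x).natDegree, Finset.mem_Icc.2 ⟨hpos, hle⟩, ?_⟩
    rw [Multiset.mem_toFinset, mem_roots (FiniteField.X_pow_card_pow_sub_X_ne_zero K hpos.ne' hq)]
    simp [(hdvd _).1 dvd_rfl]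
  refine (Finset.card_le_card hsub).trans (Finset.card_biUnion_le.trans ?_)
  refine (Finset.sum_le_sum (g := fun e => q ^ e) fun e he => ?_).trans ?_
  · refine (Multiset.toFinset_card_le _).trans ((card_roots' _).trans ?_)
    rw [FiniteField.X_pow_card_pow_sub_X_natDegree_eq K (by
      have := (Finset.mem_Icc.1 he).1; omega) hq]
  · have key : ∀ m, ∑ e ∈ Finset.Icc 1 m, q ^ e ≤ 2 * q ^ m := by
      intro m
      induction m with
      | zero => simp
      | succ m ih =>
        rw [Finset.sum_Icc_succ_top (by omega), pow_succ]
        nlinarith [Nat.mul_le_mul_left (q ^ m) hq]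
    exact key _

end

lemma exists_field_card {n : ℕ} (hn : 1 ≤ n) :
    ∃ (K : Type) (_ : Field K) (_ : Algebra (ZMod q) K) (_ : Fintype K),
      Fintype.card K = q ^ n := by
  have := Fintype.ofFinite (GaloisField q n)
  exact ⟨GaloisField q n, inferInstance, inferInstance, inferInstance, by
    rw [← Nat.card_eq_fintype_card, GaloisField.card q n (by omega)]⟩

lemma sqrt_natCast_pow (n : ℕ) : √((q : ℝ) ^ n) = (q : ℝ) ^ ((n : ℝ) / 2) := by
  rw [Real.sqrt_eq_rpow, ← Real.rpow_natCast, ← Real.rpow_mul (by positivity)]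
  congr 1; ring

/-- Prime polynomial theorem for quadratic symbols. -/
theorem prime_sum_bound (hq2 : q ≠ 2) {n : ℕ} (hn : 1 ≤ n) {f : (ZMod q)[X]} (hf : f.Monic) :
    |∑ P ∈ irrFin q n, (n : ℝ) * (resSym q f P : ℝ) - if IsSquare f then (q : ℝ) ^ n else 0|
      ≤ 30 * (1 + f.natDegree) * (q : ℝ) ^ ((n : ℝ) / 2) := by
  obtain ⟨K, _, _, _, hK⟩ := exists_field_card (q := q) hn
  have hq1 : (1 : ℝ) ≤ q := by exact_mod_cast (Fact.out : q.Prime).one_le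
  have : CharP K q := charP_of_injective_algebraMap (algebraMap (ZMod q) K).injective q
  have hch : ringChar K ≠ 2 := by rwa [ringChar.eq K q]
  set w := (q : ℝ) ^ ((n : ℝ) / 2) with hw
  have hw1 : 1 ≤ w := Real.one_le_rpow hq1 (by positivity)
  have hsum : ((∑ x : K, quadraticChar K (aeval x f) : ℤ) : ℝ)
      = ∑ P ∈ irrFin q n, (n : ℝ) * (resSym q f P : ℝ)
        + ∑ x ∈ Finset.univ.filter (fun x : K => ¬ (minpoly (ZMod q) x).natDegree = n),
          ((quadraticChar K (aeval x f) : ℤ) : ℝ) := by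
    have := sum_irrFin_resSym hK f
    rw [← Finset.sum_filter_add_sum_filter_not Finset.univ
      (fun x : K => (minpoly (ZMod q) x).natDegree = n), ← this]
    push_cast
    rfl
  have habs : ∀ y : K, |((quadraticChar K y : ℤ) : ℝ)| ≤ 1 := by
    intro y
    by_cases h : y = 0
    · simp [h]
    · rcases quadraticChar_dichotomy h with h1 | h1 <;> simp [h1]
  have hbad : |∑ x ∈ Finset.univ.filter (fun x : K => ¬ (minpoly (ZMod q) x).natDegree = n),
          ((quadraticChar K (aeval x f) : ℤ) : ℝ)| ≤ 2 * w := by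
    refine (Finset.abs_sum_le_sum_abs _ _).trans ?_
    refine (Finset.sum_le_card_nsmul _ _ 1 fun x _ => habs _).trans ?_
    rw [nsmul_eq_mul, mul_one]
    have h1 := card_minpoly_degree_ne hn hK
    have h2 : (q : ℝ) ^ (n / 2) ≤ w := by
      rw [hw, ← Real.rpow_natCast]
      exact Real.rpow_le_rpow_of_exponent_le hq1 Nat.cast_div_le
    have h3 :
        (((Finset.univ.filter (fun x : K => ¬ (minpoly (ZMod q) x).natDegree = n)).card : ℕ) : ℝ)
        ≤ 2 * (q : ℝ) ^ (n / 2) := by exact_mod_cast h1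
    linarith
  have hmain : |((∑ x : K, quadraticChar K (aeval x f) : ℤ) : ℝ)
      - if IsSquare f then (q : ℝ) ^ n else 0| ≤ 27 * f.natDegree * w := by
    by_cases hs : IsSquare f
    · rw [if_pos hs]
      obtain ⟨h, rfl⟩ := hs
      have hh : h ≠ 0 := by rintro rfl; simpa using hf.ne_zero
      have h1 : ((∑ x : K, quadraticChar K (aeval x (h * h)) : ℤ) : ℝ)
          = (q : ℝ) ^ n - ((Finset.univ.filter fun x : K => aeval x h = 0).card : ℝ) := by
        have h2 : (q : ℝ) ^ n = ∑ x : K, (1 : ℝ) := by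
          rw [Finset.sum_const, Finset.card_univ, hK]; simp
        rw [h2, Finset.card_filter]
        push_cast
        rw [← Finset.sum_sub_distrib]
        refine Finset.sum_congr rfl fun x _ => ?_
        by_cases hx : aeval x h = 0
        · simp [hx]
        · rw [map_mul, map_mul]
          rcases quadraticChar_dichotomy hx with h1 | h1 <;> simp [h1, hx]
      rw [h1, sub_sub_cancel_left, abs_neg, Nat.abs_cast]
      have h3 : (Finset.univ.filter fun x : K => aeval x h = 0).card ≤ h.natDegree := by
        refine (Finset.card_le_card (t := (h.map (algebraMap (ZMod q) K)).roots.toFinset) ?_).trans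
          ((Multiset.toFinset_card_le _).trans (card_roots_map_le_natDegree h))
        intro x hx
        have := (Finset.mem_filter.1 hx).2
        rw [Multiset.mem_toFinset, mem_roots (by
          rwa [Ne, Polynomial.map_eq_zero]), IsRoot.def, ← eval₂_eq_eval_map]
        exact this
      have h4 : ((Finset.univ.filter fun x : K => aeval x h = 0).card : ℝ) ≤ h.natDegree := by
        exact_mod_cast h3
      rw [natDegree_mul hh hh]
      push_cast
      nlinarith [(Nat.cast_nonneg h.natDegree : (0 : ℝ) ≤ h.natDegree)]
    · rw [if_neg hs, sub_zero]
      have hpf : PerfectField (ZMod q) := inferInstance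
      have := weil_quadratic hch (hf.map (algebraMap (ZMod q) K)) (not_isSquare_map hf hs)
      rw [natDegree_map, hK] at this
      push_cast [sqrt_natCast_pow] at this
      rw [hw]
      simpa [eval_map_algebraMap] using this
  have e : ∑ P ∈ irrFin q n, (n : ℝ) * (resSym q f P : ℝ) - (if IsSquare f then (q : ℝ) ^ n else 0)
      = (((∑ x : K, quadraticChar K (aeval x f) : ℤ) : ℝ) - if IsSquare f then (q : ℝ) ^ n else 0)
        - ∑ x ∈ Finset.univ.filter (fun x : K => ¬ (minpoly (ZMod q) x).natDegree = n),
          ((quadraticChar K (aeval x f) : ℤ) : ℝ) := by rw [hsum]; ring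
  rw [e]
  refine (abs_sub _ _).trans ?_
  nlinarith [(Nat.cast_nonneg f.natDegree : (0 : ℝ) ≤ f.natDegree)]

lemma card_irrFin_le {n : ℕ} (hn : 1 ≤ n) : n * (irrFin q n).card ≤ q ^ n := by
  obtain ⟨K, _, _, _, hK⟩ := exists_field_card (q := q) hn
  have h := sum_irrFin_resSym hK (1 : (ZMod q)[X])
  have h1 : ∑ P ∈ irrFin q n, (n : ℤ) * resSym q 1 P = n * (irrFin q n).card := by
    rw [Finset.sum_congr rfl (g := fun _ => (n : ℤ))]
    · simp [mul_comm]
    · intro P hP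
      obtain ⟨hm, -, hi⟩ := mem_irrFin.1 hP
      simp [resSym_one hm hi]
  rw [h1] at h
  have h2 : (n * (irrFin q n).card : ℤ) ≤ q ^ n := by
    rw [h]
    simp only [map_one, Finset.sum_const, nsmul_eq_mul, mul_one]
    rw [show ((q : ℤ) ^ n) = (Fintype.card K : ℤ) by rw [hK]; push_cast; rfl]
    exact_mod_cast Finset.card_le_univ _
  exact_mod_cast h2

end PrimeSums

section GaussSums

variable {q : ℕ} [Fact q.Prime] {P : (ZMod q)[X]}

/-- The coefficient of `t^{-1}` in the expansion of `f/P` at infinity. -/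
def resLin (P f : (ZMod q)[X]) : ZMod q := (f %ₘ P).coeff (P.natDegree - 1)

/-- The additive character attached to `P`. -/
def expSym (P f : (ZMod q)[X]) : ℂ := ZMod.stdAddChar (resLin P f)

lemma resLin_add (f g : (ZMod q)[X]) : resLin P (f + g) = resLin P f + resLin P g := by
  rw [resLin, add_modByMonic, coeff_add]; rfl

lemma expSym_add (f g : (ZMod q)[X]) : expSym P (f + g) = expSym P f * expSym P g := by
  rw [expSym, resLin_add, AddChar.map_add_eq_mul]; rfl

lemma expSym_of_resLin {f : (ZMod q)[X]} (h : resLin P f = 0) : expSym P f = 1 := by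
  rw [expSym, h, AddChar.map_zero_eq_one]

lemma expSym_zero : expSym P 0 = 1 := expSym_of_resLin (by simp [resLin])

lemma resLin_eq_of_dvd_sub (hP : P.Monic) {a b : (ZMod q)[X]} (h : P ∣ a - b) :
    resLin P a = resLin P b := by
  rw [← modByMonic_eq_zero_iff_dvd hP, sub_modByMonic, sub_eq_zero] at h
  rw [resLin, resLin, h]

lemma expSym_eq_of_dvd_sub (hP : P.Monic) {a b : (ZMod q)[X]} (h : P ∣ a - b) :
    expSym P a = expSym P b := by
  rw [expSym, resLin_eq_of_dvd_sub hP h]; rfl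

lemma resLin_of_degree_lt (hP : P.Monic) {f : (ZMod q)[X]} (hf : f.degree < P.degree) :
    resLin P f = f.coeff (P.natDegree - 1) := by
  rw [resLin, (modByMonic_eq_self_iff hP).2 hf]

lemma modByMonic_mem_ltFin (hP : P.Monic) (f : (ZMod q)[X]) :
    f %ₘ P ∈ ltFin q P.natDegree := by
  rw [mem_ltFin, ← degree_eq_natDegree hP.ne_zero]
  exact degree_modByMonic_lt f hP

lemma eq_of_mem_ltFin_of_dvd (hP : P.Monic) {a b : (ZMod q)[X]} (ha : a ∈ ltFin q P.natDegree)
    (hb : b ∈ ltFin q P.natDegree) (h : P ∣ a - b) : a = b := by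
  rw [mem_ltFin, ← degree_eq_natDegree hP.ne_zero] at ha hb
  rw [← sub_eq_zero]
  exact eq_zero_of_dvd_of_degree_lt h ((degree_sub_le _ _).trans_lt (max_lt ha hb))

lemma stdAddChar_ne_one {a : ZMod q} (ha : a ≠ 0) : ZMod.stdAddChar a ≠ (1 : ℂ) := by
  intro h
  apply ha
  apply ZMod.injective_stdAddChar
  rw [h, AddChar.map_zero_eq_one]

/-- Orthogonality of the characters on polynomials of bounded degree. -/
lemma sum_expSym_ltFin (hP : P.Monic) (k : ℕ) {z : (ZMod q)[X]} (hz : z ∈ ltFin q P.natDegree) :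
    ∑ h ∈ ltFin q k, expSym P (z * h)
      = if z ∈ ltFin q (P.natDegree - k) then (q : ℂ) ^ k else 0 := by
  split_ifs with hmem
  · rw [Finset.sum_congr rfl (g := fun _ => (1 : ℂ)), Finset.sum_const, card_ltFin]
    · simp
    · intro h hh
      apply expSym_of_resLin
      by_cases hz0 : z = 0
      · simp [hz0, resLin]
      by_cases hh0 : h = 0
      · simp [hh0, resLin]
      rw [mem_ltFin, degree_eq_natDegree hz0, Nat.cast_lt] at hmem
      rw [mem_ltFin, degree_eq_natDegree hh0, Nat.cast_lt] at hh
      have hd : (z * h).natDegree < P.natDegree - 1 := by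
        rw [natDegree_mul hz0 hh0]; omega
      rw [resLin_of_degree_lt hP (degree_lt_degree (by omega))]
      exact coeff_eq_zero_of_natDegree_lt hd
  · have hz0 : z ≠ 0 := by
      rintro rfl
      exact hmem (mem_ltFin.2 (by simp))
    rw [mem_ltFin, degree_eq_natDegree hz0, Nat.cast_lt] at hmem hz
    obtain ⟨h0, hh0, hne⟩ : ∃ h0 ∈ ltFin q k, expSym P (z * h0) ≠ 1 := by
      refine ⟨X ^ (P.natDegree - 1 - z.natDegree), ?_, ?_⟩
      · rw [mem_ltFin, degree_X_pow, Nat.cast_lt]; omega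
      · have hd : (z * X ^ (P.natDegree - 1 - z.natDegree)).natDegree = P.natDegree - 1 := by
          rw [natDegree_mul hz0 (pow_ne_zero _ X_ne_zero), natDegree_X_pow]; omega
        rw [expSym, resLin_of_degree_lt hP (degree_lt_degree (by omega))]
        apply stdAddChar_ne_one
        nth_rewrite 2 [← hd]
        rw [coeff_natDegree]
        exact leadingCoeff_ne_zero.2 (mul_ne_zero hz0 (pow_ne_zero _ X_ne_zero))
    have hshift : ∑ h ∈ ltFin q k, expSym P (z * h)
        = ∑ h ∈ ltFin q k, expSym P (z * h) * expSym P (z * h0) := by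
      symm
      refine Finset.sum_nbij' (· + h0) (· - h0) ?_ ?_ ?_ ?_ ?_
      · intro h hh
        rw [mem_ltFin] at *
        exact (degree_add_le _ _).trans_lt (max_lt hh hh0)
      · intro h hh
        rw [mem_ltFin] at *
        exact (degree_sub_le _ _).trans_lt (max_lt hh hh0)
      · intro h _; simp
      · intro h _; simp
      · intro h _
        rw [mul_add, expSym_add]
    rw [← Finset.sum_mul] at hshift
    by_contra hS
    exact hne (mul_left_cancel₀ hS (by rw [← hshift, mul_one]))

/-- Reduction of a sum over residues to a sum over the residue field. -/
lemma sum_ltFin_eq_sum_field {K : Type*} [Field K] [Algebra (ZMod q) K] (hP : P.Monic)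
    (hi : Irreducible P) [Fintype K] (hK : Fintype.card K = q ^ P.natDegree) {x : K}
    (hx : aeval x P = 0) {M : Type*} [AddCommMonoid M] (F : K → M) :
    ∑ f ∈ ltFin q P.natDegree, F (aeval x f) = ∑ y : K, F y := by
  have hmin : P = minpoly (ZMod q) x := minpoly.eq_of_irreducible_of_monic hi hx hP
  refine Finset.sum_bij (fun f _ => aeval x f) (fun _ _ => Finset.mem_univ _) ?_ ?_ fun _ _ => rfl
  · intro a ha b hb h
    refine eq_of_mem_ltFin_of_dvd hP ha hb ?_
    rw [hmin, minpoly.dvd_iff, map_sub, sub_eq_zero]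
    exact h
  · intro y _
    obtain ⟨f, hf, hfy⟩ := exists_aeval_eq hP hi hK hx y
    exact ⟨f, mem_ltFin.2 (by rwa [← degree_eq_natDegree hP.ne_zero]), hfy⟩

lemma ringChar_ne_two {K : Type*} [Field K] [Algebra (ZMod q) K] (hq2 : q ≠ 2) :
    ringChar K ≠ 2 := by
  have : CharP K q := charP_of_injective_algebraMap (algebraMap (ZMod q) K).injective q
  rwa [ringChar.eq K q]

lemma sum_resSym_ltFin (hq2 : q ≠ 2) (hP : P.Monic) (hi : Irreducible P) :
    ∑ f ∈ ltFin q P.natDegree, resSym q f P = 0 := by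
  obtain ⟨K, _, _, _, x, hK, hx⟩ := exists_field_root hP hi
  simp only [resSym_eq_quadraticChar hP hi hK hx]
  rw [sum_ltFin_eq_sum_field hP hi hK hx (fun y => quadraticChar K y)]
  exact quadraticChar_sum_zero (ringChar_ne_two hq2)

lemma sum_sq_ltFin (hq2 : q ≠ 2) (hP : P.Monic) (hi : Irreducible P) (E : (ZMod q)[X] → ℂ)
    (hE : ∀ a b, P ∣ a - b → E a = E b) :
    ∑ f ∈ ltFin q P.natDegree, E (f ^ 2)
      = ∑ f ∈ ltFin q P.natDegree, ((resSym q f P : ℂ) + 1) * E f := by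
  obtain ⟨K, _, _, _, x, hK, hx⟩ := exists_field_root hP hi
  have hmin : P = minpoly (ZMod q) x := minpoly.eq_of_irreducible_of_monic hi hx hP
  choose r _ hr using exists_aeval_eq hP hi hK hx
  have hEr : ∀ f, E f = E (r (aeval x f)) := fun f => hE _ _ (by
    rw [hmin, minpoly.dvd_iff, map_sub, hr, sub_self])
  simp only [resSym_eq_quadraticChar hP hi hK hx]
  rw [Finset.sum_congr rfl (g := fun f => E (r ((aeval x f) ^ 2)))
      (fun f _ => by rw [hEr (f ^ 2), map_pow]),
    sum_ltFin_eq_sum_field hP hi hK hx (fun y => E (r (y ^ 2))),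
    Finset.sum_congr rfl (g := fun f => ((quadraticChar K (aeval x f) : ℂ) + 1) * E (r (aeval x f)))
      (fun f _ => by rw [hEr f]),
    sum_ltFin_eq_sum_field hP hi hK hx (fun y => ((quadraticChar K y : ℂ) + 1) * E (r y)),
    ← Finset.sum_fiberwise_of_maps_to (t := Finset.univ) (g := fun y : K => y ^ 2)
      fun _ _ => Finset.mem_univ _]
  refine Finset.sum_congr rfl fun w _ => ?_
  rw [Finset.sum_congr rfl (g := fun _ => E (r w)) (fun y hy => by rw [(Finset.mem_filter.1 hy).2]),
    Finset.sum_const, nsmul_eq_mul]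
  congr 1
  have := quadraticChar_card_sqrts (ringChar_ne_two hq2 : ringChar K ≠ 2) w
  have h2 : (Finset.univ.filter fun y : K => y ^ 2 = w) = {x | x ^ 2 = w}.toFinset := by
    ext y; simp
  rw [h2]
  exact_mod_cast congrArg (Int.cast : ℤ → ℂ) this

/-- The quadratic Gauss sum attached to `P`. -/
def gaussP (P : (ZMod q)[X]) : ℂ :=
  ∑ z ∈ ltFin q P.natDegree, (resSym q z P : ℂ) * expSym P z

lemma gaussP_mul_resSym (hq2 : q ≠ 2) (hP : P.Monic) (hi : Irreducible P) (y : (ZMod q)[X]) :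
    gaussP P * (resSym q y P : ℂ)
      = ∑ z ∈ ltFin q P.natDegree, (resSym q z P : ℂ) * expSym P (z * y) := by
  by_cases hy : P ∣ y
  · have h0 : resSym q y P = 0 := by simp [resSym, hy]
    rw [h0, Int.cast_zero, mul_zero, Finset.sum_congr rfl (g := fun z => ((resSym q z P : ℤ) : ℂ))]
    · have := sum_resSym_ltFin hq2 hP hi
      exact_mod_cast (congrArg (Int.cast : ℤ → ℂ) this).symm
    · intro z _
      rw [expSym_eq_of_dvd_sub hP (b := 0) (by simpa using hy.mul_left z), expSym_zero, mul_one]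
  · have hsq : ((resSym q y P : ℤ) : ℂ) * (resSym q y P : ℂ) = 1 := by
      have := resSym_sq hP hi y
      rw [if_neg hy, sq, resSym_mul hP hi] at this
      exact_mod_cast congrArg (Int.cast : ℤ → ℂ) this
    have hinj : Set.InjOn (fun z => (z * y) %ₘ P) (ltFin q P.natDegree : Set (ZMod q)[X]) := by
      intro a ha b hb h
      refine eq_of_mem_ltFin_of_dvd hP ha hb ?_
      have h1 : P ∣ (a - b) * y := by
        have h2 : (a * y) %ₘ P = (b * y) %ₘ P := h
        rw [sub_mul]
        rw [← modByMonic_eq_zero_iff_dvd hP, sub_modByMonic, h2, sub_self]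
      exact (hi.prime.dvd_or_dvd h1).resolve_right hy
    have hmaps : ∀ z ∈ ltFin q P.natDegree, (z * y) %ₘ P ∈ ltFin q P.natDegree :=
      fun z _ => modByMonic_mem_ltFin hP _
    rw [gaussP, ← Finset.sum_nbij (fun z => (z * y) %ₘ P)
      (f := fun z => ((resSym q z P : ℤ) : ℂ) * (resSym q y P : ℂ) * expSym P (z * y)) hmaps hinj
      (Finset.surjOn_of_injOn_of_card_le _ hmaps hinj le_rfl) ?_]
    · rw [Finset.sum_mul]
      refine Finset.sum_congr rfl fun z _ => ?_
      linear_combination (resSym q z P : ℂ) * expSym P (z * y) * hsq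
    · intro z _
      rw [resSym_eq_of_dvd_sub hP hi (dvd_modByMonic_sub _ P), resSym_mul hP hi,
        expSym_eq_of_dvd_sub hP (dvd_modByMonic_sub _ P)]
      push_cast
      rfl

end GaussSums

section GaussEval

variable {q : ℕ} [Fact q.Prime] {P : (ZMod q)[X]}

lemma add_mem_ltFin {k : ℕ} {a b : (ZMod q)[X]} (ha : a ∈ ltFin q k) (hb : b ∈ ltFin q k) :
    a + b ∈ ltFin q k := by
  rw [mem_ltFin] at *
  exact (degree_add_le _ _).trans_lt (max_lt ha hb)

lemma sub_mem_ltFin {k : ℕ} {a b : (ZMod q)[X]} (ha : a ∈ ltFin q k) (hb : b ∈ ltFin q k) :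
    a - b ∈ ltFin q k := by
  rw [mem_ltFin] at *
  exact (degree_sub_le _ _).trans_lt (max_lt ha hb)

lemma ltFin_mono {k l : ℕ} (h : k ≤ l) : ltFin q k ⊆ ltFin q l := fun f hf => by
  rw [mem_ltFin] at *
  exact hf.trans_le (by exact_mod_cast h)

lemma C_mul_mem_ltFin {k : ℕ} {c : ZMod q} {f : (ZMod q)[X]} (hf : f ∈ ltFin q k) :
    C c * f ∈ ltFin q k := by
  rw [mem_ltFin] at *
  rw [← smul_eq_C_mul]
  exact (degree_smul_le c f).trans_lt hf

lemma coeff_eq_zero_of_mem_ltFin {k : ℕ} {f : (ZMod q)[X]} (hf : f ∈ ltFin q k) : f.coeff k = 0 :=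
  coeff_eq_zero_of_degree_lt (mem_ltFin.1 hf)

lemma coeff_sq_of_mem_ltFin_succ {k : ℕ} {f : (ZMod q)[X]} (hf : f ∈ ltFin q (k + 1)) :
    (f ^ 2).coeff (2 * k) = f.coeff k ^ 2 := by
  have h : f.natDegree ≤ k := by
    rw [mem_ltFin] at hf
    exact natDegree_le_of_degree_le (Order.le_of_lt_succ (by exact_mod_cast hf))
  rw [sq, sq, two_mul, coeff_mul_add_eq_of_natDegree_le h h]

lemma sum_ltFin_succ {M : Type*} [AddCommMonoid M] (k : ℕ) (F : (ZMod q)[X] → M) :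
    ∑ z ∈ ltFin q (k + 1), F z = ∑ c : ZMod q, ∑ h ∈ ltFin q k, F (C c * X ^ k + h) := by
  have hcoeff : ∀ (c : ZMod q), ∀ h ∈ ltFin q k, (C c * X ^ k + h).coeff k = c := by
    intro c h hh
    rw [coeff_add, coeff_C_mul, coeff_X_pow_self, coeff_eq_zero_of_mem_ltFin hh]; simp
  rw [← Finset.sum_product']
  symm
  refine Finset.sum_nbij' (fun x => C x.1 * X ^ k + x.2)
    (fun z => (z.coeff k, z - C (z.coeff k) * X ^ k)) ?_ ?_ ?_ ?_ ?_
  · rintro ⟨c, h⟩ hx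
    rw [Finset.mem_product] at hx
    refine add_mem_ltFin ?_ (ltFin_mono k.le_succ hx.2)
    rw [mem_ltFin]
    exact (degree_C_mul_X_pow_le k c).trans_lt (by exact_mod_cast k.lt_succ_self)
  · intro z hz
    rw [Finset.mem_product]
    refine ⟨Finset.mem_univ _, ?_⟩
    rw [mem_ltFin] at *
    rw [degree_lt_iff_coeff_zero] at *
    intro m hm
    simp only [coeff_sub, coeff_C_mul, coeff_X_pow]
    rcases hm.eq_or_lt with rfl | hm
    · simp
    · rw [hz m (by exact_mod_cast hm), if_neg (by omega)]; simp
  · rintro ⟨c, h⟩ hx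
    rw [Finset.mem_product] at hx
    simp [hcoeff c h hx.2]
  · intro z _; simp
  · intro x _; rfl

lemma sum_ltFin_add_C_mul {M : Type*} [AddCommMonoid M] (k : ℕ) {c : ZMod q} (hc : c ≠ 0)
    (F : (ZMod q)[X] → M) :
    ∑ h ∈ ltFin q k, F (C c * X ^ k + h) = ∑ f ∈ monicFin q k, F (C c * f) := by
  have hcc : C c * C c⁻¹ = (1 : (ZMod q)[X]) := by rw [← C_mul, mul_inv_cancel₀ hc, C_1]
  refine Finset.sum_nbij' (fun h => X ^ k + C c⁻¹ * h) (fun f => C c * (f - X ^ k)) ?_ ?_ ?_ ?_ ?_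
  · intro h hh
    rw [mem_monicFin]
    have := mem_ltFin.1 (C_mul_mem_ltFin (c := c⁻¹) hh)
    exact ⟨monic_X_pow_add this, by
      rw [natDegree_add_eq_left_of_degree_lt, natDegree_X_pow]
      rwa [degree_X_pow]⟩
  · intro f hf
    rw [mem_monicFin] at hf
    apply C_mul_mem_ltFin
    rw [mem_ltFin, ← hf.2, ← degree_eq_natDegree hf.1.ne_zero]
    exact degree_sub_lt_left (by rw [degree_X_pow, degree_eq_natDegree hf.1.ne_zero]) hf.1.ne_zero
        (by rw [hf.1.leadingCoeff, (monic_X_pow _).leadingCoeff])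
  · intro h _
    linear_combination h * hcc
  · intro f _
    linear_combination (f - X ^ k) * hcc
  · intro h _
    congr 1
    linear_combination (-h) * hcc

lemma sum_monicFin_eq_sum_ltFin {M : Type*} [AddCommMonoid M] (k : ℕ) (F : (ZMod q)[X] → M) :
    ∑ f ∈ monicFin q k, F f = ∑ h ∈ ltFin q k, F (X ^ k + h) := by
  have := sum_ltFin_add_C_mul (q := q) k one_ne_zero F
  simpa using this.symm

lemma two_ne_zero_zmod (hq2 : q ≠ 2) : (2 : ZMod q) ≠ 0 := by
  intro h
  have h2 : ((2 : ℕ) : ZMod q) = 0 := by exact_mod_cast h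
  rw [ZMod.natCast_eq_zero_iff] at h2
  exact hq2 ((Nat.prime_dvd_prime_iff_eq Fact.out Nat.prime_two).1 h2)

lemma natDegree_pos_of_irreducible (hi : Irreducible P) : 1 ≤ P.natDegree := hi.natDegree_pos

lemma gaussP_eq_sum_sq (hq2 : q ≠ 2) (hP : P.Monic) (hi : Irreducible P) :
    gaussP P = ∑ z ∈ ltFin q P.natDegree, expSym P (z ^ 2) := by
  have hpos := natDegree_pos_of_irreducible hi
  rw [sum_sq_ltFin hq2 hP hi _ fun a b h => expSym_eq_of_dvd_sub hP h]
  simp only [add_mul, one_mul, Finset.sum_add_distrib]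
  have h1 := sum_expSym_ltFin hP P.natDegree (z := (1 : (ZMod q)[X]))
    (by rw [mem_ltFin, degree_one]; exact_mod_cast hpos)
  rw [if_neg (by rw [mem_ltFin, degree_one]; simp)] at h1
  simp only [one_mul] at h1
  rw [h1, add_zero, gaussP]

lemma expSym_sq_of_mem (hP : P.Monic) {s : ℕ} (hs : 2 * s ≤ P.natDegree) {h : (ZMod q)[X]}
    (hh : h ∈ ltFin q s) : expSym P (h ^ 2) = 1 := by
  apply expSym_of_resLin
  by_cases hh0 : h = 0
  · simp [hh0, resLin]
  rw [mem_ltFin, degree_eq_natDegree hh0, Nat.cast_lt] at hh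
  have hd : (h ^ 2).natDegree < P.natDegree - 1 := by
    rw [natDegree_pow]; omega
  rw [resLin_of_degree_lt hP (degree_lt_degree (by omega))]
  exact coeff_eq_zero_of_natDegree_lt hd

lemma gaussP_eq_half (hq2 : q ≠ 2) (hP : P.Monic) (hi : Irreducible P) {s : ℕ}
    (hs : 2 * s ≤ P.natDegree) :
    gaussP P = ∑ z ∈ ltFin q (P.natDegree - s), expSym P (z ^ 2) := by
  have hq0 : (q : ℂ) ^ s ≠ 0 := pow_ne_zero _ (by exact_mod_cast (Fact.out : q.Prime).ne_zero)
  have hsn : s ≤ P.natDegree := by omega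
  have h2u : IsUnit (C (2 : ZMod q)) := isUnit_C.2 (two_ne_zero_zmod hq2).isUnit
  have hshift : ∀ h ∈ ltFin q s, gaussP P
      = ∑ z ∈ ltFin q P.natDegree, expSym P (z ^ 2) * expSym P (C 2 * z * h) := by
    intro h hh
    have hh' := ltFin_mono hsn hh
    rw [gaussP_eq_sum_sq hq2 hP hi]
    refine Finset.sum_nbij' (· - h) (· + h) (fun z hz => sub_mem_ltFin hz hh')
      (fun z hz => add_mem_ltFin hz hh') (fun z _ => by simp) (fun z _ => by simp) ?_
    intro z _
    have h1 : z ^ 2 = (z - h) ^ 2 + C 2 * (z - h) * h + h ^ 2 := by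
      rw [show (C (2 : ZMod q)) = (2 : (ZMod q)[X]) from rfl]; ring
    rw [h1, expSym_add, expSym_add, expSym_sq_of_mem hP hs hh, mul_one]
  have havg : (q : ℂ) ^ s * gaussP P
      = ∑ z ∈ ltFin q P.natDegree, expSym P (z ^ 2) * ∑ h ∈ ltFin q s, expSym P (C 2 * z * h) := by
    simp only [Finset.mul_sum]
    rw [Finset.sum_comm, ← Finset.sum_congr rfl hshift, Finset.sum_const, card_ltFin]
    simp
  apply mul_left_cancel₀ hq0
  rw [havg, Finset.mul_sum, ← Finset.sum_subset (ltFin_mono (Nat.sub_le P.natDegree s))]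
  · refine Finset.sum_congr rfl fun z hz => ?_
    rw [sum_expSym_ltFin hP s (C_mul_mem_ltFin (ltFin_mono (Nat.sub_le _ _) hz)),
      if_pos (C_mul_mem_ltFin hz), mul_comm]
  · intro z hz hz'
    rw [sum_expSym_ltFin hP s (C_mul_mem_ltFin hz), if_neg, mul_zero]
    intro hmem
    apply hz'
    have := C_mul_mem_ltFin (c := (2 : ZMod q)⁻¹) hmem
    rwa [← mul_assoc, ← C_mul, inv_mul_cancel₀ (two_ne_zero_zmod hq2), C_1, one_mul] at this

lemma gaussP_even (hq2 : q ≠ 2) (hP : P.Monic) (hi : Irreducible P) {s : ℕ}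
    (hs : P.natDegree = 2 * s) : gaussP P = (q : ℂ) ^ s := by
  rw [gaussP_eq_half hq2 hP hi hs.ge, show P.natDegree - s = s by omega,
    Finset.sum_congr rfl fun z hz => expSym_sq_of_mem hP hs.ge hz, Finset.sum_const, card_ltFin]
  simp

variable (q) in
/-- The quadratic Gauss sum of the prime field. -/
def gaussZ : ℂ := ∑ c : ZMod q, ZMod.stdAddChar (c ^ 2)

lemma gaussP_odd (hq2 : q ≠ 2) (hP : P.Monic) (hi : Irreducible P) {s : ℕ}
    (hs : P.natDegree = 2 * s + 1) : gaussP P = (q : ℂ) ^ s * gaussZ q := by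
  rw [gaussP_eq_half hq2 hP hi (s := s) (by omega), show P.natDegree - s = s + 1 by omega,
    Finset.sum_congr rfl (g := fun z => ZMod.stdAddChar (z.coeff s ^ 2)), sum_ltFin_succ,
    gaussZ, Finset.mul_sum]
  · refine Finset.sum_congr rfl fun c _ => ?_
    rw [Finset.sum_congr rfl (g := fun _ => ZMod.stdAddChar (c ^ 2)), Finset.sum_const,
      card_ltFin]
    · simp
    · intro h hh
      rw [coeff_add, coeff_C_mul, coeff_X_pow_self, coeff_eq_zero_of_mem_ltFin hh]; simp
  · intro z hz
    rw [← coeff_sq_of_mem_ltFin_succ hz, expSym, resLin_of_degree_lt hP, hs, Nat.add_sub_cancel]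
    by_cases hz0 : z = 0
    · rw [hz0]; simp [hP.ne_zero, bot_lt_iff_ne_bot]
    rw [mem_ltFin, degree_eq_natDegree hz0, Nat.cast_lt] at hz
    refine degree_lt_degree ?_
    rw [natDegree_pow]; omega

end GaussEval

section FunctionalEquation

variable {q : ℕ} [Fact q.Prime] {P : (ZMod q)[X]}

lemma pow_div_two_eq_geom (hq : q % 2 = 1) (n : ℕ) :
    q ^ n / 2 = (q / 2) * ∑ i ∈ Finset.range n, q ^ i := by
  induction n with
  | zero => simp
  | succ n ih =>
    rw [Finset.sum_range_succ, mul_add, ← ih, pow_succ]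
    have h1 : q ^ n % 2 = 1 := by rw [Nat.pow_mod, hq]; simp
    obtain ⟨a, ha⟩ : ∃ a, q = 2 * a + 1 := ⟨q / 2, by omega⟩
    obtain ⟨b, hb⟩ : ∃ b, q ^ n = 2 * b + 1 := ⟨q ^ n / 2, by omega⟩
    rw [hb]
    have h2 : (2 * b + 1) * q = 2 * (b + a * (2 * b + 1)) + 1 := by rw [ha]; ring
    rw [h2]
    have h3 : q / 2 = a := by omega
    rw [h3]
    omega

lemma prime_mod_two (hq2 : q ≠ 2) : q % 2 = 1 :=
  (Fact.out : q.Prime).eq_two_or_odd.resolve_left hq2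

lemma geom_mod_two (hq : q % 2 = 1) (n : ℕ) : (∑ i ∈ Finset.range n, q ^ i) % 2 = n % 2 := by
  induction n with
  | zero => simp
  | succ n ih =>
    have h1 : q ^ n % 2 = 1 := by rw [Nat.pow_mod, hq]; simp
    rw [Finset.sum_range_succ]; omega

lemma resSym_C (hq2 : q ≠ 2) (hP : P.Monic) (hi : Irreducible P) {c : ZMod q} (hc : c ≠ 0) :
    resSym q (C c) P = quadraticChar (ZMod q) c ^ P.natDegree := by
  obtain ⟨K, _, _, _, x, hK, hx⟩ := exists_field_root hP hi
  have hqo := prime_mod_two hq2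
  have hchK : ringChar K ≠ 2 := ringChar_ne_two hq2
  have hchZ : ringChar (ZMod q) ≠ 2 := by rwa [ZMod.ringChar_zmod_n]
  rw [resSym_eq_quadraticChar hP hi hK hx, aeval_C]
  have hcK : algebraMap (ZMod q) K c ≠ 0 := by simpa using hc
  have h1 : ((quadraticChar K (algebraMap (ZMod q) K c) : ℤ) : K)
      = ((quadraticChar (ZMod q) c ^ P.natDegree : ℤ) : K) := by
    rw [quadraticChar_eq_pow_of_char_ne_two' hchK, hK, pow_div_two_eq_geom hqo, pow_mul,
      ← map_pow]
    have h2 := quadraticChar_eq_pow_of_char_ne_two' hchZ c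
    rw [ZMod.card] at h2
    rw [← h2, map_intCast]
    have h3 := geom_mod_two hqo P.natDegree
    rw [← Int.cast_pow]
    congr 1
    rcases quadraticChar_dichotomy hc with h4 | h4
    · simp [h4]
    · rw [h4]
      rw [neg_one_pow_eq_pow_mod_two, h3, ← neg_one_pow_eq_pow_mod_two]
  rcases quadraticChar_dichotomy hcK with h4 | h4 <;>
    rcases quadraticChar_dichotomy hc with h5 | h5 <;>
    rcases neg_one_pow_eq_or ℤ P.natDegree with h6 | h6 <;>
    rw [h4, h5] at h1 ⊢ <;> simp only [one_pow, h6] at h1 ⊢ <;>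
    exfalso <;> push_cast at h1 <;>
    first
      | exact (Ring.neg_one_ne_one_of_char_ne_two hchK) h1
      | exact (Ring.neg_one_ne_one_of_char_ne_two hchK) h1.symm

/-- The sum of `(f/P)` over the monic polynomials of degree `k`. -/
def aSum (P : (ZMod q)[X]) (k : ℕ) : ℤ := ∑ f ∈ monicFin q k, resSym q f P

/-- The sum of `(f/P)` over the monic polynomials of degree less than `k`. -/
def ASum (P : (ZMod q)[X]) (k : ℕ) : ℤ := ∑ j ∈ Finset.range k, aSum P j

lemma ltFin_zero : ltFin q 0 = {0} := by
  ext f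
  rw [mem_ltFin, Finset.mem_singleton]
  constructor
  · intro h
    by_contra hf
    rw [degree_eq_natDegree hf] at h
    exact absurd h (by simp)
  · rintro rfl; simp

lemma resSym_zero : resSym q 0 P = 0 := by simp [resSym]

lemma sum_ltFin_succ_resSym (hP : P.Monic) (hi : Irreducible P) (k : ℕ) (w : ZMod q → ℂ) :
    ∑ c : ZMod q, ∑ h ∈ ltFin q k, (resSym q (C c * X ^ k + h) P : ℂ) * w c
      = (∑ h ∈ ltFin q k, (resSym q h P : ℂ)) * w 0
        + (∑ c ∈ Finset.univ.erase (0 : ZMod q), (resSym q (C c) P : ℂ) * w c) * aSum P k := by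
  rw [← Finset.add_sum_erase _ _ (Finset.mem_univ (0 : ZMod q)), Finset.sum_mul, Finset.sum_mul]
  congr 1
  · simp
  · refine Finset.sum_congr rfl fun c hc => ?_
    rw [sum_ltFin_add_C_mul k (Finset.ne_of_mem_erase hc) fun f => (resSym q f P : ℂ) * w c, aSum]
    push_cast
    rw [Finset.mul_sum]
    refine Finset.sum_congr rfl fun f _ => ?_
    rw [resSym_mul hP hi]; push_cast; ring

lemma sum_erase_zero_quadraticChar (hq2 : q ≠ 2) :
    ∑ c ∈ Finset.univ.erase (0 : ZMod q), (quadraticChar (ZMod q) c : ℂ) = 0 := by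
  have h := quadraticChar_sum_zero (F := ZMod q) (by rwa [ZMod.ringChar_zmod_n])
  rw [← Finset.add_sum_erase _ _ (Finset.mem_univ (0 : ZMod q))] at h
  simp only [MulChar.map_zero, zero_add] at h
  exact_mod_cast congrArg (Int.cast : ℤ → ℂ) h

lemma gaussZ_eq (hq2 : q ≠ 2) :
    gaussZ q = ∑ c : ZMod q, (quadraticChar (ZMod q) c : ℂ) * ZMod.stdAddChar c := by
  have hch : ringChar (ZMod q) ≠ 2 := by rwa [ZMod.ringChar_zmod_n]
  have h1 : gaussZ q
      = ∑ c : ZMod q, ((quadraticChar (ZMod q) c : ℂ) + 1) * ZMod.stdAddChar c := by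
    rw [gaussZ, ← Finset.sum_fiberwise_of_maps_to (t := Finset.univ) (g := fun y : ZMod q => y ^ 2)
        fun _ _ => Finset.mem_univ _]
    refine Finset.sum_congr rfl fun w _ => ?_
    rw [Finset.sum_congr rfl (g := fun _ => ZMod.stdAddChar w)
      (fun y hy => by rw [(Finset.mem_filter.1 hy).2]), Finset.sum_const, nsmul_eq_mul]
    congr 1
    have := quadraticChar_card_sqrts hch w
    have h2 : (Finset.univ.filter fun y : ZMod q => y ^ 2 = w) = {x | x ^ 2 = w}.toFinset := by
      ext y; simp
    rw [h2]
    exact_mod_cast congrArg (Int.cast : ℤ → ℂ) this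
  rw [h1]
  simp only [add_mul, one_mul, Finset.sum_add_distrib]
  rw [AddChar.sum_eq_zero_of_ne_one, add_zero]
  intro h
  exact stdAddChar_ne_one (one_ne_zero : (1 : ZMod q) ≠ 0) (by rw [h, AddChar.one_apply])

lemma gaussZ_ne_zero (hq2 : q ≠ 2) : gaussZ q ≠ 0 := by
  have hch : ringChar (ZMod q) ≠ 2 := by rwa [ZMod.ringChar_zmod_n]
  rw [gaussZ_eq hq2]
  have := gaussSum_ne_zero_of_nontrivial (R := ZMod q) (R' := ℂ)
    (by rw [ZMod.card]; exact_mod_cast (Fact.out : q.Prime).ne_zero)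
    (χ := (quadraticChar (ZMod q)).ringHomComp (Int.castRingHom ℂ)) (by
      obtain ⟨a, ha⟩ := quadraticChar_exists_neg_one hch
      intro h
      have h1 := congrArg (fun χ : MulChar (ZMod q) ℂ => χ a) h
      have ha0 : a ≠ 0 := by rintro rfl; simp at ha
      simp only [MulChar.ringHomComp_apply, ha, MulChar.one_apply ha0.isUnit] at h1
      norm_num at h1)
    (ZMod.isPrimitive_stdAddChar q)
  simpa [gaussSum] using this

lemma gaussP_mul_sum_ltFin (hq2 : q ≠ 2) (hP : P.Monic) (hi : Irreducible P) (k : ℕ) :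
    gaussP P * ∑ y ∈ ltFin q k, (resSym q y P : ℂ)
      = (q : ℂ) ^ k * ∑ z ∈ ltFin q (P.natDegree - k), (resSym q z P : ℂ) := by
  simp only [Finset.mul_sum, gaussP_mul_resSym hq2 hP hi]
  rw [Finset.sum_comm]
  simp only [← Finset.mul_sum]
  refine (Finset.sum_subset (ltFin_mono (Nat.sub_le P.natDegree k)) ?_).symm.trans ?_
  · intro z hz hz'
    rw [sum_expSym_ltFin hP k hz, if_neg hz', mul_zero]
  · rw [Finset.mul_sum]
    refine Finset.sum_congr rfl fun z hz => ?_
    rw [sum_expSym_ltFin hP k (ltFin_mono (Nat.sub_le _ _) hz), if_pos hz, mul_comm]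

lemma gaussP_mul_aSum (hq2 : q ≠ 2) (hP : P.Monic) (hi : Irreducible P) (k : ℕ) :
    gaussP P * aSum P k
      = (q : ℂ) ^ k * ∑ z ∈ ltFin q (P.natDegree - k),
          (resSym q z P : ℂ) * expSym P (z * X ^ k) := by
  rw [aSum, sum_monicFin_eq_sum_ltFin]
  push_cast
  simp only [Finset.mul_sum, gaussP_mul_resSym hq2 hP hi, mul_add, expSym_add]
  rw [Finset.sum_comm]
  simp only [← mul_assoc, ← Finset.mul_sum]
  refine (Finset.sum_subset (ltFin_mono (Nat.sub_le P.natDegree k)) ?_).symm.trans ?_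
  · intro z hz hz'
    rw [sum_expSym_ltFin hP k hz, if_neg hz', mul_zero]
  · refine Finset.sum_congr rfl fun z hz => ?_
    rw [sum_expSym_ltFin hP k (ltFin_mono (Nat.sub_le _ _) hz), if_pos hz]; ring

lemma sum_ltFin_eq_mul_ASum (hq2 : q ≠ 2) (hP : P.Monic) (hi : Irreducible P)
    (he : Even P.natDegree) (k : ℕ) :
    ∑ y ∈ ltFin q k, (resSym q y P : ℂ) = ((q : ℂ) - 1) * ASum P k := by
  induction k with
  | zero => simp [ltFin_zero, ASum, resSym_zero]
  | succ k ih =>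
    have h := sum_ltFin_succ_resSym hP hi k fun _ => 1
    simp only [mul_one] at h
    rw [sum_ltFin_succ, h, ih, ASum, ASum, Finset.sum_range_succ,
      Finset.sum_congr rfl (g := fun _ => (1 : ℂ)), Finset.sum_const,
      Finset.card_erase_of_mem (Finset.mem_univ _), Finset.card_univ, ZMod.card, nsmul_eq_mul,
      Nat.cast_sub (Fact.out : q.Prime).one_le]
    · push_cast; ring
    · intro c hc
      rw [resSym_C hq2 hP hi (Finset.ne_of_mem_erase hc)]
      rcases quadraticChar_dichotomy (Finset.ne_of_mem_erase hc) with h4 | h4 <;>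
        simp [h4, he.neg_one_pow]

lemma sum_ltFin_eq_zero (hq2 : q ≠ 2) (hP : P.Monic) (hi : Irreducible P)
    (ho : Odd P.natDegree) (k : ℕ) :
    ∑ y ∈ ltFin q k, (resSym q y P : ℂ) = 0 := by
  induction k with
  | zero => simp [ltFin_zero, resSym_zero]
  | succ k ih =>
    have h := sum_ltFin_succ_resSym hP hi k fun _ => 1
    simp only [mul_one] at h
    rw [sum_ltFin_succ, h, ih, Finset.sum_congr rfl (g := fun c => (quadraticChar (ZMod q) c : ℂ)),
      sum_erase_zero_quadraticChar hq2, zero_mul, zero_add]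
    intro c hc
    rw [resSym_C hq2 hP hi (Finset.ne_of_mem_erase hc)]
    rcases quadraticChar_dichotomy (Finset.ne_of_mem_erase hc) with h4 | h4 <;>
      simp [h4, ho.neg_one_pow]

/-- Functional equation, even degree. -/
lemma ASum_functional (hq2 : q ≠ 2) (hP : P.Monic) (hi : Irreducible P) {s : ℕ}
    (hs : P.natDegree = 2 * s) (k : ℕ) :
    (q : ℤ) ^ s * ASum P k = (q : ℤ) ^ k * ASum P (P.natDegree - k) := by
  have he : Even P.natDegree := ⟨s, by omega⟩
  have h := gaussP_mul_sum_ltFin hq2 hP hi k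
  rw [gaussP_even hq2 hP hi hs, sum_ltFin_eq_mul_ASum hq2 hP hi he,
    sum_ltFin_eq_mul_ASum hq2 hP hi he] at h
  have hq1 : ((q : ℂ) - 1) ≠ 0 := by
    rw [sub_ne_zero]
    exact_mod_cast (Fact.out : q.Prime).one_lt.ne'
  have h2 : (q : ℂ) ^ s * ASum P k = (q : ℂ) ^ k * ASum P (P.natDegree - k) :=
    mul_left_cancel₀ hq1 (by linear_combination h)
  exact_mod_cast h2

/-- Functional equation, odd degree. -/
lemma aSum_functional (hq2 : q ≠ 2) (hP : P.Monic) (hi : Irreducible P) {s : ℕ}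
    (hs : P.natDegree = 2 * s + 1) {k : ℕ} (hk : k ≤ 2 * s) :
    (q : ℤ) ^ s * aSum P k = (q : ℤ) ^ k * aSum P (2 * s - k) := by
  have ho : Odd P.natDegree := ⟨s, by omega⟩
  have h := gaussP_mul_aSum hq2 hP hi k
  rw [gaussP_odd hq2 hP hi hs, show P.natDegree - k = (2 * s - k) + 1 by omega,
    Finset.sum_congr rfl (g := fun z => (resSym q z P : ℂ) * ZMod.stdAddChar (z.coeff (2 * s - k))),
    sum_ltFin_succ] at h
  · have h1 := sum_ltFin_succ_resSym hP hi (2 * s - k) fun c => ZMod.stdAddChar c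
    have hC : ∑ c ∈ Finset.univ.erase (0 : ZMod q), (resSym q (C c) P : ℂ) * ZMod.stdAddChar c
        = ∑ c ∈ Finset.univ.erase (0 : ZMod q),
          (quadraticChar (ZMod q) c : ℂ) * ZMod.stdAddChar c := by
      refine Finset.sum_congr rfl fun c hc => ?_
      rw [resSym_C hq2 hP hi (Finset.ne_of_mem_erase hc)]
      rcases quadraticChar_dichotomy (Finset.ne_of_mem_erase hc) with h4 | h4 <;>
        simp [h4, ho.neg_one_pow]
    rw [sum_ltFin_eq_zero hq2 hP hi ho, zero_mul, zero_add, hC] at h1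
    · have h2 := gaussZ_eq hq2
      rw [← Finset.add_sum_erase _ _ (Finset.mem_univ (0 : ZMod q))] at h2
      simp only [MulChar.map_zero, Int.cast_zero, zero_mul, zero_add] at h2
      rw [← h2] at h1
      rw [Finset.sum_congr rfl (g := fun c => ∑ h ∈ ltFin q (2 * s - k),
        (resSym q (C c * X ^ (2 * s - k) + h) P : ℂ) * ZMod.stdAddChar c), h1] at h
      · have h3 : (q : ℂ) ^ s * aSum P k = (q : ℂ) ^ k * aSum P (2 * s - k) :=
          mul_left_cancel₀ (gaussZ_ne_zero hq2) (by linear_combination h)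
        exact_mod_cast h3
      · intro c _
        refine Finset.sum_congr rfl fun h hh => ?_
        rw [coeff_add, coeff_C_mul, coeff_X_pow_self, coeff_eq_zero_of_mem_ltFin hh]; simp
  · intro z hz
    have hd : (z * X ^ k).degree < P.degree := by
      by_cases hz0 : z = 0
      · rw [hz0]; simp [hP.ne_zero, bot_lt_iff_ne_bot]
      rw [mem_ltFin, degree_eq_natDegree hz0, Nat.cast_lt] at hz
      refine degree_lt_degree ?_
      rw [natDegree_mul hz0 (pow_ne_zero _ X_ne_zero), natDegree_X_pow]; omega
    rw [expSym, resLin_of_degree_lt hP hd, hs, Nat.add_sub_cancel]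
    nth_rewrite 1 [show 2 * s = (2 * s - k) + k by omega]
    rw [coeff_mul_X_pow]

lemma aSum_eq_zero (hq2 : q ≠ 2) (hP : P.Monic) (hi : Irreducible P) {k : ℕ}
    (hk : P.natDegree ≤ k) : aSum P k = 0 := by
  have h := gaussP_mul_aSum hq2 hP hi k
  rw [Nat.sub_eq_zero_of_le hk, ltFin_zero, Finset.sum_singleton, resSym_zero] at h
  have hG : gaussP P ≠ 0 := by
    have hq0 : (q : ℂ) ≠ 0 := by exact_mod_cast (Fact.out : q.Prime).ne_zero
    rcases Nat.even_or_odd' P.natDegree with ⟨s, hs | hs⟩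
    · rw [gaussP_even hq2 hP hi hs]; exact pow_ne_zero _ hq0
    · rw [gaussP_odd hq2 hP hi hs]; exact mul_ne_zero (pow_ne_zero _ hq0) (gaussZ_ne_zero hq2)
  simpa [hG] using h

end FunctionalEquation

section SquarefreeSieve

variable {q : ℕ} [Fact q.Prime]

lemma squarefree_mul_sq_dvd {D D' h h' : (ZMod q)[X]} (hD : Squarefree D)
    (hD0 : D ≠ 0) (hh' : h' ≠ 0) (e : D * h ^ 2 = D' * h' ^ 2) : D ∣ D' := by
  have h1 : h' ^ 2 ∣ (D * h) ^ 2 := ⟨D * D', by linear_combination D * e⟩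
  rw [IsIntegrallyClosed.pow_dvd_pow_iff two_ne_zero] at h1
  obtain ⟨s, hs⟩ := h1
  have h2 : s ^ 2 = D * D' := by
    have h3 : h' ^ 2 * s ^ 2 = h' ^ 2 * (D * D') := by
      rw [← mul_pow, ← hs]; linear_combination D * e
    exact mul_left_cancel₀ (pow_ne_zero 2 hh') h3
  have h4 : D ∣ s := (hD.dvd_pow_iff_dvd two_ne_zero).1 ⟨D', h2⟩
  have h5 : D * D ∣ D * D' := by
    rw [← h2, ← sq]; exact pow_dvd_pow_of_dvd h4 2
  exact (mul_dvd_mul_iff_left hD0).1 h5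

lemma sum_monicFin_eq_sum_sqfFin {M : Type*} [AddCommMonoid M] (m : ℕ) (F : (ZMod q)[X] → M) :
    ∑ f ∈ monicFin q m, F f
      = ∑ j ∈ Finset.range (m / 2 + 1), ∑ D ∈ sqfFin q (m - 2 * j), ∑ h ∈ monicFin q j,
          F (D * h ^ 2) := by
  simp only [← Finset.sum_product']
  rw [Finset.sum_sigma' (Finset.range (m / 2 + 1))
    (fun j => sqfFin q (m - 2 * j) ×ˢ monicFin q j) fun _ x => F (x.1 * x.2 ^ 2)]
  symm
  refine Finset.sum_nbij (fun x => x.2.1 * x.2.2 ^ 2) ?_ ?_ ?_ fun _ _ => rfl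
  · rintro ⟨j, D, h⟩ hx
    simp only [Finset.mem_sigma, Finset.mem_range, Finset.mem_product, mem_sqfFin,
      mem_monicFin] at hx ⊢
    obtain ⟨hj, ⟨hD, hd, -⟩, hh, hd'⟩ := hx
    refine ⟨hD.mul (hh.pow 2), ?_⟩
    rw [hD.natDegree_mul (hh.pow 2), hh.natDegree_pow, hd, hd']; omega
  · rintro ⟨j, D, h⟩ hx ⟨j', D', h'⟩ hx' e
    simp only [Finset.coe_sigma, Set.mem_sigma_iff, Finset.mem_coe, Finset.mem_range,
      Finset.mem_product, mem_sqfFin, mem_monicFin] at hx hx' e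
    obtain ⟨hj, ⟨hD, hd, hs⟩, hh, hd'⟩ := hx
    obtain ⟨hj', ⟨hD', hd1, hs'⟩, hh', hd1'⟩ := hx'
    have e1 : D = D' := eq_of_monic_of_associated hD hD' (associated_of_dvd_dvd
      (squarefree_mul_sq_dvd hs hD.ne_zero hh'.ne_zero e)
      (squarefree_mul_sq_dvd hs' hD'.ne_zero hh.ne_zero e.symm))
    subst e1
    have e2 : h ^ 2 = h' ^ 2 := mul_left_cancel₀ hD.ne_zero e
    have e3 : h = h' := eq_of_monic_of_associated hh hh' (associated_of_dvd_dvd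
      ((IsIntegrallyClosed.pow_dvd_pow_iff two_ne_zero).1 e2.dvd)
      ((IsIntegrallyClosed.pow_dvd_pow_iff two_ne_zero).1 e2.symm.dvd))
    subst e3
    have e4 : j = j' := hd'.symm.trans hd1'
    subst e4
    rfl
  · intro f hf
    rw [Finset.mem_coe, mem_monicFin] at hf
    obtain ⟨D, h, hD, hh, hs, rfl⟩ := exists_squarefree_mul_sq hf.1
    rw [hD.natDegree_mul (hh.pow 2), hh.natDegree_pow] at hf
    refine ⟨⟨h.natDegree, D, h⟩, ?_, rfl⟩
    simp only [Finset.coe_sigma, Set.mem_sigma_iff, Finset.mem_coe, Finset.mem_range,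
      Finset.mem_product, mem_sqfFin, mem_monicFin]
    exact ⟨by omega, ⟨hD, by omega, hs⟩, hh, trivial⟩

/-- The sum of `(D/P)` over the monic squarefree polynomials of degree `m`. -/
def tSum (P : (ZMod q)[X]) (m : ℕ) : ℤ := ∑ D ∈ sqfFin q m, resSym q D P

/-- The sum of `(D/P)` over the pairs of a monic squarefree `D` and a monic `h` with
`deg (D h ^ 2) = m`. -/
def bSum (P : (ZMod q)[X]) (m : ℕ) : ℤ :=
  ∑ j ∈ Finset.range (m / 2 + 1), (q : ℤ) ^ j * tSum P (m - 2 * j)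

/-- The sum of `(D/P)` over the monic squarefree polynomials of degree `m` not divisible
by `Q`. -/
def tSumQ (P Q : (ZMod q)[X]) (m : ℕ) : ℤ :=
  ∑ D ∈ (sqfFin q m).filter (¬ Q ∣ ·), resSym q D P

variable {P Q : (ZMod q)[X]}

lemma bSum_eq (m : ℕ) :
    bSum P m = tSum P m + if 2 ≤ m then (q : ℤ) * bSum P (m - 2) else 0 := by
  rw [bSum, Finset.sum_range_succ', add_comm]
  congr 1
  · simp
  · split_ifs with h
    · rw [bSum, Finset.mul_sum, show (m - 2) / 2 + 1 = m / 2 by omega]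
      refine Finset.sum_congr rfl fun j _ => ?_
      rw [show m - 2 * (j + 1) = m - 2 - 2 * j by omega, pow_succ]; ring
    · rw [show m / 2 = 0 by omega]; simp

lemma sum_monicFin_dvd {M : Type*} [AddCommMonoid M] (hP : P.Monic) (j : ℕ)
    (F : (ZMod q)[X] → M) :
    ∑ h ∈ (monicFin q j).filter (P ∣ ·), F h
      = if P.natDegree ≤ j then ∑ h ∈ monicFin q (j - P.natDegree), F (P * h) else 0 := by
  split_ifs with hj
  · symm
    refine Finset.sum_nbij (fun h => P * h) ?_ ?_ ?_ fun _ _ => rfl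
    · intro h hh
      rw [mem_monicFin] at hh
      rw [Finset.mem_filter, mem_monicFin]
      refine ⟨⟨hP.mul hh.1, ?_⟩, dvd_mul_right _ _⟩
      rw [hP.natDegree_mul hh.1, hh.2]; omega
    · intro h _ h' _ e
      exact mul_left_cancel₀ hP.ne_zero e
    · intro f hf
      rw [Finset.mem_coe, Finset.mem_filter, mem_monicFin] at hf
      obtain ⟨⟨hm, hd⟩, h, rfl⟩ := hf
      have hh := hP.of_mul_monic_left hm
      rw [hP.natDegree_mul hh] at hd
      exact ⟨h, by rw [Finset.mem_coe, mem_monicFin]; exact ⟨hh, by omega⟩, rfl⟩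
  · rw [Finset.filter_eq_empty_iff.2, Finset.sum_empty]
    intro f hf hd
    rw [mem_monicFin] at hf
    exact hj (hf.2 ▸ natDegree_le_of_dvd hd hf.1.ne_zero)

lemma aSum_eq_sum_tSum (hP : P.Monic) (hi : Irreducible P) (m : ℕ) :
    aSum P m = ∑ j ∈ Finset.range (m / 2 + 1),
      ((q : ℤ) ^ j - if P.natDegree ≤ j then (q : ℤ) ^ (j - P.natDegree) else 0)
        * tSum P (m - 2 * j) := by
  rw [aSum, sum_monicFin_eq_sum_sqfFin]
  refine Finset.sum_congr rfl fun j _ => ?_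
  rw [tSum, Finset.mul_sum]
  refine Finset.sum_congr rfl fun D _ => ?_
  simp only [resSym_mul hP hi, resSym_sq hP hi]
  rw [← Finset.mul_sum, mul_comm]
  congr 1
  have h1 := Finset.sum_filter_add_sum_filter_not (monicFin q j) (P ∣ ·) fun _ => (1 : ℤ)
  simp only [sum_monicFin_dvd hP, Finset.sum_const, card_monicFin] at h1
  rw [Finset.sum_ite, Finset.sum_const_zero, zero_add, Finset.sum_const]
  simp only [nsmul_eq_mul, mul_one] at h1
  push_cast at h1
  linear_combination h1

lemma bSum_eq_aSum (hP : P.Monic) (hi : Irreducible P) (m : ℕ) :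
    bSum P m = aSum P m
      + if 2 * P.natDegree ≤ m then bSum P (m - 2 * P.natDegree) else 0 := by
  rw [aSum_eq_sum_tSum hP hi]
  simp only [sub_mul, Finset.sum_sub_distrib]
  rw [← bSum, sub_add, eq_comm, sub_eq_self, sub_eq_zero]
  simp only [ite_mul, zero_mul]
  split_ifs with h
  · rw [bSum, show m / 2 + 1 = P.natDegree + ((m - 2 * P.natDegree) / 2 + 1) by omega,
      Finset.sum_range_add, Finset.sum_eq_zero, zero_add]
    · refine Finset.sum_congr rfl fun j _ => ?_
      rw [if_pos (by omega), Nat.add_sub_cancel_left,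
        show m - 2 * (P.natDegree + j) = m - 2 * P.natDegree - 2 * j by omega]
    · intro j hj
      rw [Finset.mem_range] at hj
      rw [if_neg (by omega)]
  · refine Finset.sum_eq_zero fun j hj => ?_
    rw [Finset.mem_range] at hj
    rw [if_neg (by omega)]

lemma abs_aSum_le (k : ℕ) : |aSum P k| ≤ (q : ℤ) ^ k := by
  refine (Finset.abs_sum_le_sum_abs _ _).trans ((Finset.sum_le_card_nsmul _ _ 1 fun f _ =>
    abs_resSym_le f P).trans ?_)
  simp [card_monicFin]

lemma abs_bSum_le (hq2 : q ≠ 2) (hP : P.Monic) (hi : Irreducible P) (m : ℕ) :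
    |bSum P m| ≤ (q : ℤ) ^ P.natDegree := by
  have hq1 : (1 : ℤ) ≤ q := by exact_mod_cast (Fact.out : q.Prime).one_le
  induction m using Nat.strong_induction_on with
  | _ m ih =>
    rw [bSum_eq_aSum hP hi]
    have hn := hi.natDegree_pos
    by_cases h : P.natDegree ≤ m
    · rw [aSum_eq_zero hq2 hP hi h, zero_add]
      split_ifs with h1
      · exact ih _ (by omega)
      · simp
    · rw [if_neg (by omega), add_zero]
      exact (abs_aSum_le m).trans (pow_le_pow_right₀ hq1 (by omega))

lemma abs_tSum_le (hq2 : q ≠ 2) (hP : P.Monic) (hi : Irreducible P) (m : ℕ) :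
    |tSum P m| ≤ (q + 1) * (q : ℤ) ^ P.natDegree := by
  have h := bSum_eq (P := P) m
  have h1 := abs_bSum_le hq2 hP hi m
  have h2 := abs_bSum_le hq2 hP hi (m - 2)
  have hq1 : (1 : ℤ) ≤ q := by exact_mod_cast (Fact.out : q.Prime).one_le
  have h3 : tSum P m = bSum P m - if 2 ≤ m then (q : ℤ) * bSum P (m - 2) else 0 := by
    linear_combination -h
  rw [h3]
  have h4 : |if 2 ≤ m then (q : ℤ) * bSum P (m - 2) else 0| ≤ q * (q : ℤ) ^ P.natDegree := by
    split_ifs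
    · rw [abs_mul, abs_of_nonneg (by omega : (0 : ℤ) ≤ q)]; gcongr
    · rw [abs_zero]; positivity
  exact (abs_sub _ _).trans (by linarith)

lemma tSum_eq_aSum (hP : P.Monic) (hi : Irreducible P) {m : ℕ} (hm : m < 2 * P.natDegree) :
    tSum P m = aSum P m - if 2 ≤ m then (q : ℤ) * aSum P (m - 2) else 0 := by
  have h := bSum_eq (P := P) m
  have hn := hi.natDegree_pos
  rw [bSum_eq_aSum hP hi m, bSum_eq_aSum hP hi (m - 2),
    if_neg (by omega : ¬ 2 * P.natDegree ≤ m), if_neg (by omega : ¬ 2 * P.natDegree ≤ m - 2),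
    add_zero, add_zero] at h
  linear_combination -h

lemma tSum_eq_tSumQ (hP : P.Monic) (hi : Irreducible P) (hQ : Q.Monic) (hQi : Irreducible Q)
    (m : ℕ) :
    tSum P m = tSumQ P Q m
      + if Q.natDegree ≤ m then resSym q Q P * tSumQ P Q (m - Q.natDegree) else 0 := by
  rw [tSum, ← Finset.sum_filter_not_add_sum_filter (sqfFin q m) (Q ∣ ·), ← tSumQ]
  congr 1
  split_ifs with hm
  · rw [tSumQ, Finset.mul_sum]
    symm
    refine Finset.sum_nbij (fun h => Q * h) ?_ ?_ ?_ fun D _ => (resSym_mul hP hi _ _).symm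
    · intro D hD
      rw [Finset.mem_filter, mem_sqfFin] at hD ⊢
      obtain ⟨⟨hD, hd, hs⟩, hn⟩ := hD
      refine ⟨⟨hQ.mul hD, ?_, ?_⟩, dvd_mul_right _ _⟩
      · rw [hQ.natDegree_mul hD, hd]; omega
      · exact squarefree_mul_iff.2 ⟨hQi.isRelPrime_iff_not_dvd.2 hn, hQi.squarefree, hs⟩
    · intro h _ h' _ e
      exact mul_left_cancel₀ hQ.ne_zero e
    · intro f hf
      rw [Finset.mem_coe, Finset.mem_filter, mem_sqfFin] at hf
      obtain ⟨⟨hm, hd, hs⟩, h, rfl⟩ := hf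
      have hh := hQ.of_mul_monic_left hm
      rw [hQ.natDegree_mul hh] at hd
      rw [squarefree_mul_iff] at hs
      refine ⟨h, ?_, rfl⟩
      rw [Finset.mem_coe, Finset.mem_filter, mem_sqfFin]
      exact ⟨⟨hh, by omega, hs.2.2⟩, hQi.isRelPrime_iff_not_dvd.1 hs.1⟩
  · rw [Finset.filter_eq_empty_iff.2, Finset.sum_empty]
    intro f hf hd
    rw [mem_sqfFin] at hf
    exact hm (hf.2.1 ▸ natDegree_le_of_dvd hd hf.1.ne_zero)

lemma tSumQ_eq (hP : P.Monic) (hi : Irreducible P) (hQ : Q.Monic) (hQi : Irreducible Q)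
    (M : ℕ) : ∀ m < M, tSumQ P Q m = ∑ i ∈ Finset.range M,
      if Q.natDegree * i ≤ m then (-resSym q Q P) ^ i * tSum P (m - Q.natDegree * i) else 0 := by
  induction M with
  | zero => intro m hm; omega
  | succ M ih =>
    intro m hm
    have h := tSum_eq_tSumQ hP hi hQ hQi m
    have hd := hQi.natDegree_pos
    rw [Finset.sum_range_succ', mul_zero, if_pos (Nat.zero_le _), pow_zero, one_mul, Nat.sub_zero,
      h]
    by_cases hm' : Q.natDegree ≤ m
    · rw [if_pos hm', ih (m - Q.natDegree) (by omega), Finset.mul_sum, add_comm _ (tSumQ P Q m + _),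
        add_assoc, left_eq_add, ← Finset.sum_add_distrib]
      refine Finset.sum_eq_zero fun i _ => ?_
      have h2 : Q.natDegree * (i + 1) = Q.natDegree * i + Q.natDegree := by ring
      by_cases h3 : Q.natDegree * (i + 1) ≤ m
      · rw [if_pos h3, if_pos (by omega),
          show m - Q.natDegree - Q.natDegree * i = m - Q.natDegree * (i + 1) by omega]; ring
      · rw [if_neg h3, if_neg (by omega)]; ring
    · rw [if_neg hm', add_zero, Finset.sum_eq_zero, zero_add]
      intro i _
      have : Q.natDegree ≤ Q.natDegree * (i + 1) := Nat.le_mul_of_pos_right _ (by omega)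
      rw [if_neg (by omega)]

end SquarefreeSieve

section PrimeAverages

variable {q : ℕ} [Fact q.Prime] {P Q : (ZMod q)[X]}

variable (q) in
lemma one_le_cast : (1 : ℝ) ≤ q := by exact_mod_cast (Fact.out : q.Prime).one_le

/-- `aSum` extended by zero to negative degrees. -/
def aZ (P : (ZMod q)[X]) (k : ℤ) : ℝ := if 0 ≤ k then (aSum P k.toNat : ℝ) else 0

/-- `ASum` extended by zero to negative lengths. -/
def AZ (P : (ZMod q)[X]) (K : ℤ) : ℝ := (ASum P K.toNat : ℝ)

/-- `tSum` extended by zero to negative degrees. -/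
def tZ (P : (ZMod q)[X]) (k : ℤ) : ℝ := if 0 ≤ k then (tSum P k.toNat : ℝ) else 0

lemma aZ_eq (k : ℤ) : aZ P k = AZ P (k + 1) - AZ P k := by
  unfold aZ AZ
  split_ifs with h
  · lift k to ℕ using h
    rw [show ((k : ℤ) + 1).toNat = k + 1 by omega, Int.toNat_natCast, ASum, ASum,
      Finset.sum_range_succ]
    push_cast; ring
  · rw [show (k + 1).toNat = 0 by omega, show k.toNat = 0 by omega, sub_self]

lemma AZ_functional (hq2 : q ≠ 2) (hP : P.Monic) (hi : Irreducible P) {s : ℕ}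
    (hs : P.natDegree = 2 * s) (K : ℤ) :
    AZ P K = (q : ℝ) ^ (K - s) * AZ P (2 * s - K) := by
  have hq0 : (q : ℝ) ≠ 0 := by exact_mod_cast (Fact.out : q.Prime).ne_zero
  have key : ∀ k : ℕ, AZ P k = (q : ℝ) ^ ((k : ℤ) - s) * AZ P (2 * s - k) := by
    intro k
    have h := ASum_functional hq2 hP hi hs k
    have h1 : (q : ℝ) ^ s * ASum P k = (q : ℝ) ^ k * ASum P (P.natDegree - k) := by exact_mod_cast h
    unfold AZ
    rw [Int.toNat_natCast, show (2 * (s : ℤ) - k).toNat = P.natDegree - k by omega,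
      zpow_sub₀ hq0, zpow_natCast, zpow_natCast, div_mul_eq_mul_div, eq_div_iff (pow_ne_zero _ hq0)]
    linear_combination h1
  rcases le_or_gt 0 K with h | h
  · lift K to ℕ using h
    exact key K
  · have h2 : AZ P K = 0 := by
      unfold AZ; rw [Int.toNat_of_nonpos h.le]; simp [ASum]
    obtain ⟨k, hk⟩ : ∃ k : ℕ, 2 * (s : ℤ) - K = k := ⟨(2 * (s : ℤ) - K).toNat, by omega⟩
    have h3 := key k
    rw [← hk, show 2 * (s : ℤ) - (2 * s - K) = K by ring, h2, mul_zero] at h3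
    rw [h2, h3, mul_zero]

lemma aZ_functional (hq2 : q ≠ 2) (hP : P.Monic) (hi : Irreducible P) {s : ℕ}
    (hs : P.natDegree = 2 * s + 1) (k : ℤ) :
    aZ P k = (q : ℝ) ^ (k - s) * aZ P (2 * s - k) := by
  have hq0 : (q : ℝ) ≠ 0 := by exact_mod_cast (Fact.out : q.Prime).ne_zero
  have key : ∀ k : ℤ, 2 * s < k → aZ P k = 0 := by
    intro k hk
    rw [aZ, if_pos (by omega), aSum_eq_zero hq2 hP hi (by omega), Int.cast_zero]
  rcases lt_or_ge k 0 with h | h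
  · rw [key (2 * s - k) (by omega), mul_zero, aZ, if_neg (by omega)]
  rcases lt_or_ge (2 * (s : ℤ)) k with h1 | h1
  · rw [key k h1, aZ, if_neg (by omega), mul_zero]
  lift k to ℕ using h
  have h2 := aSum_functional hq2 hP hi hs (k := k) (by omega)
  have h3 : (q : ℝ) ^ s * aSum P k = (q : ℝ) ^ k * aSum P (2 * s - k) := by exact_mod_cast h2
  rw [aZ, aZ, if_pos (by omega), if_pos (by omega), Int.toNat_natCast,
    show (2 * (s : ℤ) - k).toNat = 2 * s - k by omega, zpow_sub₀ hq0, zpow_natCast, zpow_natCast,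
    div_mul_eq_mul_div, eq_div_iff (pow_ne_zero _ hq0)]
  linear_combination h3

lemma tZ_eq_aZ (hP : P.Monic) (hi : Irreducible P) {k : ℤ} (hk : k < 2 * P.natDegree) :
    tZ P k = aZ P k - q * aZ P (k - 2) := by
  rcases lt_or_ge k 0 with h | h
  · rw [tZ, aZ, aZ, if_neg (by omega), if_neg (by omega), if_neg (by omega)]; simp
  lift k to ℕ using h
  rw [tZ, aZ, aZ, if_pos (by omega), if_pos (by omega), Int.toNat_natCast,
    tSum_eq_aSum hP hi (by omega)]
  by_cases h2 : 2 ≤ k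
  · rw [if_pos h2, if_pos (by omega), show ((k : ℤ) - 2).toNat = k - 2 by omega]; push_cast; ring
  · rw [if_neg h2, if_neg (by omega)]; simp

lemma tSumQ_eq_tZ (hP : P.Monic) (hi : Irreducible P) (hQ : Q.Monic) (hQi : Irreducible Q)
    (m : ℕ) : (tSumQ P Q m : ℝ) = ∑ i ∈ Finset.range (m + 1),
      (-1) ^ i * (resSym q Q P : ℝ) ^ i * tZ P (m - Q.natDegree * i) := by
  rw [tSumQ_eq hP hi hQ hQi (m + 1) m (by omega)]
  push_cast
  refine Finset.sum_congr rfl fun i _ => ?_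
  unfold tZ
  have h0 : ((Q.natDegree * i : ℕ) : ℤ) = Q.natDegree * i := by push_cast; ring
  by_cases h : Q.natDegree * i ≤ m
  · rw [if_pos h, if_pos (by omega),
      show ((m : ℤ) - Q.natDegree * i).toNat = m - Q.natDegree * i by omega, neg_pow]
  · rw [if_neg h, if_neg (by omega), mul_zero]

/-- The number of monic polynomials `f` of degree `j` such that `f₀ f` is a square. -/
def sqCount (f₀ : (ZMod q)[X]) (j : ℕ) : ℕ :=
  ((monicFin q j).filter fun f => IsSquare (f₀ * f)).card

lemma sqCount_sq (hQ : Q.Monic) (j : ℕ) :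
    sqCount (Q ^ 2) j = if Even j then q ^ (j / 2) else 0 := by
  have key : ∀ f : (ZMod q)[X], f.Monic → (IsSquare (Q ^ 2 * f) ↔ ∃ h, h.Monic ∧ f = h ^ 2) := by
    intro f hf
    constructor
    · rintro ⟨r, hr⟩
      have h1 : Q ^ 2 ∣ r ^ 2 := ⟨f, by rw [hr, sq]⟩
      obtain ⟨t, rfl⟩ := (IsIntegrallyClosed.pow_dvd_pow_iff two_ne_zero).1 h1
      have h2 : f = t ^ 2 := mul_left_cancel₀ (pow_ne_zero 2 hQ.ne_zero)
        (by rw [hr]; ring)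
      have h3 : t.leadingCoeff ^ 2 = 1 := by rw [← leadingCoeff_pow, ← h2]; exact hf
      rcases mul_self_eq_one_iff.1 ((sq _).symm.trans h3) with h4 | h4
      · exact ⟨t, h4, h2⟩
      · exact ⟨-t, by rw [Monic, leadingCoeff_neg, h4, neg_neg], by rw [h2, neg_sq]⟩
    · rintro ⟨h, -, rfl⟩
      exact ⟨Q * h, by ring⟩
  unfold sqCount
  split_ifs with hj
  · obtain ⟨m, rfl⟩ := even_iff_two_dvd.1 hj
    rw [Nat.mul_div_cancel_left _ two_pos, ← card_monicFin (q := q) m]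
    symm
    refine Finset.card_nbij (fun h => h ^ 2) ?_ ?_ ?_
    · intro h hh
      rw [Finset.mem_coe, mem_monicFin] at hh
      rw [Finset.mem_coe, Finset.mem_filter, mem_monicFin, key _ (hh.1.pow 2)]
      exact ⟨⟨hh.1.pow 2, by rw [natDegree_pow, hh.2]⟩, h, hh.1, rfl⟩
    · intro h hh h' hh' e
      rw [Finset.mem_coe, mem_monicFin] at hh hh'
      have e : h ^ 2 = h' ^ 2 := e
      exact eq_of_monic_of_associated hh.1 hh'.1 (associated_of_dvd_dvd
        ((IsIntegrallyClosed.pow_dvd_pow_iff two_ne_zero).1 e.dvd)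
        ((IsIntegrallyClosed.pow_dvd_pow_iff two_ne_zero).1 e.symm.dvd))
    · intro f hf
      rw [Finset.mem_coe, Finset.mem_filter, mem_monicFin] at hf
      obtain ⟨h, hh, rfl⟩ := (key f hf.1.1).1 hf.2
      refine ⟨h, ?_, rfl⟩
      rw [Finset.mem_coe, mem_monicFin]
      have := hf.1.2
      rw [natDegree_pow] at this
      exact ⟨hh, by omega⟩
  · rw [Finset.card_eq_zero, Finset.filter_eq_empty_iff]
    intro f hf hs
    rw [mem_monicFin] at hf
    obtain ⟨h, -, rfl⟩ := (key f hf.1).1 hs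
    refine hj ?_
    rw [← hf.2, natDegree_pow]
    exact even_two_mul _

lemma sqCount_one (j : ℕ) : sqCount (1 : (ZMod q)[X]) j = if Even j then q ^ (j / 2) else 0 := by
  rw [← sqCount_sq monic_one j, one_pow]

lemma sqCount_irreducible (hQ : Q.Monic) (hQi : Irreducible Q) (j : ℕ) :
    sqCount Q j = if Q.natDegree ≤ j ∧ Even (j - Q.natDegree) then q ^ ((j - Q.natDegree) / 2)
      else 0 := by
  have key : ∀ f, IsSquare (Q * f) → Q ∣ f := by
    rintro f ⟨r, hr⟩
    have h1 : Q ∣ r := by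
      have : Q ∣ r * r := ⟨f, hr.symm⟩
      rcases hQi.prime.dvd_or_dvd this with h | h <;> exact h
    obtain ⟨t, rfl⟩ := h1
    exact ⟨t * t, mul_left_cancel₀ hQ.ne_zero (by rw [hr]; ring)⟩
  have h1 : sqCount Q j = if Q.natDegree ≤ j then sqCount (Q ^ 2) (j - Q.natDegree) else 0 := by
    have h2 := sum_monicFin_dvd hQ j fun f => if IsSquare (Q * f) then 1 else 0
    rw [sqCount, Finset.card_filter, ← Finset.sum_filter_add_sum_filter_not (monicFin q j) (Q ∣ ·),
      h2, Finset.sum_eq_zero (s := (monicFin q j).filter (¬ Q ∣ ·)), add_zero]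
    · simp only [sqCount, Finset.card_filter, ← mul_assoc, ← sq]
    · intro f hf
      rw [if_neg fun h => (Finset.mem_filter.1 hf).2 (key f h)]
  rw [h1, sqCount_sq hQ]
  split_ifs <;> first | rfl | tauto

lemma abs_irr_sum_aSum_sub_le (hq2 : q ≠ 2) {n : ℕ} (hn : 1 ≤ n) {f₀ : (ZMod q)[X]}
    (hf : f₀.Monic) (j : ℕ) :
    |∑ P ∈ irrFin q n, (n : ℝ) * ((resSym q f₀ P : ℝ) * aSum P j) - (q : ℝ) ^ n * sqCount f₀ j|
      ≤ 30 * (1 + j + f₀.natDegree) * (q : ℝ) ^ ((n + 1) / 2) * (q : ℝ) ^ j := by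
  have h1 : ∑ P ∈ irrFin q n, (n : ℝ) * ((resSym q f₀ P : ℝ) * aSum P j)
      = ∑ f ∈ monicFin q j, ∑ P ∈ irrFin q n, (n : ℝ) * (resSym q (f₀ * f) P : ℝ) := by
    rw [Finset.sum_comm]
    refine Finset.sum_congr rfl fun P hP => ?_
    rw [mem_irrFin] at hP
    rw [aSum]
    push_cast
    rw [Finset.mul_sum, Finset.mul_sum]
    refine Finset.sum_congr rfl fun f _ => ?_
    rw [resSym_mul hP.1 hP.2.2]; push_cast; ring
  have h2 : (q : ℝ) ^ n * sqCount f₀ j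
      = ∑ f ∈ monicFin q j, if IsSquare (f₀ * f) then (q : ℝ) ^ n else 0 := by
    rw [sqCount, Finset.sum_ite, Finset.sum_const_zero, add_zero, Finset.sum_const, nsmul_eq_mul,
      mul_comm]
  rw [h1, h2, ← Finset.sum_sub_distrib]
  refine (Finset.abs_sum_le_sum_abs _ _).trans ?_
  have hq1 := one_le_cast q
  have h3 : ∀ f ∈ monicFin q j, |∑ P ∈ irrFin q n, (n : ℝ) * (resSym q (f₀ * f) P : ℝ)
      - if IsSquare (f₀ * f) then (q : ℝ) ^ n else 0|
      ≤ 30 * (1 + j + f₀.natDegree) * (q : ℝ) ^ ((n + 1) / 2) := by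
    intro f hf'
    rw [mem_monicFin] at hf'
    refine (prime_sum_bound hq2 hn (hf.mul hf'.1)).trans ?_
    rw [hf.natDegree_mul hf'.1, hf'.2]
    have h4 : (q : ℝ) ^ ((n : ℝ) / 2) ≤ (q : ℝ) ^ ((n + 1) / 2) := by
      rw [← Real.rpow_natCast]
      refine Real.rpow_le_rpow_of_exponent_le hq1 ?_
      have : n ≤ 2 * ((n + 1) / 2) := by omega
      have h5 : (n : ℝ) ≤ 2 * ((n + 1) / 2 : ℕ) := by exact_mod_cast this
      linarith
    push_cast
    calc _ ≤ 30 * (1 + ((f₀.natDegree : ℝ) + j)) * (q : ℝ) ^ ((n + 1) / 2) := by gcongr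
      _ = _ := by ring
  refine (Finset.sum_le_card_nsmul _ _ _ h3).trans (le_of_eq ?_)
  rw [card_monicFin, nsmul_eq_mul]; push_cast; ring

end PrimeAverages

section TwistedSums

variable {q : ℕ} [Fact q.Prime] {P Q : (ZMod q)[X]}

/-- The number of monic `f` of degree less than `K` such that `f₀ f` is a square. -/
def sqTotal (f₀ : (ZMod q)[X]) (K : ℤ) : ℝ := ∑ j ∈ Finset.range K.toNat, (sqCount f₀ j : ℝ)

variable (q) in
lemma two_le_cast : (2 : ℝ) ≤ q := by exact_mod_cast (Fact.out : q.Prime).two_le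

lemma sum_range_pow_le (k : ℕ) : ∑ j ∈ Finset.range k, (q : ℝ) ^ j ≤ (q : ℝ) ^ k := by
  have hq := two_le_cast q
  induction k with
  | zero => simp
  | succ k ih =>
    rw [Finset.sum_range_succ, pow_succ]
    have : 0 < (q : ℝ) ^ k := by positivity
    nlinarith

lemma abs_irr_sum_aZ_sub_le (hq2 : q ≠ 2) {n : ℕ} (hn : 1 ≤ n) {f₀ : (ZMod q)[X]}
    (hf : f₀.Monic) (K : ℤ) :
    |∑ P ∈ irrFin q n, (n : ℝ) * ((resSym q f₀ P : ℝ) * aZ P K)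
        - if 0 ≤ K then (q : ℝ) ^ n * sqCount f₀ K.toNat else 0|
      ≤ 30 * (1 + K.toNat + f₀.natDegree) * (q : ℝ) ^ ((n + 1) / 2) * (q : ℝ) ^ K := by
  have hq := two_le_cast q
  rcases lt_or_ge K 0 with h | h
  · simp only [aZ, if_neg h.not_ge, mul_zero, Finset.sum_const_zero, sub_zero, abs_zero]
    positivity
  · lift K to ℕ using h
    simp only [aZ, Nat.cast_nonneg, if_true, Int.toNat_natCast, zpow_natCast]
    exact abs_irr_sum_aSum_sub_le hq2 hn hf K

lemma abs_irr_sum_AZ_sub_le (hq2 : q ≠ 2) {n : ℕ} (hn : 1 ≤ n) {f₀ : (ZMod q)[X]}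
    (hf : f₀.Monic) (K : ℤ) :
    |∑ P ∈ irrFin q n, (n : ℝ) * ((resSym q f₀ P : ℝ) * AZ P K) - (q : ℝ) ^ n * sqTotal f₀ K|
      ≤ 30 * (1 + K.toNat + f₀.natDegree) * (q : ℝ) ^ ((n + 1) / 2) * (q : ℝ) ^ K := by
  have hq := two_le_cast q
  rcases lt_or_ge K 0 with h | h
  · simp only [AZ, sqTotal, Int.toNat_of_nonpos h.le, ASum, Finset.sum_range_zero, Int.cast_zero,
      mul_zero, Finset.sum_const_zero, sub_zero, abs_zero]
    positivity
  · lift K to ℕ using h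
    simp only [AZ, sqTotal, Int.toNat_natCast, zpow_natCast, ASum]
    push_cast
    simp only [Finset.mul_sum]
    rw [Finset.sum_comm, ← Finset.sum_sub_distrib]
    refine (Finset.abs_sum_le_sum_abs _ _).trans ?_
    calc _ ≤ ∑ j ∈ Finset.range K, 30 * (1 + (K : ℝ) + f₀.natDegree) * (q : ℝ) ^ ((n + 1) / 2)
            * (q : ℝ) ^ j := by
          refine Finset.sum_le_sum fun j hj => ?_
          refine (abs_irr_sum_aSum_sub_le hq2 hn hf j).trans ?_
          have : (j : ℝ) ≤ K := by exact_mod_cast (Finset.mem_range.1 hj).le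
          gcongr
      _ ≤ _ := by
          rw [← Finset.mul_sum]
          have := sum_range_pow_le (q := q) K
          gcongr

lemma tZ_eq_AZ_dual (hq2 : q ≠ 2) (hP : P.Monic) (hi : Irreducible P) {s : ℕ}
    (hs : P.natDegree = 2 * s) {k : ℤ} (hk : k < 2 * P.natDegree) :
    tZ P k = (q : ℝ) ^ (k - s) * (q * AZ P (2 * s - k - 1) - AZ P (2 * s - k)
      - AZ P (2 * s - k + 1) + (q : ℝ)⁻¹ * AZ P (2 * s - k + 2)) := by
  have hq0 : (q : ℝ) ≠ 0 := by exact_mod_cast (Fact.out : q.Prime).ne_zero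
  rw [tZ_eq_aZ hP hi hk, aZ_eq, aZ_eq, AZ_functional hq2 hP hi hs (k + 1),
    AZ_functional hq2 hP hi hs k, AZ_functional hq2 hP hi hs (k - 2 + 1),
    AZ_functional hq2 hP hi hs (k - 2), show 2 * (s : ℤ) - (k + 1) = 2 * s - k - 1 by ring,
    show 2 * (s : ℤ) - (k - 2 + 1) = 2 * s - k + 1 by ring,
    show 2 * (s : ℤ) - (k - 2) = 2 * s - k + 2 by ring,
    show k + 1 - (s : ℤ) = k - s + 1 by ring, show k - 2 + 1 - (s : ℤ) = k - s - 1 by ring,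
    show k - 2 - (s : ℤ) = k - s - 1 - 1 by ring, zpow_add_one₀ hq0,
    zpow_sub_one₀ hq0 (k - s - 1), zpow_sub_one₀ hq0 (k - s)]
  linear_combination ((q : ℝ) ^ (k - s) * (q : ℝ)⁻¹ * AZ P (2 * s - k + 2)
    - (q : ℝ) ^ (k - s) * AZ P (2 * s - k + 1)) * mul_inv_cancel₀ hq0

lemma tZ_eq_aZ_dual (hq2 : q ≠ 2) (hP : P.Monic) (hi : Irreducible P) {s : ℕ}
    (hs : P.natDegree = 2 * s + 1) {k : ℤ} (hk : k < 2 * P.natDegree) :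
    tZ P k = (q : ℝ) ^ (k - s) * (aZ P (2 * s - k) - (q : ℝ)⁻¹ * aZ P (2 * s - k + 2)) := by
  have hq0 : (q : ℝ) ≠ 0 := by exact_mod_cast (Fact.out : q.Prime).ne_zero
  rw [tZ_eq_aZ hP hi hk, aZ_functional hq2 hP hi hs k, aZ_functional hq2 hP hi hs (k - 2),
    show 2 * (s : ℤ) - (k - 2) = 2 * s - k + 2 by ring,
    show k - 2 - (s : ℤ) = k - s - 1 - 1 by ring, zpow_sub_one₀ hq0, zpow_sub_one₀ hq0]
  linear_combination -((q : ℝ) ^ (k - s) * (q : ℝ)⁻¹ * aZ P (2 * s - k + 2)) * mul_inv_cancel₀ hq0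

lemma abs_irr_sum_tZ_sub_le_of_even (hq2 : q ≠ 2) {s : ℕ} (hs : 1 ≤ s) {f₀ : (ZMod q)[X]}
    (hf : f₀.Monic) {k : ℤ} (hk0 : 0 ≤ k) (hk : k < 4 * s) :
    |∑ P ∈ irrFin q (2 * s), ((2 * s : ℕ) : ℝ) * ((resSym q f₀ P : ℝ) * tZ P k)
        - (q : ℝ) ^ (k - s) * (q : ℝ) ^ (2 * s) * (q * sqTotal f₀ (2 * s - k - 1)
          - sqTotal f₀ (2 * s - k) - sqTotal f₀ (2 * s - k + 1)
          + (q : ℝ)⁻¹ * sqTotal f₀ (2 * s - k + 2))|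
      ≤ 30 * (3 + 2 * s + f₀.natDegree) * (2 + 2 * q) * (q : ℝ) ^ (2 * s) := by
  have hq := two_le_cast q
  have hq0 : (q : ℝ) ≠ 0 := by positivity
  set E : ℤ → ℝ := fun K =>
    ∑ P ∈ irrFin q (2 * s), ((2 * s : ℕ) : ℝ) * ((resSym q f₀ P : ℝ) * AZ P K)
      - (q : ℝ) ^ (2 * s) * sqTotal f₀ K with hE
  have hEb : ∀ K : ℤ, K ≤ 2 * s + 2 →
      |E K| ≤ 30 * (3 + 2 * s + f₀.natDegree) * (q : ℝ) ^ s * (q : ℝ) ^ K := by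
    intro K hK
    refine (abs_irr_sum_AZ_sub_le hq2 (by omega) hf K).trans ?_
    rw [show (2 * s + 1) / 2 = s by omega]
    have h1 : (K.toNat : ℝ) ≤ 2 * s + 2 := by
      have : K.toNat ≤ 2 * s + 2 := by omega
      exact_mod_cast this
    have h2 : 0 < (q : ℝ) ^ K := by positivity
    exact mul_le_mul_of_nonneg_right
      (mul_le_mul_of_nonneg_right (by linarith) (by positivity)) h2.le
  have h1 : ∑ P ∈ irrFin q (2 * s), ((2 * s : ℕ) : ℝ) * ((resSym q f₀ P : ℝ) * tZ P k)
        - (q : ℝ) ^ (k - s) * (q : ℝ) ^ (2 * s) * (q * sqTotal f₀ (2 * s - k - 1)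
          - sqTotal f₀ (2 * s - k) - sqTotal f₀ (2 * s - k + 1)
          + (q : ℝ)⁻¹ * sqTotal f₀ (2 * s - k + 2))
      = (q : ℝ) ^ (k - s) * (q * E (2 * s - k - 1) - E (2 * s - k)
      - E (2 * s - k + 1) + (q : ℝ)⁻¹ * E (2 * s - k + 2)) := by
    set S : ℤ → ℝ := fun K =>
      ∑ P ∈ irrFin q (2 * s), ((2 * s : ℕ) : ℝ) * ((resSym q f₀ P : ℝ) * AZ P K) with hS
    have h2 : ∑ P ∈ irrFin q (2 * s), ((2 * s : ℕ) : ℝ) * ((resSym q f₀ P : ℝ) * tZ P k)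
        = (q : ℝ) ^ (k - s) * (q * S (2 * s - k - 1) - S (2 * s - k) - S (2 * s - k + 1)
            + (q : ℝ)⁻¹ * S (2 * s - k + 2)) := by
      simp only [hS, Finset.mul_sum, ← Finset.sum_sub_distrib, ← Finset.sum_add_distrib]
      refine Finset.sum_congr rfl fun P hP => ?_
      rw [mem_irrFin] at hP
      rw [tZ_eq_AZ_dual hq2 hP.1 hP.2.2 hP.2.1 (by omega)]
      ring
    rw [h2, hE]
    ring
  rw [h1, abs_mul, abs_of_pos (by positivity : 0 < (q : ℝ) ^ (k - s))]
  set B := 30 * (3 + 2 * (s : ℝ) + f₀.natDegree) * (q : ℝ) ^ s with hB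
  set z := (q : ℝ) ^ (2 * s - k) with hz
  have hz0 : 0 < z := by positivity
  have h3 := hEb (2 * s - k - 1) (by omega)
  have h4 := hEb (2 * s - k) (by omega)
  have h5 := hEb (2 * s - k + 1) (by omega)
  have h6 := hEb (2 * s - k + 2) (by omega)
  rw [zpow_sub_one₀ hq0, ← hz] at h3
  rw [← hz] at h4
  rw [zpow_add_one₀ hq0, ← hz] at h5
  rw [zpow_add₀ hq0, ← hz, zpow_two] at h6
  have h7 : |(q : ℝ) * E (2 * s - k - 1) - E (2 * s - k) - E (2 * s - k + 1)
      + (q : ℝ)⁻¹ * E (2 * s - k + 2)| ≤ (2 + 2 * q) * (B * z) := by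
    refine (abs_add_le _ _).trans ?_
    refine (add_le_add_left ((abs_sub _ _).trans (add_le_add_left (abs_sub _ _) _)) _).trans ?_
    rw [abs_mul, abs_mul, abs_of_pos (by positivity : (0 : ℝ) < q),
      abs_of_pos (by positivity : (0 : ℝ) < (q : ℝ)⁻¹)]
    calc _ ≤ q * (B * (z * (q : ℝ)⁻¹)) + B * z + B * (z * q) + (q : ℝ)⁻¹ * (B * (z * (q * q))) := by
          gcongr
      _ = _ := by field_simp; ring
  have h8 : (q : ℝ) ^ (k - s) * z = (q : ℝ) ^ s := by
    rw [hz, ← zpow_add₀ hq0, show k - s + (2 * s - k) = (s : ℤ) by ring, zpow_natCast]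
  calc _ ≤ (q : ℝ) ^ (k - s) * ((2 + 2 * q) * (B * z)) := by gcongr
    _ = (2 + 2 * q) * B * ((q : ℝ) ^ (k - s) * z) := by ring
    _ = _ := by rw [h8, hB, two_mul s, pow_add]; ring

lemma abs_irr_sum_tZ_le_of_odd (hq2 : q ≠ 2) {s : ℕ} {f₀ : (ZMod q)[X]}
    (hf : f₀.Monic) {k : ℤ} (hk0 : 0 ≤ k) (hk : k < 4 * s + 2)
    (hsq : ∀ j : ℕ, Even (k + j) → sqCount f₀ j = 0) :
    |∑ P ∈ irrFin q (2 * s + 1), ((2 * s + 1 : ℕ) : ℝ) * ((resSym q f₀ P : ℝ) * tZ P k)|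
      ≤ 30 * (3 + (2 * s + 1) + f₀.natDegree) * (2 + 2 * q) * (q : ℝ) ^ (2 * s + 1) := by
  have hq := two_le_cast q
  have hq0 : (q : ℝ) ≠ 0 := by positivity
  set E : ℤ → ℝ := fun K =>
    ∑ P ∈ irrFin q (2 * s + 1), ((2 * s + 1 : ℕ) : ℝ) * ((resSym q f₀ P : ℝ) * aZ P K) with hE
  have hEb : ∀ K : ℤ, K ≤ 2 * s + 2 → Even (k + K) →
      |E K| ≤ 30 * (3 + (2 * s + 1) + f₀.natDegree) * (q : ℝ) ^ (s + 1) * (q : ℝ) ^ K := by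
    intro K hK hev
    have h0 := abs_irr_sum_aZ_sub_le hq2 (by omega : 1 ≤ 2 * s + 1) hf K
    have h00 : (if 0 ≤ K then (q : ℝ) ^ (2 * s + 1) * sqCount f₀ K.toNat else 0) = 0 := by
      split_ifs with h
      · rw [hsq _ (by rwa [Int.toNat_of_nonneg h])]; simp
      · rfl
    rw [h00, sub_zero] at h0
    refine h0.trans ?_
    rw [show (2 * s + 1 + 1) / 2 = s + 1 by omega]
    have h1 : (K.toNat : ℝ) ≤ 2 * s + 2 := by
      have : K.toNat ≤ 2 * s + 2 := by omega
      exact_mod_cast this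
    have h2 : 0 < (q : ℝ) ^ K := by positivity
    exact mul_le_mul_of_nonneg_right
      (mul_le_mul_of_nonneg_right (by linarith) (by positivity)) h2.le
  have h1 : ∑ P ∈ irrFin q (2 * s + 1), ((2 * s + 1 : ℕ) : ℝ) * ((resSym q f₀ P : ℝ) * tZ P k)
      = (q : ℝ) ^ (k - s) * (E (2 * s - k) - (q : ℝ)⁻¹ * E (2 * s - k + 2)) := by
    simp only [hE, Finset.mul_sum, ← Finset.sum_sub_distrib]
    refine Finset.sum_congr rfl fun P hP => ?_
    rw [mem_irrFin] at hP
    rw [tZ_eq_aZ_dual hq2 hP.1 hP.2.2 hP.2.1 (by omega)]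
    ring
  rw [h1, abs_mul, abs_of_pos (by positivity : 0 < (q : ℝ) ^ (k - s))]
  set B := 30 * (3 + (2 * (s : ℝ) + 1) + f₀.natDegree) * (q : ℝ) ^ (s + 1) with hB
  set z := (q : ℝ) ^ (2 * s - k) with hz
  have hz0 : 0 < z := by positivity
  have h4 := hEb (2 * s - k) (by omega) ⟨s, by ring⟩
  have h6 := hEb (2 * s - k + 2) (by omega) ⟨s + 1, by ring⟩
  rw [← hz] at h4
  rw [zpow_add₀ hq0, ← hz, zpow_two] at h6
  have h7 : |E (2 * s - k) - (q : ℝ)⁻¹ * E (2 * s - k + 2)| ≤ (2 + 2 * q) * (B * z) := by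
    refine (abs_sub _ _).trans ?_
    rw [abs_mul, abs_of_pos (by positivity : (0 : ℝ) < (q : ℝ)⁻¹)]
    calc _ ≤ B * z + (q : ℝ)⁻¹ * (B * (z * (q * q))) := by gcongr
      _ = (1 + q) * (B * z) := by field_simp
      _ ≤ _ := by gcongr <;> linarith
  have h8 : (q : ℝ) ^ (k - s) * z = (q : ℝ) ^ s := by
    rw [hz, ← zpow_add₀ hq0, show k - s + (2 * s - k) = (s : ℤ) by ring, zpow_natCast]
  calc _ ≤ (q : ℝ) ^ (k - s) * ((2 + 2 * q) * (B * z)) := by gcongr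
    _ = (2 + 2 * q) * B * ((q : ℝ) ^ (k - s) * z) := by ring
    _ = _ := by rw [h8, hB, show 2 * s + 1 = s + (s + 1) by ring, pow_add _ s (s + 1)]; ring

end TwistedSums

section MainTerm

variable {q : ℕ} [Fact q.Prime] {P Q : (ZMod q)[X]}

/-- A polynomial whose residue symbols are the `i`-th powers of those of `Q`. -/
def twist (Q : (ZMod q)[X]) (i : ℕ) : (ZMod q)[X] :=
  if i = 0 then 1 else if Even i then Q ^ 2 else Q

lemma twist_monic (hQ : Q.Monic) (i : ℕ) : (twist Q i).Monic := by
  unfold twist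
  split_ifs
  exacts [monic_one, hQ.pow 2, hQ]

lemma natDegree_twist_le (hQ : Q.Monic) (i : ℕ) : (twist Q i).natDegree ≤ 2 * Q.natDegree := by
  unfold twist
  split_ifs
  · simp
  · rw [hQ.natDegree_pow]
  · omega

lemma resSym_twist (hP : P.Monic) (hi : Irreducible P) (i : ℕ) :
    resSym q (twist Q i) P = resSym q Q P ^ i := by
  unfold twist
  have h3 : resSym q Q P = 0 ∨ resSym q Q P = 1 ∨ resSym q Q P = -1 := by
    unfold resSym; split_ifs <;> simp
  split_ifs with h1 h2
  · rw [h1, pow_zero, resSym_one hP hi]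
  · rw [resSym_pow hP hi]
    rcases h3 with h | h | h <;> rw [h]
    · rw [zero_pow h1, zero_pow two_ne_zero]
    · simp
    · rw [h2.neg_one_pow]; simp
  · rcases h3 with h | h | h <;> rw [h]
    · rw [zero_pow h1]
    · simp
    · rw [(Nat.not_even_iff_odd.1 h2).neg_one_pow]

/-- The degree of the squarefree part of `twist Q i`. -/
def twistDeg (Q : (ZMod q)[X]) (i : ℕ) : ℕ := if Even i then 0 else Q.natDegree

lemma sqCount_twist (hQ : Q.Monic) (hQi : Irreducible Q) (i j : ℕ) :
    sqCount (twist Q i) j = if twistDeg Q i ≤ j ∧ Even (j - twistDeg Q i)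
      then q ^ ((j - twistDeg Q i) / 2) else 0 := by
  unfold twist twistDeg
  by_cases h2 : Even i
  · rw [if_pos h2, if_pos h2]
    simp only [Nat.zero_le, true_and, Nat.sub_zero]
    by_cases h1 : i = 0
    · rw [if_pos h1, sqCount_one]
    · rw [if_neg h1, sqCount_sq hQ]
  · have h1 : i ≠ 0 := by rintro rfl; simp at h2
    rw [if_neg h2, if_neg h2, if_neg h1, sqCount_irreducible hQ hQi]

lemma sub_one_mul_sqTotal {f₀ : (ZMod q)[X]} {δ : ℕ}
    (h : ∀ j, sqCount f₀ j = if δ ≤ j ∧ Even (j - δ) then q ^ ((j - δ) / 2) else 0) (Y : ℕ) :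
    ((q : ℝ) - 1) * ∑ j ∈ Finset.range Y, (sqCount f₀ j : ℝ)
      = (q : ℝ) ^ ((Y + 1 - δ) / 2) - 1 := by
  induction Y with
  | zero => rw [show (0 + 1 - δ) / 2 = 0 by omega]; simp
  | succ Y ih =>
    rw [Finset.sum_range_succ, mul_add, ih, h]
    split_ifs with h1
    · obtain ⟨h1, m, hm⟩ := h1
      rw [show (Y + 1 - δ) / 2 = m by omega, show (Y - δ) / 2 = m by omega,
        show (Y + 1 + 1 - δ) / 2 = m + 1 by omega]
      push_cast; ring
    · rw [Nat.even_iff] at h1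
      rw [show (Y + 1 + 1 - δ) / 2 = (Y + 1 - δ) / 2 by omega]; simp

variable (q) in
/-- The coefficients of `u ^ 2 / (u ^ 2 - 1) + 1 / (q - 1)` in the variable `u ^ 2`. -/
def coefA (x : ℤ) : ℝ := if x < 0 then 0 else if x = 0 then 1 / ((q : ℝ) - 1) else -1

lemma abs_coefA_le (x : ℤ) : |coefA q x| ≤ 1 := by
  have hq := two_le_cast q
  unfold coefA
  split_ifs
  · simp
  · rw [abs_of_nonneg (by apply div_nonneg <;> linarith), div_le_one (by linarith)]; linarith
  · simp

lemma sqTotal_bracket {f₀ : (ZMod q)[X]} {δ : ℕ}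
    (h : ∀ j, sqCount f₀ j = if δ ≤ j ∧ Even (j - δ) then q ^ ((j - δ) / 2) else 0) {x y : ℤ}
    (hy : y = δ + 2 * x - 1) :
    q * sqTotal f₀ (y - 1) - sqTotal f₀ y - sqTotal f₀ (y + 1) + (q : ℝ)⁻¹ * sqTotal f₀ (y + 2)
      = ((q : ℝ) - 1) / q * coefA q x := by
  have hq := two_le_cast q
  have hq1 : (q : ℝ) - 1 ≠ 0 := by linarith
  have hq0 : (q : ℝ) ≠ 0 := by linarith
  have key : ∀ K : ℤ, sqTotal f₀ K = ((q : ℝ) ^ ((K.toNat + 1 - δ) / 2) - 1) / ((q : ℝ) - 1) := by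
    intro K
    rw [← sub_one_mul_sqTotal h, mul_div_cancel_left₀ _ hq1, sqTotal]
  simp only [key]
  unfold coefA
  split_ifs with h1 h2
  · rw [show ((y - 1).toNat + 1 - δ) / 2 = 0 by omega, show (y.toNat + 1 - δ) / 2 = 0 by omega,
      show ((y + 1).toNat + 1 - δ) / 2 = 0 by omega,
      show ((y + 2).toNat + 1 - δ) / 2 = 0 by omega]
    simp
  · rw [show ((y - 1).toNat + 1 - δ) / 2 = 0 by omega, show (y.toNat + 1 - δ) / 2 = 0 by omega,
      show ((y + 1).toNat + 1 - δ) / 2 = 0 by omega,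
      show ((y + 2).toNat + 1 - δ) / 2 = 1 by omega]
    field_simp
    ring
  · obtain ⟨m, hm⟩ : ∃ m : ℕ, x = m + 1 := ⟨(x - 1).toNat, by omega⟩
    rw [show ((y - 1).toNat + 1 - δ) / 2 = m by omega,
      show (y.toNat + 1 - δ) / 2 = m + 1 by omega,
      show ((y + 1).toNat + 1 - δ) / 2 = m + 1 by omega,
      show ((y + 2).toNat + 1 - δ) / 2 = m + 2 by omega]
    field_simp
    ring

lemma sum_range_two_mul {M : Type*} [AddCommMonoid M] (F : ℕ → M) (m : ℕ) :
    ∑ i ∈ Finset.range (2 * m), F i = ∑ i ∈ Finset.range m, (F (2 * i) + F (2 * i + 1)) := by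
  induction m with
  | zero => simp
  | succ m ih =>
    rw [show 2 * (m + 1) = 2 * m + 1 + 1 by ring, Finset.sum_range_succ, Finset.sum_range_succ,
      Finset.sum_range_succ, ih, add_assoc]

variable (q) in
/-- The main term of the average over `P` of degree `n` of the sum of `(D/P)` over the
squarefree `D` of degree `2 g + 1` not divisible by a given prime of degree `d`. -/
def mainW (g n d : ℕ) : ℝ :=
  if Even n then ((q : ℝ) - 1) * (q : ℝ) ^ (n / 2 + 2 * g) * (1 - ((q : ℝ) ^ d)⁻¹) *
    ∑ i ∈ Finset.range (g + 1), ((q : ℝ) ^ (2 * d * i))⁻¹ * coefA q ((n / 2 : ℕ) - g + d * i)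
  else 0

lemma mainW_eq_sum {g s d : ℕ} : mainW q g (2 * s) d = ∑ i ∈ Finset.range (2 * g + 2),
    (-1) ^ i * ((q : ℝ) - 1) * ((q : ℝ) ^ (s + 2 * g) * ((q : ℝ) ^ (d * i))⁻¹)
      * coefA q (s - g + d * (i / 2 : ℕ)) := by
  rw [show 2 * g + 2 = 2 * (g + 1) by ring, sum_range_two_mul, mainW, if_pos (even_two_mul s),
    Nat.mul_div_cancel_left _ two_pos, Finset.mul_sum]
  refine Finset.sum_congr rfl fun i _ => ?_
  rw [show 2 * i / 2 = i by omega, show (2 * i + 1) / 2 = i by omega,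
    show d * (2 * i + 1) = 2 * d * i + d by ring, show d * (2 * i) = 2 * d * i by ring,
    pow_add (q : ℝ) (2 * d * i) d, mul_inv, pow_succ,
    (even_two_mul i).neg_one_pow]
  ring

/-- The average over the primes of degree `n` of the sum of `(D/P)` over the squarefree `D`
of degree `2 g + 1` not divisible by `Q`. -/
def avgW (g n : ℕ) (Q : (ZMod q)[X]) : ℝ :=
  ∑ P ∈ irrFin q n, (n : ℝ) * (tSumQ P Q (2 * g + 1) : ℝ)

lemma avgW_eq (hQ : Q.Monic) (hQi : Irreducible Q) (g n : ℕ) :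
    avgW g n Q = ∑ i ∈ Finset.range (2 * g + 2), (-1) ^ i *
      ∑ P ∈ irrFin q n, (n : ℝ) * ((resSym q (twist Q i) P : ℝ) *
        tZ P ((2 * g + 1 : ℕ) - Q.natDegree * i)) := by
  simp only [Finset.mul_sum, avgW]
  rw [Finset.sum_comm]
  refine Finset.sum_congr rfl fun P hP => ?_
  rw [mem_irrFin] at hP
  rw [tSumQ_eq_tZ hP.1 hP.2.2 hQ hQi, Finset.mul_sum]
  refine Finset.sum_congr rfl fun i _ => ?_
  rw [resSym_twist hP.1 hP.2.2]
  push_cast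
  ring

lemma abs_avgW_sub_mainW_le (hq2 : q ≠ 2) (hQ : Q.Monic) (hQi : Irreducible Q) {g n : ℕ}
    (hn : g < n) :
    |avgW g n Q - mainW q g n Q.natDegree|
      ≤ (2 * g + 2) * (30 * (3 + n + 2 * Q.natDegree) * (2 + 2 * q) * (q : ℝ) ^ n) := by
  have hq := two_le_cast q
  have hq0 : (q : ℝ) ≠ 0 := by linarith
  have hd := hQi.natDegree_pos
  set d := Q.natDegree with hd'
  have hneg : ∀ i : ℕ, ((2 * g + 1 : ℕ) : ℤ) - d * i < 0 →
      ∑ P ∈ irrFin q n, (n : ℝ) * ((resSym q (twist Q i) P : ℝ) *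
        tZ P ((2 * g + 1 : ℕ) - d * i)) = 0 := by
    intro i hi
    refine Finset.sum_eq_zero fun P _ => ?_
    rw [tZ, if_neg hi.not_ge, mul_zero, mul_zero]
  have hdeg : ∀ i, ((twist Q i).natDegree : ℝ) ≤ 2 * d := fun i => by
    exact_mod_cast natDegree_twist_le hQ i
  have hB : (0 : ℝ) ≤ 30 * (3 + n + 2 * d) * (2 + 2 * q) * (q : ℝ) ^ n := by positivity
  have hcard : (2 * (g : ℝ) + 2) * (30 * (3 + n + 2 * d) * (2 + 2 * q) * (q : ℝ) ^ n)
      = ∑ i ∈ Finset.range (2 * g + 2), 30 * (3 + n + 2 * d) * (2 + 2 * q) * (q : ℝ) ^ n := by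
    rw [Finset.sum_const, Finset.card_range, nsmul_eq_mul]; push_cast; ring
  rw [avgW_eq hQ hQi, hcard]
  rcases Nat.even_or_odd' n with ⟨s, rfl | rfl⟩
  · rw [mainW_eq_sum, ← Finset.sum_sub_distrib]
    refine (Finset.abs_sum_le_sum_abs _ _).trans (Finset.sum_le_sum fun i _ => ?_)
    simp only [mul_assoc ((-1 : ℝ) ^ i)]
    rw [← mul_sub, abs_mul, abs_pow, abs_neg, abs_one, one_pow, one_mul]
    rcases lt_or_ge (((2 * g + 1 : ℕ) : ℤ) - d * i) 0 with hk | hk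
    · rw [hneg i hk, zero_sub, abs_neg, abs_mul]
      have h1 := abs_coefA_le (q := q) (s - g + d * (i / 2 : ℕ))
      have h2 : (q : ℝ) ^ (s + 2 * g) * ((q : ℝ) ^ (d * i))⁻¹ ≤ (q : ℝ) ^ s := by
        rw [← div_eq_mul_inv, div_le_iff₀ (by positivity), ← pow_add]
        have : 2 * g + 1 < d * i := by zify; omega
        exact pow_le_pow_right₀ (by linarith) (by omega)
      rw [abs_of_nonneg (by have : (0 : ℝ) ≤ (q : ℝ) - 1 := by linarith
                            positivity)]
      have h3 : (q : ℝ) ^ s ≤ (q : ℝ) ^ (2 * s) := pow_le_pow_right₀ (by linarith) (by omega)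
      have h4 : (0 : ℝ) < (q : ℝ) ^ s := by positivity
      calc _ ≤ ((q : ℝ) - 1) * (q : ℝ) ^ s * 1 := by
            have : (0 : ℝ) ≤ (q : ℝ) - 1 := by linarith
            gcongr
        _ ≤ (2 + 2 * q) * (q : ℝ) ^ (2 * s) := by nlinarith
        _ ≤ _ := by
            rw [mul_assoc (30 * _)]
            refine le_mul_of_one_le_left (by positivity) ?_
            have : (0 : ℝ) ≤ ((2 * s : ℕ) : ℝ) := by positivity
            nlinarith
    · have h1 := abs_irr_sum_tZ_sub_le_of_even hq2 (s := s) (by omega) (twist_monic hQ i) hk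
        (by have : (0 : ℤ) ≤ d * i := by positivity
            omega)
      rw [sqTotal_bracket (x := s - g + d * (i / 2 : ℕ)) (sqCount_twist hQ hQi i)] at h1
      · have h2 : (q : ℝ) ^ (((2 * g + 1 : ℕ) : ℤ) - d * i - s) * (q : ℝ) ^ (2 * s) *
            (((q : ℝ) - 1) / q * coefA q (s - g + d * (i / 2 : ℕ)))
            = ((q : ℝ) - 1) * ((q : ℝ) ^ (s + 2 * g) * ((q : ℝ) ^ (d * i))⁻¹)
              * coefA q (s - g + d * (i / 2 : ℕ)) := by
          have h3 : (q : ℝ) ^ (((2 * g + 1 : ℕ) : ℤ) - d * i - s) * (q : ℝ) ^ (2 * s)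
              = (q : ℝ) ^ (s + 2 * g) * ((q : ℝ) ^ (d * i))⁻¹ * q := by
            rw [← zpow_natCast, ← zpow_natCast, ← zpow_natCast, ← zpow_neg, ← zpow_add₀ hq0,
              ← zpow_add₀ hq0, ← zpow_add_one₀ hq0]
            congr 1
            push_cast
            ring
          rw [h3]
          field_simp
        rw [← h2]
        refine h1.trans ?_
        have := hdeg i
        push_cast
        gcongr
      · unfold twistDeg
        rcases Nat.even_or_odd' i with ⟨j, rfl | rfl⟩
        · rw [if_pos (even_two_mul j), Nat.mul_div_cancel_left _ two_pos]; push_cast; ring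
        · rw [if_neg (by simp), show (2 * j + 1) / 2 = j by omega]; push_cast; ring
  · rw [mainW, if_neg (by simp), sub_zero]
    refine (Finset.abs_sum_le_sum_abs _ _).trans (Finset.sum_le_sum fun i _ => ?_)
    rw [abs_mul, abs_pow, abs_neg, abs_one, one_pow, one_mul]
    rcases lt_or_ge (((2 * g + 1 : ℕ) : ℤ) - d * i) 0 with hk | hk
    · rw [hneg i hk, abs_zero]; exact hB
    · refine (abs_irr_sum_tZ_le_of_odd hq2 (twist_monic hQ i) hk
        (by have : (0 : ℤ) ≤ d * i := by positivity
            omega) ?_).trans ?_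
      · intro j hj
        rw [sqCount_twist hQ hQi, if_neg]
        rintro ⟨h1, m, hm⟩
        unfold twistDeg at h1 hm
        obtain ⟨a, ha⟩ := hj
        rcases Nat.even_or_odd' i with ⟨b, rfl | rfl⟩
        · rw [if_pos (even_two_mul b), Nat.sub_zero] at hm
          have : ((d * (2 * b) : ℕ) : ℤ) = 2 * (d * b : ℕ) := by push_cast; ring
          push_cast at this ha
          omega
        · rw [if_neg (by simp)] at hm h1
          have : ((d : ℤ) * ((2 * b + 1 : ℕ) : ℤ)) = 2 * (d * b : ℕ) + d := by push_cast; ring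
          rw [this] at ha
          omega
      · have := hdeg i
        push_cast
        gcongr

lemma abs_avgW_le (hq2 : q ≠ 2) (hQ : Q.Monic) (hQi : Irreducible Q) (g n : ℕ) :
    |avgW g n Q| ≤ (2 * g + 2) * (q + 1) * ((q : ℝ) ^ n * (q : ℝ) ^ n) := by
  have hq := two_le_cast q
  have h1 : ∀ P ∈ irrFin q n, |(n : ℝ) * (tSumQ P Q (2 * g + 1) : ℝ)|
      ≤ n * ((2 * g + 2) * ((q + 1) * (q : ℝ) ^ n)) := by
    intro P hP
    rw [mem_irrFin] at hP
    rw [abs_mul, Nat.abs_cast]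
    refine mul_le_mul_of_nonneg_left ?_ (Nat.cast_nonneg _)
    rw [tSumQ_eq_tZ hP.1 hP.2.2 hQ hQi]
    refine (Finset.abs_sum_le_sum_abs _ _).trans ?_
    refine (Finset.sum_le_card_nsmul _ _ ((q + 1) * (q : ℝ) ^ n) fun i _ => ?_).trans (le_of_eq ?_)
    · rw [abs_mul, abs_mul, abs_pow, abs_neg, abs_one, one_pow, one_mul]
      have h2 : |(resSym q Q P : ℝ) ^ i| ≤ 1 := by
        rw [abs_pow]
        refine pow_le_one₀ (abs_nonneg _) ?_
        exact_mod_cast abs_resSym_le Q P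
      have h3 : |tZ P ((2 * g + 1 : ℕ) - Q.natDegree * i)| ≤ (q + 1) * (q : ℝ) ^ n := by
        unfold tZ
        split_ifs
        · have := abs_tSum_le hq2 hP.1 hP.2.2 (((2 * g + 1 : ℕ) : ℤ) - Q.natDegree * i).toNat
          rw [hP.2.1] at this
          exact_mod_cast this
        · rw [abs_zero]; positivity
      calc _ ≤ 1 * ((q + 1) * (q : ℝ) ^ n) := by gcongr
        _ = _ := one_mul _
    · rw [Finset.card_range, nsmul_eq_mul]; push_cast; ring
  refine (Finset.abs_sum_le_sum_abs _ _).trans ((Finset.sum_le_card_nsmul _ _ _ h1).trans ?_)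
  rw [nsmul_eq_mul]
  rcases Nat.eq_zero_or_pos n with rfl | hn
  · simp; positivity
  have h4 : (n : ℝ) * (irrFin q n).card ≤ (q : ℝ) ^ n := by exact_mod_cast card_irrFin_le hn
  calc _ = ((n : ℝ) * (irrFin q n).card) * ((2 * g + 2) * ((q + 1) * (q : ℝ) ^ n)) := by ring
    _ ≤ (q : ℝ) ^ n * ((2 * g + 2) * ((q + 1) * (q : ℝ) ^ n)) := by gcongr
    _ = _ := by ring

end MainTerm

section Annulus

open Metric Filter Topology MeasureTheory

lemma norm_sub_le_norm_mul_sub {z w : ℂ} {s : ℝ} (hs : 1 ≤ s) (h : ‖w‖ = ‖z‖) :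
    ‖z - w‖ ≤ ‖s * z - w‖ := by
  rw [← sq_le_sq₀ (norm_nonneg _) (norm_nonneg _), ← Complex.normSq_eq_norm_sq,
    ← Complex.normSq_eq_norm_sq, Complex.normSq_sub, Complex.normSq_sub, Complex.normSq_mul,
    Complex.normSq_ofReal, mul_assoc, mul_assoc (s : ℂ), Complex.re_ofReal_mul]
  have h1 : (z * (starRingEnd ℂ) w).re ≤ Complex.normSq z := by
    refine (Complex.re_le_norm _).trans ?_
    rw [norm_mul, Complex.norm_conj, h, Complex.normSq_eq_norm_sq, sq]
  have h2 := Complex.normSq_nonneg z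
  nlinarith [mul_nonneg (sub_nonneg.2 hs) (sub_nonneg.2 h1), mul_nonneg (sub_nonneg.2 hs) h2,
    mul_nonneg (mul_nonneg (sub_nonneg.2 hs) (sub_nonneg.2 hs)) h2]

/-- A sector-free bound for the integral along `‖u‖ = r` of a function with simple poles at
the `M`-th roots of `w`, uniform in the position of these poles. -/
lemma norm_circleIntegral_le_of_annulus {r₁ r r₂ B : ℝ} (h0 : 0 < r₁) (h1 : r₁ < r) (h2 : r < r₂)
    {M : ℕ} (hM : M ≠ 0) {h f : ℂ → ℂ} {w : ℂ}
    (hd : ∀ z : ℂ, r₁ ≤ ‖z‖ → ‖z‖ ≤ r₂ → DifferentiableAt ℂ h z)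
    (hB : ∀ z : ℂ, r₁ ≤ ‖z‖ → ‖z‖ ≤ r₂ → ‖h z‖ ≤ B)
    (hf : ∀ z : ℂ, ‖z‖ = r → z ^ M ≠ w → f z = h z / (z ^ M - w)) :
    ‖∮ u in C(0, r), f u‖ ≤ 2 * Real.pi * r₂ * (B / (r₂ ^ M - r ^ M))
      + 2 * Real.pi * r₁ * (B / (r ^ M - r₁ ^ M)) := by
  have hr : 0 < r := h0.trans h1
  have hr2 : 0 < r₂ := hr.trans h2
  have hp2 : 0 < r₂ ^ M - r ^ M := sub_pos.2 (pow_lt_pow_left₀ h2 hr.le hM)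
  have hp1 : 0 < r ^ M - r₁ ^ M := sub_pos.2 (pow_lt_pow_left₀ h1 h0.le hM)
  have hB0 : 0 ≤ B := (norm_nonneg _).trans (hB r₂ (by
    rw [Complex.norm_real, Real.norm_of_nonneg hr2.le]; linarith) (by
    rw [Complex.norm_real, Real.norm_of_nonneg hr2.le]))
  have hpos1 : 0 ≤ 2 * Real.pi * r₂ * (B / (r₂ ^ M - r ^ M)) := by positivity
  have hpos2 : 0 ≤ 2 * Real.pi * r₁ * (B / (r ^ M - r₁ ^ M)) := by positivity
  set G : ℂ → ℂ := fun z => h z / (z ^ M - w) with hG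
  have hGd : ∀ z : ℂ, r₁ ≤ ‖z‖ → ‖z‖ ≤ r₂ → z ^ M ≠ w → DifferentiableAt ℂ G z := by
    intro z hz1 hz2 hzw
    exact (hd z hz1 hz2).div (by fun_prop) (sub_ne_zero.2 hzw)
  -- contours outside the poles
  have hout : ∀ ρ, r ≤ ρ → ρ ≤ r₂ → ‖w‖ < ρ ^ M → ‖w‖ ≤ r ^ M →
      ‖∮ u in C(0, ρ), G u‖ ≤ 2 * Real.pi * r₂ * (B / (r₂ ^ M - r ^ M)) := by
    intro ρ hρ1 hρ2 hwρ hwr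
    have hne : ∀ z : ℂ, ρ ≤ ‖z‖ → z ^ M ≠ w := by
      rintro z hz rfl
      rw [norm_pow] at hwρ
      exact absurd (pow_le_pow_left₀ (hr.le.trans hρ1) hz M) hwρ.not_ge
    rw [← Complex.circleIntegral_eq_of_differentiable_on_annulus_off_countable
      (hr.trans_le hρ1) hρ2 (f := G) Set.countable_empty]
    · refine circleIntegral.norm_integral_le_of_norm_le_const hr2.le fun z hz => ?_
      rw [mem_sphere_zero_iff_norm] at hz
      rw [hG, norm_div]
      refine div_le_div₀ hB0 (hB z (by linarith) hz.le) hp2 ?_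
      calc r₂ ^ M - r ^ M ≤ ‖z ^ M‖ - ‖w‖ := by rw [norm_pow, hz]; linarith
        _ ≤ _ := norm_sub_norm_le _ _
    · intro z hz
      simp only [Set.mem_sdiff, mem_closedBall_zero_iff, mem_ball_zero_iff, not_lt] at hz
      exact (hGd z (by linarith) hz.1 (hne z hz.2)).continuousAt.continuousWithinAt
    · intro z hz
      simp only [Set.mem_sdiff, mem_closedBall_zero_iff, mem_ball_zero_iff, not_le] at hz
      exact hGd z (by linarith) hz.1.1.le (hne z hz.1.2.le)
  rcases lt_trichotomy ‖w‖ (r ^ M) with hw | hw | hw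
  · have : (∮ u in C(0, r), f u) = ∮ u in C(0, r), G u := by
      refine circleIntegral.integral_congr hr.le fun z hz => ?_
      rw [mem_sphere_zero_iff_norm] at hz
      refine hf z hz ?_
      rintro rfl
      rw [norm_pow, hz] at hw
      exact lt_irrefl _ hw
    rw [this]
    linarith [hout r le_rfl h2.le hw hw.le]
  · by_cases hint : CircleIntegrable f 0 r
    swap
    · rw [circleIntegral.integral_undef hint, norm_zero]; linarith
    -- Lipschitz bound for `h` in the radial direction
    set r₃ := (r + r₂) / 2 with hr3
    have h23 : r₃ < r₂ := by rw [hr3]; linarith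
    have h3 : r < r₃ := by rw [hr3]; linarith
    obtain ⟨L, hL⟩ : ∃ L, ∀ z : ℂ, r ≤ ‖z‖ → ‖z‖ ≤ r₃ → ‖deriv h z‖ ≤ L := by
      have ho : IsOpen {z : ℂ | r₁ < ‖z‖ ∧ ‖z‖ < r₂} :=
        (isOpen_lt continuous_const continuous_norm).inter
          (isOpen_lt continuous_norm continuous_const)
      have hdo : DifferentiableOn ℂ h {z : ℂ | r₁ < ‖z‖ ∧ ‖z‖ < r₂} := fun z hz =>
        (hd z hz.1.le hz.2.le).differentiableWithinAt
      have hK : IsCompact (closedBall (0 : ℂ) r₃ \ ball 0 r) :=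
        (isCompact_closedBall _ _).diff isOpen_ball
      obtain ⟨L, hL⟩ := hK.exists_bound_of_continuousOn (f := deriv h) (by
        refine (hdo.deriv ho).continuousOn.mono fun z hz => ?_
        simp only [Set.mem_sdiff, mem_closedBall_zero_iff, mem_ball_zero_iff, not_lt] at hz
        exact ⟨by linarith, by linarith⟩)
      exact ⟨L, fun z hz1 hz2 => hL z (by
        simp only [Set.mem_sdiff, mem_closedBall_zero_iff, mem_ball_zero_iff, not_lt]
        exact ⟨hz2, hz1⟩)⟩
    have hL0 : 0 ≤ L := (norm_nonneg _).trans (hL r (by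
      rw [Complex.norm_real, Real.norm_of_nonneg hr.le]) (by
      rw [Complex.norm_real, Real.norm_of_nonneg hr.le]; exact h3.le))
    have hcm : ∀ ρ θ : ℝ, circleMap 0 ρ θ = ρ * circleMap 0 1 θ := by
      intro ρ θ; simp [circleMap]
    have hcn : ∀ ρ θ : ℝ, 0 ≤ ρ → ‖circleMap 0 ρ θ‖ = ρ := by
      intro ρ θ hρ; simp [circleMap, abs_of_nonneg hρ]
    have hLip : ∀ ρ θ : ℝ, r ≤ ρ → ρ ≤ r₃ →
        ‖h (circleMap 0 ρ θ) - h (circleMap 0 r θ)‖ ≤ L * (ρ - r) := by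
      intro ρ θ hρ1 hρ2
      have key := norm_image_sub_le_of_norm_deriv_le_segment'
        (f := fun s : ℝ => h (circleMap 0 s θ))
        (f' := fun s => deriv h (circleMap 0 s θ) * circleMap 0 1 θ) (C := L) (a := r) (b := ρ)
        (fun s hs => by
          have hs' := hcn s θ (hr.le.trans hs.1)
          have h5 := (hd (circleMap 0 s θ) (by linarith [hs.1]) (by linarith [hs.2])).hasDerivAt
          have h6 : HasDerivAt (fun s : ℝ => circleMap 0 s θ) (circleMap 0 1 θ) s := by
            have := (Complex.ofRealCLM.hasDerivAt (x := s)).mul_const (circleMap 0 1 θ)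
            simpa only [Complex.ofRealCLM_apply, Complex.ofReal_one, one_mul, ← hcm] using this
          exact (h5.comp s h6).hasDerivWithinAt)
        (fun s hs => by
          have hs' := hcn s θ (hr.le.trans hs.1)
          rw [norm_mul, hcn 1 θ zero_le_one, mul_one]
          exact hL _ (by linarith [hs.1]) (by linarith [hs.2]))
        ρ ⟨hρ1, le_rfl⟩
      exact key
    have hcount : (circleMap 0 r ⁻¹' {z : ℂ | z ^ M = w}).Countable := by
      refine Set.Countable.preimage_circleMap (Set.Finite.countable ?_) 0 hr.ne'
      refine (Polynomial.nthRoots M w).toFinset.finite_toSet.subset fun z hz => ?_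
      simpa [Polynomial.mem_nthRoots (Nat.pos_of_ne_zero hM)] using hz
    have hae : ∀ᵐ θ : ℝ, (circleMap 0 r θ) ^ M ≠ w := by
      rw [ae_iff]
      simpa [Set.preimage] using hcount.measure_zero volume
    have hlt : ∀ ρ, r < ρ → 0 < ρ ^ M - r ^ M := fun ρ hρ =>
      sub_pos.2 (pow_lt_pow_left₀ hρ hr.le hM)
    have hlow : ∀ ρ θ : ℝ, r ≤ ρ → ρ ^ M - r ^ M ≤ ‖circleMap 0 ρ θ ^ M - w‖ := by
      intro ρ θ hρ
      refine le_trans (le_of_eq ?_) (norm_sub_norm_le _ _)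
      rw [norm_pow, hcn ρ θ (hr.le.trans hρ), hw]
    have hbound : ∀ ρ θ : ℝ, r < ρ → ρ ≤ r₃ → (circleMap 0 r θ) ^ M ≠ w →
        ‖deriv (circleMap 0 ρ) θ • G (circleMap 0 ρ θ)‖
          ≤ r₃ * (‖f (circleMap 0 r θ)‖ + L / r ^ (M - 1)) := by
      intro ρ θ hρ1 hρ2 hne
      have h4 := hlow ρ θ hρ1.le
      have h5 := hlt ρ hρ1
      have h6 : ‖circleMap 0 r θ ^ M - w‖ ≤ ‖circleMap 0 ρ θ ^ M - w‖ := by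
        have h7 : circleMap 0 ρ θ ^ M = ((ρ / r) ^ M : ℝ) * circleMap 0 r θ ^ M := by
          rw [hcm ρ, hcm r, mul_pow, mul_pow]
          push_cast
          rw [div_pow, ← mul_assoc, div_mul_cancel₀ _ (pow_ne_zero _ (by exact_mod_cast hr.ne'))]
        rw [h7]
        refine norm_sub_le_norm_mul_sub (one_le_pow₀ ?_) ?_
        · rw [le_div_iff₀ hr]; linarith
        · rw [hw, norm_pow, hcn r θ hr.le]
      have h8 : 0 < ‖circleMap 0 r θ ^ M - w‖ := norm_pos_iff.2 (sub_ne_zero.2 hne)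
      rw [norm_smul, deriv_circleMap, norm_mul, Complex.norm_I, mul_one,
        hcn ρ θ (hr.le.trans hρ1.le), hf _ (hcn r θ hr.le) hne, hG, norm_div, norm_div]
      refine mul_le_mul hρ2 ?_ (by positivity) (by linarith)
      have h9 : ‖h (circleMap 0 ρ θ)‖ ≤ ‖h (circleMap 0 r θ)‖ + L * (ρ - r) := by
        have := norm_le_norm_add_norm_sub' (h (circleMap 0 ρ θ)) (h (circleMap 0 r θ))
        linarith [hLip ρ θ hρ1.le hρ2]
      have h10 : r ^ (M - 1) * (ρ - r) ≤ ρ ^ M - r ^ M := by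
        obtain ⟨m, rfl⟩ : ∃ m, M = m + 1 := ⟨M - 1, by omega⟩
        rw [Nat.add_sub_cancel]
        have := pow_le_pow_left₀ hr.le hρ1.le m
        have := mul_le_mul_of_nonneg_right this (hr.le.trans hρ1.le)
        rw [pow_succ, pow_succ]
        linarith
      calc _ ≤ (‖h (circleMap 0 r θ)‖ + L * (ρ - r)) / ‖circleMap 0 ρ θ ^ M - w‖ := by gcongr
        _ = ‖h (circleMap 0 r θ)‖ / ‖circleMap 0 ρ θ ^ M - w‖
            + L * (ρ - r) / ‖circleMap 0 ρ θ ^ M - w‖ := add_div _ _ _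
        _ ≤ _ := by
          refine add_le_add (by gcongr) ?_
          rw [div_le_div_iff₀ (h5.trans_le h4) (by positivity)]
          have := mul_le_mul_of_nonneg_left (h10.trans h4) hL0
          linarith
    have hlim : Tendsto (fun ρ => ∮ u in C(0, ρ), G u) (𝓝[>] r) (𝓝 (∮ u in C(0, r), f u)) := by
      have hev : ∀ᶠ ρ in 𝓝[>] r, ρ ∈ Set.Ioc r r₃ := Ioc_mem_nhdsGT h3
      refine intervalIntegral.tendsto_integral_filter_of_dominated_convergence
        (fun θ => r₃ * (‖f (circleMap 0 r θ)‖ + L / r ^ (M - 1))) ?_ ?_ ?_ ?_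
      · filter_upwards [hev] with ρ hρ
        refine Continuous.aestronglyMeasurable ?_
        have h4 : Continuous fun θ => G (circleMap 0 ρ θ) := by
          refine continuous_iff_continuousAt.2 fun θ => ?_
          have h5 := hcn ρ θ (hr.le.trans hρ.1.le)
          refine ContinuousAt.comp (hGd _ (by linarith [hρ.1]) (by linarith [hρ.2]) ?_).continuousAt
            (continuous_circleMap 0 ρ).continuousAt
          intro h6
          have := hlow ρ θ hρ.1.le
          rw [h6, sub_self, norm_zero] at this
          linarith [hlt ρ hρ.1]
        simp only [deriv_circleMap]
        exact ((continuous_circleMap 0 ρ).mul continuous_const).smul h4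
      · filter_upwards [hev] with ρ hρ
        filter_upwards [hae] with θ hθ _
        exact hbound ρ θ hρ.1 hρ.2 hθ
      · exact (hint.norm.add intervalIntegrable_const).const_mul _
      · filter_upwards [hae] with θ hθ _
        refine Tendsto.mono_left ?_ nhdsWithin_le_nhds
        rw [hf _ (hcn r θ hr.le) hθ]
        have h4 : ContinuousAt (fun ρ : ℝ => circleMap 0 ρ θ) r := by
          have : (fun ρ : ℝ => circleMap 0 ρ θ) = fun ρ : ℝ => (ρ : ℂ) * circleMap 0 1 θ :=
            funext fun ρ => hcm ρ θ
          rw [this]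
          fun_prop
        have h5 := hcn r θ hr.le
        have h6 : ContinuousAt (fun ρ : ℝ => G (circleMap 0 ρ θ)) r :=
          ContinuousAt.comp (f := fun ρ : ℝ => circleMap 0 ρ θ)
            (hGd _ (by linarith) (by linarith) hθ).continuousAt h4
        simp only [deriv_circleMap]
        exact (h4.mul continuousAt_const).smul h6
    have hfin := le_of_tendsto hlim.norm (b := 2 * Real.pi * r₂ * (B / (r₂ ^ M - r ^ M))) (by
      filter_upwards [Ioc_mem_nhdsGT h3] with ρ hρ
      refine hout ρ hρ.1.le (by linarith [hρ.2]) ?_ hw.le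
      linarith [hlt ρ hρ.1])
    linarith
  · have hne : ∀ z : ℂ, ‖z‖ ≤ r → z ^ M ≠ w := by
      rintro z hz rfl
      rw [norm_pow] at hw
      exact absurd (pow_le_pow_left₀ (norm_nonneg z) hz M) hw.not_ge
    have : (∮ u in C(0, r), f u) = ∮ u in C(0, r), G u := by
      refine circleIntegral.integral_congr hr.le fun z hz => ?_
      rw [mem_sphere_zero_iff_norm] at hz
      exact hf z hz (hne z hz.le)
    rw [this, Complex.circleIntegral_eq_of_differentiable_on_annulus_off_countable
      h0 h1.le (f := G) Set.countable_empty]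
    · have : ‖∮ u in C(0, r₁), G u‖ ≤ 2 * Real.pi * r₁ * (B / (r ^ M - r₁ ^ M)) := by
        refine circleIntegral.norm_integral_le_of_norm_le_const h0.le fun z hz => ?_
        rw [mem_sphere_zero_iff_norm] at hz
        rw [hG, norm_div]
        refine div_le_div₀ hB0 (hB z hz.ge (by linarith)) hp1 ?_
        calc r ^ M - r₁ ^ M ≤ ‖w‖ - ‖z ^ M‖ := by rw [norm_pow, hz]; linarith
          _ ≤ ‖w - z ^ M‖ := norm_sub_norm_le _ _
          _ = _ := norm_sub_rev _ _
      linarith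
    · intro z hz
      simp only [Set.mem_sdiff, mem_closedBall_zero_iff, mem_ball_zero_iff, not_lt] at hz
      exact (hGd z hz.2 (by linarith) (hne z hz.1)).continuousAt.continuousWithinAt
    · intro z hz
      simp only [Set.mem_sdiff, mem_closedBall_zero_iff, mem_ball_zero_iff, not_le] at hz
      exact hGd z hz.1.2.le (by linarith [hz.1.1]) (hne z hz.1.1.le)

end Annulus

section ContourBound

open Metric Filter Topology MeasureTheory

variable {q : ℕ} [Fact q.Prime]

variable (q) in
/-- The contribution of a single prime of degree `d` to `Kfun`. -/
def kTerm (d : ℕ) (α β u : ℂ) : ℂ :=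
  (d : ℂ) * ((q : ℂ) ^ ((d : ℂ) * (2 * (1 - α))) - (q : ℂ) ^ ((d : ℂ) * (1 - 2 * α))) *
    u ^ (4 * d) /
    (((q : ℂ) ^ ((d : ℂ) * (2 * (1 - α))) * u ^ (2 * d) - 1) *
      ((q : ℂ) ^ ((d : ℂ) * (1 + 2 * β)) - u ^ (2 * d)))

lemma Kfun_eq (g : ℕ) (α β u : ℂ) :
    Kfun q g α β u = ∑ d ∈ Finset.Ico 1 g, ((irrFin q d).card : ℂ) * kTerm q d α β u := by
  have h1 : Kfun q g α β u = ∑' Q : (ZMod q)[X], Set.indicator {Q | Q.Monic ∧ Irreducible Q}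
      (fun Q => if Q.natDegree < g then kTerm q Q.natDegree α β u else 0) Q :=
    tsum_subtype {Q : (ZMod q)[X] | Q.Monic ∧ Irreducible Q}
      (fun Q => if Q.natDegree < g then kTerm q Q.natDegree α β u else 0)
  rw [h1, tsum_eq_sum (s := (Finset.Ico 1 g).biUnion (irrFin q))]
  · rw [Finset.sum_biUnion]
    · refine Finset.sum_congr rfl fun d hd => ?_
      rw [← nsmul_eq_mul, ← Finset.sum_const]
      refine Finset.sum_congr rfl fun Q hQ => ?_
      rw [mem_irrFin] at hQ
      rw [Set.indicator_of_mem (show Q ∈ {Q | Q.Monic ∧ Irreducible Q} from ⟨hQ.1, hQ.2.2⟩),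
        hQ.2.1, if_pos (Finset.mem_Ico.1 hd).2]
    · intro a _ b _ hab
      refine Finset.disjoint_left.2 fun Q hQ hQ' => hab ?_
      rw [mem_irrFin] at hQ hQ'
      exact hQ.2.1.symm.trans hQ'.2.1
  · intro Q hQ
    by_cases hm : Q ∈ {Q : (ZMod q)[X] | Q.Monic ∧ Irreducible Q}
    · rw [Set.indicator_of_mem hm, if_neg]
      intro hlt
      exact hQ (Finset.mem_biUnion.2 ⟨Q.natDegree, Finset.mem_Ico.2 ⟨hm.2.natDegree_pos, hlt⟩,
        mem_irrFin.2 ⟨hm.1, rfl, hm.2⟩⟩)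
    · rw [Set.indicator_of_notMem hm]

lemma exists_circleIntegral_bound {S : Set ℂ} (hS : IsClosed S) {r₁ r r₂ R : ℝ} (h0 : 0 < r₁)
    (h1 : r₁ < r) (h2 : r < r₂) {M : ℕ} (hM : M ≠ 0) {w : ℂ → ℂ} {f h : ℂ → ℂ → ℂ → ℂ}
    (hd : ∀ α ∈ S, ‖α‖ ≤ R → ∀ β : ℂ, ‖β‖ ≤ R → ∀ u : ℂ, r₁ ≤ ‖u‖ → ‖u‖ ≤ r₂ →
      DifferentiableAt ℂ (fun p : ℂ × ℂ × ℂ => h p.1 p.2.1 p.2.2) (α, β, u))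
    (hf : ∀ α ∈ S, ‖α‖ ≤ R → ∀ β : ℂ, ‖β‖ ≤ R → ∀ u : ℂ, ‖u‖ = r → u ^ M ≠ w α →
      f α β u = h α β u / (u ^ M - w α)) :
    ∃ C, ∀ α ∈ S, ‖α‖ ≤ R → ∀ β : ℂ, ‖β‖ ≤ R → ‖∮ u in C(0, r), f α β u‖ ≤ C := by
  have hK : IsCompact ((S ∩ closedBall (0 : ℂ) R) ×ˢ
      (closedBall (0 : ℂ) R ×ˢ (closedBall (0 : ℂ) r₂ \ ball 0 r₁))) :=
    ((isCompact_closedBall _ _).inter_left hS).prod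
      ((isCompact_closedBall _ _).prod ((isCompact_closedBall _ _).diff isOpen_ball))
  obtain ⟨B, hB⟩ := hK.exists_bound_of_continuousOn
    (f := fun p : ℂ × ℂ × ℂ => h p.1 p.2.1 p.2.2) (by
      rintro ⟨α, β, u⟩ ⟨⟨hα1, hα2⟩, hβ, hu1, hu2⟩
      simp only [mem_closedBall_zero_iff, mem_ball_zero_iff, not_lt] at hα2 hβ hu1 hu2
      exact (hd α hα1 hα2 β hβ u hu2 hu1).continuousAt.continuousWithinAt)
  refine ⟨_, fun α hα1 hα2 β hβ => norm_circleIntegral_le_of_annulus h0 h1 h2 hM (B := B)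
    (h := h α β) (w := w α) ?_ ?_ (hf α hα1 hα2 β hβ)⟩
  · intro u hu1 hu2
    exact (hd α hα1 hα2 β hβ u hu1 hu2).comp (f := fun u : ℂ => (α, β, u)) u (by fun_prop)
  · intro u hu1 hu2
    refine hB (α, β, u) ⟨⟨hα1, ?_⟩, ?_, ?_, ?_⟩ <;>
      simp only [mem_closedBall_zero_iff, mem_ball_zero_iff, not_lt] <;> assumption

lemma norm_cpow_natCast (s : ℂ) : ‖(q : ℂ) ^ s‖ = (q : ℝ) ^ s.re :=
  Complex.norm_natCast_cpow_of_pos (Fact.out : q.Prime).pos s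

lemma exists_norm_eq_rpow {a b : ℝ} {u : ℂ} (h1 : (q : ℝ) ^ (-b) ≤ ‖u‖)
    (h2 : ‖u‖ ≤ (q : ℝ) ^ (-a)) :
    ∃ x : ℝ, a ≤ x ∧ x ≤ b ∧ ‖u‖ = (q : ℝ) ^ (-x) := by
  have hq := two_le_cast q
  have hu : 0 < ‖u‖ := (Real.rpow_pos_of_pos (by linarith) _).trans_le h1
  have hx : ‖u‖ = (q : ℝ) ^ (-(-Real.logb q ‖u‖)) := by
    rw [neg_neg, Real.rpow_logb (by linarith) (by linarith) hu]
  refine ⟨-Real.logb q ‖u‖, ?_, ?_, hx⟩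
  · rw [hx] at h2
    have := (Real.rpow_le_rpow_left_iff (by linarith : (1 : ℝ) < q)).1 h2
    linarith
  · rw [hx] at h1
    have := (Real.rpow_le_rpow_left_iff (by linarith : (1 : ℝ) < q)).1 h1
    linarith

lemma norm_pow_eq_rpow {u : ℂ} {x : ℝ} (h : ‖u‖ = (q : ℝ) ^ (-x)) (n : ℕ) :
    ‖u ^ n‖ = (q : ℝ) ^ (-(n * x)) := by
  rw [norm_pow, h, ← Real.rpow_natCast, ← Real.rpow_mul (Nat.cast_nonneg _)]
  congr 1; ring

lemma rpow_injective_aux {a b : ℝ} (h : (q : ℝ) ^ a = (q : ℝ) ^ b) : a = b := by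
  have hq := two_le_cast q
  refine le_antisymm ?_ ?_ <;> refine (Real.rpow_le_rpow_left_iff (by linarith : (1 : ℝ) < q)).1 ?_
  exacts [h.le, h.ge]

@[fun_prop]
lemma differentiableAt_cpow_comp {E : Type*} [NormedAddCommGroup E] [NormedSpace ℂ E] {s : E → ℂ}
    {p : E} (hs : DifferentiableAt ℂ s p) : DifferentiableAt ℂ (fun p => (q : ℂ) ^ s p) p :=
  hs.const_cpow (Or.inl (by exact_mod_cast (Fact.out : q.Prime).ne_zero))

lemma differentiableAt_div_comp {E : Type*} [NormedAddCommGroup E] [NormedSpace ℂ E] {a b : E → ℂ}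
    {p : E} (ha : DifferentiableAt ℂ a p) (hb : DifferentiableAt ℂ b p) (h : b p ≠ 0) :
    DifferentiableAt ℂ (fun p => a p / b p) p := by
  simp only [div_eq_mul_inv]
  exact ha.fun_mul (hb.fun_inv h)

lemma exists_contour_bound {ε : ℝ} (hε0 : 0 < ε) (hε1 : ε < 1) {g : ℕ} (hg : 1 ≤ g) (N : ℕ) :
    ∃ C, ∀ α β : ℂ, ‖α‖ ≤ 1 / (g : ℝ) → ‖β‖ ≤ 1 / (g : ℝ) →
      ‖∮ u in C(0, (q : ℝ) ^ (-ε)), (q : ℂ) ^ (-2 * (g : ℂ) * α) * u ^ (2 * g) * A2 q u α *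
        Kfun q g α β u / (u ^ (N + 1) * (1 - u))‖ ≤ C := by
  have hq := two_le_cast q
  have hq1 : (1 : ℝ) < q := by linarith
  have hqC : (q : ℂ) ≠ 0 := by exact_mod_cast (Fact.out : q.Prime).ne_zero
  have hqC1 : (q : ℂ) - 1 ≠ 0 := sub_ne_zero.2 (by exact_mod_cast hq1.ne')
  rcases hg.eq_or_lt with rfl | hg2
  · refine ⟨0, fun α β _ _ => ?_⟩
    simp [Kfun_eq, circleIntegral]
  have hgR : (1 : ℝ) / g ≤ 1 / 2 := by
    have : (2 : ℝ) ≤ g := by exact_mod_cast hg2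
    exact one_div_le_one_div_of_le (by norm_num) this
  set r₁ : ℝ := (q : ℝ) ^ (-(5 * ε / 4)) with hr1
  set r₂ : ℝ := (q : ℝ) ^ (-(3 * ε / 4)) with hr2
  have h0 : 0 < r₁ := Real.rpow_pos_of_pos (by linarith) _
  have h1 : r₁ < (q : ℝ) ^ (-ε) := Real.rpow_lt_rpow_of_exponent_lt hq1 (by linarith)
  have h2 : (q : ℝ) ^ (-ε) < r₂ := Real.rpow_lt_rpow_of_exponent_lt hq1 (by linarith)
  have hu0 : ∀ u : ℂ, r₁ ≤ ‖u‖ → u ≠ 0 := fun u hu => norm_pos_iff.1 (h0.trans_le hu)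
  have hu1 : ∀ u : ℂ, ‖u‖ ≤ r₂ → 1 - u ≠ 0 := by
    intro u hu h
    rw [← sub_eq_zero.1 h, norm_one] at hu
    have : r₂ < 1 := Real.rpow_lt_one_of_one_lt_of_neg hq1 (by linarith)
    linarith
  have hW : ∀ d ∈ Finset.Ico 1 g, ∀ β : ℂ, ‖β‖ ≤ 1 / (g : ℝ) → ∀ u : ℂ, r₁ ≤ ‖u‖ → ‖u‖ ≤ r₂ →
      (q : ℂ) ^ ((d : ℂ) * (1 + 2 * β)) - u ^ (2 * d) ≠ 0 := by
    intro d hd β hβ u h3 h4 h5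
    obtain ⟨x, hx1, hx2, hx⟩ := exists_norm_eq_rpow h3 h4
    have h6 := congrArg norm (sub_eq_zero.1 h5)
    rw [norm_cpow_natCast, norm_pow_eq_rpow hx] at h6
    have h7 := rpow_injective_aux h6
    have h8 : (1 : ℝ) ≤ d := by exact_mod_cast (Finset.mem_Ico.1 hd).1
    have h9 := (abs_le.1 ((Complex.abs_re_le_norm β).trans hβ)).1
    simp at h7
    nlinarith
  have hnorm : ∀ u : ℂ, ‖u‖ = (q : ℝ) ^ (-ε) → r₁ ≤ ‖u‖ ∧ ‖u‖ ≤ r₂ := fun u hu =>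
    ⟨hu ▸ h1.le, hu ▸ h2.le⟩
  -- parameters for which the poles of `Kfun` stay away from the contour
  obtain ⟨CA, hCA⟩ := exists_circleIntegral_bound (S := {α : ℂ | |α.re + ε| ≤ 1 / 2})
    (isClosed_le (by fun_prop) continuous_const) (R := 1 / (g : ℝ)) h0 h1 h2 two_ne_zero
    (w := fun α => (q : ℂ) ^ (2 * α))
    (f := fun α β u => (q : ℂ) ^ (-2 * (g : ℂ) * α) * u ^ (2 * g) * A2 q u α *
        Kfun q g α β u / (u ^ (N + 1) * (1 - u)))
    (h := fun α β u => (q : ℂ) ^ (-2 * (g : ℂ) * α) * u ^ (2 * g) *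
        (u ^ 2 + (u ^ 2 - (q : ℂ) ^ (2 * α)) / ((q : ℂ) - 1)) *
        (∑ d ∈ Finset.Ico 1 g, ((irrFin q d).card : ℂ) * kTerm q d α β u) /
          (u ^ (N + 1) * (1 - u)))
    (by
      intro α hα1 hα2 β hβ u h3 h4
      refine differentiableAt_div_comp ?_ ?_ ?_
      · refine DifferentiableAt.fun_mul ?_ ?_
        · fun_prop
        refine DifferentiableAt.fun_sum fun d hd => DifferentiableAt.const_mul ?_ _
        refine differentiableAt_div_comp ?_ ?_ ?_
        · fun_prop
        · fun_prop
        refine mul_ne_zero ?_ (hW d hd β hβ u h3 h4)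
        intro h5
        obtain ⟨x, hx1, hx2, hx⟩ := exists_norm_eq_rpow h3 h4
        have h6 := congrArg norm (sub_eq_zero.1 h5)
        rw [norm_mul, norm_cpow_natCast, norm_pow_eq_rpow hx, ← Real.rpow_add (by linarith),
          norm_one, ← Real.rpow_zero (q : ℝ)] at h6
        have h7 := rpow_injective_aux h6
        have h8 : (1 : ℝ) ≤ d := by exact_mod_cast (Finset.mem_Ico.1 hd).1
        have h9 : α.re + ε ≤ 1 / 2 := (le_abs_self _).trans hα1
        simp at h7
        nlinarith
      · fun_prop
      · exact mul_ne_zero (pow_ne_zero _ (hu0 u h3)) (hu1 u h4))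
    (by
      intro α hα1 hα2 β hβ u h3 h4
      have h5 := hu0 u (hnorm u h3).1
      have h6 := hu1 u (hnorm u h3).2
      have h7 := sub_ne_zero.2 h4
      simp only [A2, Kfun_eq]
      field_simp)
  -- parameters for which the poles of `A2` stay away from the contour
  obtain ⟨CB, hCB⟩ := exists_circleIntegral_bound (S := {α : ℂ | 1 / 2 ≤ |α.re + ε|})
    (isClosed_le continuous_const (by fun_prop)) (R := 1 / (g : ℝ)) h0 h1 h2
    (M := 2 * g.factorial) (by have := g.factorial_pos; omega)
    (w := fun α => (q : ℂ) ^ (-(2 * g.factorial : ℕ) * (1 - α)))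
    (f := fun α β u => (q : ℂ) ^ (-2 * (g : ℂ) * α) * u ^ (2 * g) * A2 q u α *
        Kfun q g α β u / (u ^ (N + 1) * (1 - u)))
    (h := fun α β u => (q : ℂ) ^ (-2 * (g : ℂ) * α) * u ^ (2 * g) * A2 q u α *
        (∑ d ∈ Finset.Ico 1 g, ((irrFin q d).card : ℂ) * ((d : ℂ) *
          ((q : ℂ) ^ ((d : ℂ) * (2 * (1 - α))) - (q : ℂ) ^ ((d : ℂ) * (1 - 2 * α))) *
          u ^ (4 * d) / ((q : ℂ) ^ ((d : ℂ) * (1 + 2 * β)) - u ^ (2 * d)) *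
          ((∑ j ∈ Finset.range (g.factorial / d),
            ((q : ℂ) ^ ((d : ℂ) * (2 * (1 - α))) * u ^ (2 * d)) ^ j) *
            (q : ℂ) ^ (-(2 * g.factorial : ℕ) * (1 - α))))) /
          (u ^ (N + 1) * (1 - u)))
    (by
      intro α hα1 hα2 β hβ u h3 h4
      refine differentiableAt_div_comp ?_ ?_ ?_
      · refine DifferentiableAt.fun_mul (DifferentiableAt.fun_mul ?_ ?_) ?_
        · fun_prop
        · refine DifferentiableAt.fun_add (differentiableAt_div_comp ?_ ?_ ?_) ?_
          · fun_prop
          · fun_prop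
          · intro h5
            obtain ⟨x, hx1, hx2, hx⟩ := exists_norm_eq_rpow h3 h4
            have h6 := congrArg norm (sub_eq_zero.1 h5)
            rw [norm_cpow_natCast, norm_pow_eq_rpow hx] at h6
            have h7 := rpow_injective_aux h6
            simp at h7
            rw [Set.mem_ofPred_eq, show α.re = -x by linarith] at hα1
            rcases le_abs.1 hα1 with h8 | h8 <;> linarith
          · fun_prop
        · refine DifferentiableAt.fun_sum fun d hd => DifferentiableAt.const_mul ?_ _
          refine DifferentiableAt.fun_mul (differentiableAt_div_comp ?_ ?_ ?_) ?_
          · fun_prop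
          · fun_prop
          · exact hW d hd β hβ u h3 h4
          · fun_prop
      · fun_prop
      · exact mul_ne_zero (pow_ne_zero _ (hu0 u h3)) (hu1 u h4))
    (by
      intro α hα1 hα2 β hβ u h3 h4
      have h7 := sub_ne_zero.2 h4
      rw [Kfun_eq, div_right_comm, mul_div_assoc _ _ (u ^ (2 * g.factorial) - _)]
      congr 2
      rw [Finset.sum_div]
      refine Finset.sum_congr rfl fun d hd => ?_
      rw [mul_div_assoc]
      congr 1
      have hd' := Finset.mem_Ico.1 hd
      have h8 := hW d hd β hβ u (hnorm u h3).1 (hnorm u h3).2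
      have h9 : d * (g.factorial / d) = g.factorial :=
        Nat.mul_div_cancel' (Nat.dvd_factorial hd'.1 hd'.2.le)
      set T := g.factorial / d with hT
      set y : ℂ := (q : ℂ) ^ ((d : ℂ) * (2 * (1 - α))) * u ^ (2 * d) with hy
      set w : ℂ := (q : ℂ) ^ (-(2 * g.factorial : ℕ) * (1 - α)) with hw
      have h10 : w * y ^ T = u ^ (2 * g.factorial) := by
        rw [hy, mul_pow, ← pow_mul, mul_assoc 2 d T, h9, ← mul_assoc, ← Complex.cpow_nat_mul,
          ← Complex.cpow_add _ _ hqC]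
        rw [show (-((2 * g.factorial : ℕ) : ℂ) * (1 - α) + (T : ℂ) * ((d : ℂ) * (2 * (1 - α)))) = 0
          by rw [← h9]; push_cast; ring, Complex.cpow_zero, one_mul]
      have h11 : y - 1 ≠ 0 := by
        intro h12
        rw [sub_eq_zero.1 h12, one_pow, mul_one] at h10
        exact h4 h10.symm
      have h13 : (∑ j ∈ Finset.range T, y ^ j) * w * (y - 1) = u ^ (2 * g.factorial) - w := by
        rw [mul_right_comm, geom_sum_mul, sub_mul, one_mul, mul_comm, h10]
      unfold kTerm
      rw [← hy, ← h13]
      have h14 : (∑ j ∈ Finset.range T, y ^ j) * w * (y - 1) ≠ 0 := h13 ▸ h7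
      have h15 := left_ne_zero_of_mul h14
      rw [div_mul_eq_mul_div, div_div, mul_comm (y - 1),
        show ∀ a V G Y : ℂ, a * G / (V * (G * Y)) = a * G / (V * Y * G) from fun a V G Y => by ring,
        mul_div_mul_right _ _ h15])
  refine ⟨max CA CB, fun α β hα hβ => ?_⟩
  rcases le_total |α.re + ε| (1 / 2) with h | h
  · exact (hCA α h hα β hβ).trans (le_max_left _ _)
  · exact (hCB α h hα β hβ).trans (le_max_right _ _)

end ContourBound

section Expand

open Metric Filter Topology MeasureTheory

lemma HasSum.of_forall_eq {ι : Type*} {f h : ι → ℂ} {a : ℂ} (hf : HasSum f a)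
    (hfh : ∀ x, f x = h x) : HasSum h a := by
  rwa [← funext hfh]

lemma circleIntegral_zpow_div {r : ℝ} (h0 : 0 < r) (h1 : r < 1) (e : ℤ) :
    (∮ u in C(0, r), u ^ e / (1 - u)) = if e ≤ -1 then 2 * Real.pi * Complex.I else 0 := by
  have hne : ∀ z ∈ closedBall (0 : ℂ) r, 1 - z ≠ 0 := by
    intro z hz h
    rw [mem_closedBall_zero_iff, ← sub_eq_zero.1 h, norm_one] at hz
    linarith
  have hcont : ∀ e : ℤ, ContinuousOn (fun u : ℂ => u ^ e) (sphere 0 r) := by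
    intro e z hz
    refine (continuousAt_zpow₀ z e (Or.inl ?_)).continuousWithinAt
    rintro rfl
    simp at hz
    exact h0.ne hz
  have hcont' : ∀ e : ℤ, CircleIntegrable (fun u : ℂ => u ^ e / (1 - u)) 0 r := fun e =>
    ((hcont e).div (by fun_prop) fun z hz => hne z (sphere_subset_closedBall hz)).circleIntegrable
      h0.le
  have hnonneg : ∀ n : ℕ, (∮ u in C(0, r), u ^ (n : ℤ) / (1 - u)) = 0 := by
    intro n
    refine DiffContOnCl.circleIntegral_eq_zero h0.le (DifferentiableOn.diffContOnCl_ball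
      (U := closedBall 0 r) (fun z hz => ?_) subset_rfl)
    refine (DifferentiableAt.div ?_ (by fun_prop) (hne z hz)).differentiableWithinAt
    simp only [zpow_natCast]
    fun_prop
  have hstep : ∀ e : ℤ, (∮ u in C(0, r), u ^ e / (1 - u))
      = (∮ u in C(0, r), u ^ e) + ∮ u in C(0, r), u ^ (e + 1) / (1 - u) := by
    intro e
    rw [← circleIntegral.integral_add ((hcont e).circleIntegrable h0.le) (hcont' _)]
    refine circleIntegral.integral_congr h0.le fun z hz => ?_
    have h2 := hne z (sphere_subset_closedBall hz)
    have h3 : z ≠ 0 := by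
      rintro rfl
      simp at hz
      exact h0.ne hz
    rw [zpow_add_one₀ h3]
    field_simp
    ring
  have hm1 : (∮ u in C(0, r), u ^ (-1 : ℤ)) = 2 * Real.pi * Complex.I := by
    simpa using circleIntegral.integral_sub_center_inv 0 h0.ne'
  have hzp : ∀ e : ℤ, e ≠ -1 → (∮ u in C(0, r), u ^ e) = 0 := by
    intro e he
    simpa using circleIntegral.integral_sub_zpow_of_ne he 0 0 r
  split_ifs with he
  · obtain ⟨n, rfl⟩ : ∃ n : ℕ, e = -1 - n := ⟨(-1 - e).toNat, by omega⟩
    clear he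
    induction n with
    | zero =>
      have := hnonneg 0
      rw [hstep, show (-1 - ((0 : ℕ) : ℤ)) = -1 by simp, hm1]
      simpa using this
    | succ n ih =>
      rw [hstep, hzp _ (by push_cast; omega), zero_add, ← ih]
      congr! 4
      push_cast
      ring
  · obtain ⟨n, rfl⟩ : ∃ n : ℕ, e = n := ⟨e.toNat, by omega⟩
    exact hnonneg n

lemma hasSum_circleIntegral_zpow {ι : Type*} [Countable ι] {r : ℝ} (h0 : 0 < r) (h1 : r < 1)
    {K : ι → ℂ} {e : ι → ℤ} {f : ℂ → ℂ} (hs : Summable fun x => ‖K x‖ * r ^ e x)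
    (hf : ∀ u : ℂ, ‖u‖ = r → HasSum (fun x => K x * u ^ e x) (f u)) :
    CircleIntegrable (fun u => f u / (1 - u)) 0 r ∧
      HasSum (fun x => if e x ≤ -1 then K x else 0)
        (1 / (2 * Real.pi * Complex.I) * ∮ u in C(0, r), f u / (1 - u)) := by
  have hne : ∀ z ∈ sphere (0 : ℂ) r, 1 - z ≠ 0 := by
    intro z hz h
    rw [mem_sphere_zero_iff_norm, ← sub_eq_zero.1 h, norm_one] at hz
    linarith
  have hne0 : ∀ z ∈ sphere (0 : ℂ) r, z ≠ 0 := by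
    rintro z hz rfl
    simp at hz
    exact h0.ne hz
  have hcont : ∀ e : ℤ, ContinuousOn (fun u : ℂ => u ^ e) (sphere 0 r) := fun e z hz =>
    (continuousAt_zpow₀ z e (Or.inl (hne0 z hz))).continuousWithinAt
  have hnorm : ∀ x, ∀ u ∈ sphere (0 : ℂ) r, ‖K x * u ^ e x‖ = ‖K x‖ * r ^ e x := by
    intro x u hu
    rw [norm_mul, norm_zpow, mem_sphere_zero_iff_norm.1 hu]
  have hfc : ContinuousOn f (sphere 0 r) := by
    refine (continuousOn_tsum (fun x => continuousOn_const.mul (hcont (e x))) hs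
      fun x u hu => (hnorm x u hu).le).congr fun u hu => ?_
    exact (hf u (mem_sphere_zero_iff_norm.1 hu)).tsum_eq.symm
  refine ⟨(hfc.div (by fun_prop) hne).circleIntegrable h0.le, ?_⟩
  have key : HasSum (fun x => ∮ u in C(0, r), K x * (u ^ e x / (1 - u)))
      (∮ u in C(0, r), f u / (1 - u)) := by
    refine intervalIntegral.hasSum_integral_of_dominated_convergence
      (fun x _ => r * (‖K x‖ * r ^ e x * (1 - r)⁻¹)) ?_ ?_ ?_ ?_ ?_
    · intro x
      refine Continuous.aestronglyMeasurable ?_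
      simp only [deriv_circleMap]
      refine ((continuous_circleMap 0 r).mul continuous_const).smul (continuous_const.mul ?_)
      have : ContinuousOn (fun u : ℂ => u ^ e x / (1 - u)) (sphere 0 r) :=
        (hcont (e x)).div (by fun_prop) hne
      exact this.comp_continuous (continuous_circleMap 0 r) fun θ => circleMap_mem_sphere 0 h0.le θ
    · intro x
      refine Eventually.of_forall fun θ _ => ?_
      have hθ := circleMap_mem_sphere (0 : ℂ) h0.le θ
      beta_reduce
      rw [norm_smul, deriv_circleMap, norm_mul, Complex.norm_I, mul_one, norm_circleMap_zero,
        abs_of_pos h0, ← mul_div_assoc, norm_div, hnorm x _ hθ, div_eq_mul_inv]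
      have : 1 - r ≤ ‖1 - circleMap 0 r θ‖ := by
        have := norm_sub_norm_le (1 : ℂ) (circleMap 0 r θ)
        rwa [norm_one, norm_circleMap_zero, abs_of_pos h0] at this
      have h3 : 0 < 1 - r := by linarith
      gcongr
    · exact Eventually.of_forall fun θ _ => (hs.mul_right _).mul_left _
    · exact intervalIntegrable_const
    · refine Eventually.of_forall fun θ _ => ?_
      have hθ := circleMap_mem_sphere (0 : ℂ) h0.le θ
      have := ((hf _ (mem_sphere_zero_iff_norm.1 hθ)).div_const (1 - circleMap 0 r θ)).const_smul
        (deriv (circleMap 0 r) θ)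
      simpa only [mul_div_assoc] using this
  have h2 := key.mul_left (1 / (2 * Real.pi * Complex.I))
  refine h2.of_forall_eq fun x => ?_
  rw [circleIntegral.integral_const_mul, circleIntegral_zpow_div h0 h1]
  have := Complex.two_pi_I_ne_zero
  split_ifs
  · field_simp
  · simp

variable {q : ℕ} [Fact q.Prime]

lemma hasSum_coefA {a : ℂ} (ha : ‖a‖ < 1) :
    (Summable fun m : ℕ => ‖(coefA q m : ℂ) * a ^ m‖) ∧
      HasSum (fun m : ℕ => (coefA q m : ℂ) * a ^ m) (1 / ((q : ℂ) - 1) + 1 - (1 - a)⁻¹) := by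
  constructor
  · refine Summable.of_nonneg_of_le (fun _ => norm_nonneg _) (fun m => ?_)
      (summable_geometric_of_lt_one (norm_nonneg a) ha)
    rw [norm_mul, norm_pow, Complex.norm_real]
    exact mul_le_of_le_one_left (by positivity) (abs_coefA_le _)
  · have h1 := (hasSum_ite_eq (0 : ℕ) (1 / ((q : ℂ) - 1) + 1)).sub
      (hasSum_geometric_of_norm_lt_one ha)
    refine h1.of_forall_eq fun m => ?_
    rcases Nat.eq_zero_or_pos m with rfl | hm
    · simp [coefA]
    · simp [coefA, hm.ne', show ¬ (m : ℤ) < 0 by omega]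

lemma hasSum_mul_prod {R : Type*} [NormedField R] [CompleteSpace R] {ι κ : Type*} {f : ι → R}
    {g : κ → R} {a b : R}
    (hf : Summable fun n => ‖f n‖) (hg : Summable fun n => ‖g n‖) (hfa : HasSum f a)
    (hgb : HasSum g b) :
    (Summable fun x : ι × κ => ‖f x.1 * g x.2‖) ∧
      HasSum (fun x : ι × κ => f x.1 * g x.2) (a * b) := by
  have h := hf.mul_norm hg
  exact ⟨h, hfa.mul hgb h.of_norm⟩

lemma hasSum_triple {a b c : ℂ} (ha : ‖a‖ < 1) (hb : ‖b‖ < 1) (hc : ‖c‖ < 1) :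
    (Summable fun x : ℕ × ℕ × ℕ =>
      ‖b ^ (x.1 + 1) * (c ^ x.2.1 * ((coefA q x.2.2 : ℂ) * a ^ x.2.2))‖) ∧
    HasSum (fun x : ℕ × ℕ × ℕ =>
        b ^ (x.1 + 1) * (c ^ x.2.1 * ((coefA q x.2.2 : ℂ) * a ^ x.2.2)))
      (b * (1 - b)⁻¹ * ((1 - c)⁻¹ * (1 / ((q : ℂ) - 1) + 1 - (1 - a)⁻¹))) := by
  obtain ⟨hA, hA'⟩ := hasSum_coefA (q := q) ha
  have hC : Summable fun i : ℕ => ‖c ^ i‖ := by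
    simpa only [norm_pow] using summable_geometric_of_lt_one (norm_nonneg c) hc
  have hB' : HasSum (fun l : ℕ => b ^ (l + 1)) (b * (1 - b)⁻¹) := by
    simpa only [pow_succ'] using (hasSum_geometric_of_norm_lt_one hb).mul_left b
  have hB : Summable fun l : ℕ => ‖b ^ (l + 1)‖ := by
    simpa only [norm_pow, pow_succ', norm_mul] using
      (summable_geometric_of_lt_one (norm_nonneg b) hb).mul_left ‖b‖
  obtain ⟨h1, h2⟩ := hasSum_mul_prod hC hA (hasSum_geometric_of_norm_lt_one hc) hA'
  exact hasSum_mul_prod (f := fun l : ℕ => b ^ (l + 1))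
    (g := fun y : ℕ × ℕ => c ^ y.1 * ((coefA q y.2 : ℂ) * a ^ y.2)) hB h1 hB' h2

variable (q) in
/-- The term of index `x = (l, i, m)` in the expansion of the contour integral attached to primes
of degree `d`. -/
def cTerm (g d : ℕ) (α β : ℂ) (x : ℕ × ℕ × ℕ) : ℂ :=
  ((q : ℂ) ^ ((d : ℂ) * (1 + 2 * β)))⁻¹ ^ (x.1 + 1) *
    (((q : ℂ) ^ ((d : ℂ) * (2 * (1 - α))))⁻¹ ^ x.2.1 *
      ((coefA q x.2.2 : ℂ) * ((q : ℂ) ^ (-2 * α)) ^ (g + x.2.2)))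

variable (q) in
lemma exists_expansion {ε : ℝ} (h0 : 0 < ε) {g N d : ℕ} (hd : 0 < d) {α β : ℂ}
    (hα : -ε < α.re) (hα' : α.re < 1 - ε) (hβ : -(1 / 2) ≤ β.re) :
    CircleIntegrable (fun u => (q : ℂ) ^ (-2 * (g : ℂ) * α) * u ^ (2 * g) * A2 q u α *
        kTerm q d α β u / (u ^ (N + 1) * (1 - u))) 0 ((q : ℝ) ^ (-ε)) ∧
      HasSum (fun x : ℕ × ℕ × ℕ =>
        if 2 * (g + x.2.2) + 2 * d * (x.1 + 1) ≤ N + 2 * d * x.2.1 then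
          (d : ℂ) * (1 - ((q : ℂ) ^ d)⁻¹) * cTerm q g d α β x else 0)
        (1 / (2 * Real.pi * Complex.I) * ∮ u in C(0, (q : ℝ) ^ (-ε)),
          (q : ℂ) ^ (-2 * (g : ℂ) * α) * u ^ (2 * g) * A2 q u α *
            kTerm q d α β u / (u ^ (N + 1) * (1 - u))) := by
  have hq := two_le_cast q
  have hq1 : (1 : ℝ) < q := by linarith
  have hqc : (q : ℂ) ≠ 0 := by
    have := (Fact.out : q.Prime).ne_zero
    exact_mod_cast this
  have hd' : (0 : ℝ) < d := by exact_mod_cast hd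
  set r : ℝ := (q : ℝ) ^ (-ε) with hr
  have hr0 : 0 < r := Real.rpow_pos_of_pos (by linarith) _
  have hr1 : r < 1 := Real.rpow_lt_one_of_one_lt_of_neg hq1 (by linarith)
  set A : ℂ := (q : ℂ) ^ (-2 * α) with hA
  set Z : ℂ := (q : ℂ) ^ ((d : ℂ) * (2 * (1 - α))) with hZ
  set W : ℂ := (q : ℂ) ^ ((d : ℂ) * (1 + 2 * β)) with hW
  have hA0 : A ≠ 0 := by simp [hA, Complex.cpow_eq_zero_iff, hqc]
  have hZ0 : Z ≠ 0 := by simp [hZ, Complex.cpow_eq_zero_iff, hqc]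
  have hW0 : W ≠ 0 := by simp [hW, Complex.cpow_eq_zero_iff, hqc]
  have hrpow : ∀ k : ℕ, r ^ k = (q : ℝ) ^ (-(ε * k)) := by
    intro k
    rw [hr, ← Real.rpow_natCast, ← Real.rpow_mul (by linarith)]
    congr 1
    ring
  have hAn : ‖A‖ * r ^ 2 < 1 := by
    rw [hA, norm_cpow_natCast, hrpow, ← Real.rpow_add (by linarith)]
    refine Real.rpow_lt_one_of_one_lt_of_neg hq1 ?_
    simp
    linarith
  have hZn : (‖Z‖ * r ^ (2 * d))⁻¹ < 1 := by
    refine inv_lt_one_of_one_lt₀ ?_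
    rw [hZ, norm_cpow_natCast, hrpow, ← Real.rpow_add (by linarith)]
    refine Real.one_lt_rpow hq1 ?_
    simp
    nlinarith
  have hWn : r ^ (2 * d) * ‖W‖⁻¹ < 1 := by
    rw [hW, norm_cpow_natCast, hrpow, ← Real.rpow_neg (by linarith), ← Real.rpow_add (by linarith)]
    refine Real.rpow_lt_one_of_one_lt_of_neg hq1 ?_
    simp
    nlinarith
  set D : ℂ := (d : ℂ) * (1 - ((q : ℂ) ^ d)⁻¹) with hD
  set e : ℕ × ℕ × ℕ → ℤ := fun x =>
    2 * (g + x.2.2) + 2 * d * (x.1 + 1) - N - 2 * d * x.2.1 - 1 with he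
  have hterm : ∀ u : ℂ, u ≠ 0 → ∀ x : ℕ × ℕ × ℕ, D * cTerm q g d α β x * u ^ e x =
      D * A ^ g * u ^ (2 * g) / u ^ (N + 1) * ((u ^ (2 * d) * W⁻¹) ^ (x.1 + 1) *
        ((Z * u ^ (2 * d))⁻¹ ^ x.2.1 * ((coefA q x.2.2 : ℂ) * (A * u ^ 2) ^ x.2.2))) := by
    intro u hu x
    have h1 : u ^ e x = u ^ (2 * g) * u ^ (2 * x.2.2) * u ^ (2 * d * (x.1 + 1)) *
        (u ^ (2 * d * x.2.1))⁻¹ * (u ^ (N + 1))⁻¹ := by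
      simp only [← zpow_natCast, ← zpow_neg, ← zpow_add₀ hu, he]
      congr 1
      push_cast
      ring
    rw [h1, cTerm, ← hA, ← hZ, ← hW]
    simp only [mul_pow, mul_inv, inv_pow, pow_add, pow_mul]
    field_simp
  have hnorms : ∀ u : ℂ, ‖u‖ = r → ‖A * u ^ 2‖ < 1 ∧ ‖u ^ (2 * d) * W⁻¹‖ < 1 ∧
      ‖(Z * u ^ (2 * d))⁻¹‖ < 1 := by
    intro u hu
    simp only [norm_mul, norm_inv, norm_pow, hu]
    exact ⟨hAn, hWn, hZn⟩
  have hne : ∀ u : ℂ, ‖u‖ = r → u ≠ 0 := by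
    rintro u hu rfl
    rw [norm_zero] at hu
    exact hr0.ne hu
  have hval : ∀ u : ℂ, ‖u‖ = r → D * A ^ g * u ^ (2 * g) / u ^ (N + 1) *
      ((u ^ (2 * d) * W⁻¹) * (1 - u ^ (2 * d) * W⁻¹)⁻¹ * ((1 - (Z * u ^ (2 * d))⁻¹)⁻¹ *
        (1 / ((q : ℂ) - 1) + 1 - (1 - A * u ^ 2)⁻¹))) =
      (q : ℂ) ^ (-2 * (g : ℂ) * α) * u ^ (2 * g) * A2 q u α * kTerm q d α β u / u ^ (N + 1) := by
    intro u hu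
    obtain ⟨h1, h2, h3⟩ := hnorms u hu
    have hu0 := hne u hu
    have e1 : 1 - A * u ^ 2 ≠ 0 := by
      intro h
      rw [← sub_eq_zero.1 h, norm_one] at h1
      exact lt_irrefl _ h1
    have e2 : 1 - u ^ (2 * d) * W⁻¹ ≠ 0 := by
      intro h
      rw [← sub_eq_zero.1 h, norm_one] at h2
      exact lt_irrefl _ h2
    have e3 : 1 - (Z * u ^ (2 * d))⁻¹ ≠ 0 := by
      intro h
      rw [← sub_eq_zero.1 h, norm_one] at h3
      exact lt_irrefl _ h3
    have hqg : (q : ℂ) ^ (-2 * (g : ℂ) * α) = A ^ g := by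
      rw [hA, ← Complex.cpow_nat_mul]
      congr 1
      ring
    have hA2 : A2 q u α = 1 / ((q : ℂ) - 1) + 1 - (1 - A * u ^ 2)⁻¹ := by
      have h4 : (q : ℂ) ^ (2 * α) = A⁻¹ := by
        rw [hA, ← Complex.cpow_neg]
        congr 1
        ring
      have h5 : u ^ 2 - A⁻¹ = -(1 - A * u ^ 2) * A⁻¹ := by
        field_simp
        ring
      have h6 : u ^ 2 / (u ^ 2 - A⁻¹) = 1 - (1 - A * u ^ 2)⁻¹ := by
        have h7 : u ^ 2 = (1 - (1 - A * u ^ 2)) * A⁻¹ := by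
          field_simp
          ring
        rw [h5]
        generalize 1 - A * u ^ 2 = E at *
        rw [h7]
        field_simp
        ring
      rw [A2, h4, h6]
      ring
    have hk : kTerm q d α β u = D * (u ^ (2 * d) * W⁻¹ * (1 - u ^ (2 * d) * W⁻¹)⁻¹ *
        (1 - (Z * u ^ (2 * d))⁻¹)⁻¹) := by
      have h4 : (q : ℂ) ^ ((d : ℂ) * (1 - 2 * α)) = Z * ((q : ℂ) ^ d)⁻¹ := by
        rw [hZ, ← Complex.cpow_natCast (q : ℂ) d, ← Complex.cpow_neg, ← Complex.cpow_add _ _ hqc]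
        congr 1
        ring
      rw [kTerm, h4, ← hZ, ← hW, show 4 * d = 2 * d + 2 * d by ring, pow_add, hD]
      have hv : u ^ (2 * d) ≠ 0 := pow_ne_zero _ hu0
      set v := u ^ (2 * d)
      have h5 : W - v = W * (1 - v * W⁻¹) := by
        field_simp
      have h6 : Z * v - 1 = Z * v * (1 - (Z * v)⁻¹) := by
        field_simp
      have h7 : Z - Z * ((q : ℂ) ^ d)⁻¹ = Z * (1 - ((q : ℂ) ^ d)⁻¹) := by ring
      rw [h5, h6, h7]
      set E := 1 - v * W⁻¹
      set F := 1 - (Z * v)⁻¹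
      set G := 1 - ((q : ℂ) ^ d)⁻¹
      field_simp
    rw [hk, hA2, hqg]
    ring
  have hrr : ‖(r : ℂ)‖ = r := by rw [Complex.norm_real, Real.norm_of_nonneg hr0.le]
  have main := hasSum_circleIntegral_zpow hr0 hr1 (K := fun x => D * cTerm q g d α β x) (e := e)
    (f := fun u => (q : ℂ) ^ (-2 * (g : ℂ) * α) * u ^ (2 * g) * A2 q u α * kTerm q d α β u /
      u ^ (N + 1)) ?_ ?_
  · simp only [div_div] at main
    refine ⟨main.1, main.2.of_forall_eq fun x => ?_⟩
    refine if_congr ?_ rfl rfl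
    simp only [he]
    constructor
    · intro h
      zify
      linarith
    · intro h
      zify at h
      linarith
  · obtain ⟨h1, h2, h3⟩ := hnorms r hrr
    refine (((hasSum_triple (q := q) h1 h2 h3).1.mul_left
      ‖D * A ^ g * (r : ℂ) ^ (2 * g) / (r : ℂ) ^ (N + 1)‖)).congr fun x => ?_
    rw [← norm_mul, ← hterm _ (hne _ hrr), norm_mul _ ((r : ℂ) ^ e x), norm_zpow, hrr]
  · intro u hu
    obtain ⟨h1, h2, h3⟩ := hnorms u hu
    rw [← hval u hu]
    simp only [hterm u (hne u hu)]
    exact (hasSum_triple (q := q) h1 h2 h3).2.mul_left _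

variable (q) in
lemma exists_contour_eq_sum {ε : ℝ} (h0 : 0 < ε) (g N : ℕ) {α β : ℂ}
    (hα : -ε < α.re) (hα' : α.re < 1 - ε) (hβ : -(1 / 2) ≤ β.re) :
    ∃ J : ℕ → ℂ, (1 / (2 * Real.pi * Complex.I) * ∮ u in C(0, (q : ℝ) ^ (-ε)),
          (q : ℂ) ^ (-2 * (g : ℂ) * α) * u ^ (2 * g) * A2 q u α * Kfun q g α β u /
            (u ^ (N + 1) * (1 - u))) = ∑ d ∈ Finset.Ico 1 g, ((irrFin q d).card : ℂ) * J d ∧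
      ∀ d ∈ Finset.Ico 1 g, HasSum (fun x : ℕ × ℕ × ℕ =>
        if 2 * (g + x.2.2) + 2 * d * (x.1 + 1) ≤ N + 2 * d * x.2.1 then
          (d : ℂ) * (1 - ((q : ℂ) ^ d)⁻¹) * cTerm q g d α β x else 0) (J d) := by
  refine ⟨_, ?_, fun d hd => (exists_expansion q h0 (Finset.mem_Ico.1 hd).1 hα hα' hβ).2⟩
  have h1 : ∀ d ∈ Finset.Ico 1 g, CircleIntegrable (fun u => ((irrFin q d).card : ℂ) *
      ((q : ℂ) ^ (-2 * (g : ℂ) * α) * u ^ (2 * g) * A2 q u α *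
        kTerm q d α β u / (u ^ (N + 1) * (1 - u)))) 0 ((q : ℝ) ^ (-ε)) := by
    intro d hd
    exact (exists_expansion q h0 (Finset.mem_Ico.1 hd).1 hα hα' hβ).1.const_smul
      (a := ((irrFin q d).card : ℂ))
  calc _ = 1 / (2 * Real.pi * Complex.I) * ∮ u in C(0, (q : ℝ) ^ (-ε)),
        ∑ d ∈ Finset.Ico 1 g, ((irrFin q d).card : ℂ) *
          ((q : ℂ) ^ (-2 * (g : ℂ) * α) * u ^ (2 * g) * A2 q u α *
            kTerm q d α β u / (u ^ (N + 1) * (1 - u))) := by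
        congr 2
        funext u
        rw [Kfun_eq, Finset.mul_sum, Finset.sum_div]
        refine Finset.sum_congr rfl fun d _ => ?_
        ring
    _ = _ := by
        rw [circleIntegral.integral_fun_sum h1, Finset.mul_sum]
        refine Finset.sum_congr rfl fun d _ => ?_
        rw [circleIntegral.integral_const_mul]
        ring

end Expand

section Compare

variable {q : ℕ} [Fact q.Prime]

lemma norm_cTerm_le {g d l i m : ℕ} (hg : 12 ≤ g) (hd : 0 < d) (hdg : d < g) {α β : ℂ}
    (ha : |α.re| ≤ 1 / (g : ℝ)) (hb : |β.re| ≤ 1 / (g : ℝ))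
    (hx : g + 2 * m ≤ 2 * (d * i) ∨ g < i ∧ m ≤ g + d * i) :
    ‖cTerm q g d α β (l, i, m)‖ ≤
      (q : ℝ) ^ (4 - (d : ℝ) - (g : ℝ) / 2 - (l : ℝ) / 4 - (i : ℝ) / 4 - (m : ℝ) / 4) := by
  have hq := two_le_cast q
  have hq0 : (0 : ℝ) < q := by linarith
  have hexp : ‖cTerm q g d α β (l, i, m)‖ ≤ (q : ℝ) ^ (-(d * (1 + 2 * β.re)) * (l + 1 : ℕ)
      + -(d * (2 * (1 - α.re))) * (i : ℕ) + -2 * α.re * (g + m : ℕ)) := by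
    simp only [cTerm, norm_mul, norm_pow, norm_inv, norm_cpow_natCast]
    rw [Real.rpow_add hq0, Real.rpow_add hq0, mul_assoc]
    simp only [Real.rpow_mul_natCast hq0.le, Real.rpow_neg hq0.le]
    have h1 : ((d : ℂ) * (1 + 2 * β)).re = d * (1 + 2 * β.re) := by simp
    have h2 : ((d : ℂ) * (2 * (1 - α))).re = d * (2 * (1 - α.re)) := by simp
    have h3 : (-2 * α).re = -2 * α.re := by simp
    rw [h1, h2, h3, Complex.norm_real]
    have := abs_coefA_le (q := q) (m : ℤ)
    gcongr
    exact mul_le_of_le_one_left (by positivity) this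
  refine hexp.trans (Real.rpow_le_rpow_of_exponent_le (by linarith) ?_)
  have hg' : (12 : ℝ) ≤ g := by exact_mod_cast hg
  have hd1 : (1 : ℝ) ≤ d := by exact_mod_cast hd
  have hdg' : (d : ℝ) ≤ g := by exact_mod_cast hdg.le
  set δ : ℝ := 1 / (g : ℝ) with hδ
  have hδ0 : 0 < δ := by positivity
  have hδ12 : δ ≤ 1 / 12 := one_div_le_one_div_of_le (by norm_num) hg'
  have hδg : δ * g = 1 := by rw [hδ]; field_simp
  have hl0 : (0 : ℝ) ≤ l := Nat.cast_nonneg l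
  have hi0 : (0 : ℝ) ≤ i := Nat.cast_nonneg i
  have hm0 : (0 : ℝ) ≤ m := Nat.cast_nonneg m
  obtain ⟨ha1, ha2⟩ := abs_le.1 ha
  obtain ⟨hb1, hb2⟩ := abs_le.1 hb
  have hδd : δ * d ≤ 1 := by rw [← hδg]; gcongr
  obtain ⟨P, hP⟩ : ∃ P : ℝ, P = l * d := ⟨_, rfl⟩
  obtain ⟨T, hT⟩ : ∃ T : ℝ, T = d * i := ⟨_, rfl⟩
  have hPl : (l : ℝ) ≤ P := by rw [hP]; exact le_mul_of_one_le_right hl0 hd1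
  have hTi : (i : ℝ) ≤ T := by rw [hT]; exact le_mul_of_one_le_left hi0 hd1
  have e1 : -β.re * (P + d) ≤ δ * (P + d) := by
    apply mul_le_mul_of_nonneg_right <;> linarith
  have e2 : α.re * T ≤ δ * T := by
    apply mul_le_mul_of_nonneg_right <;> linarith
  have e3 : -α.re * (g + m) ≤ δ * (g + m) := by
    apply mul_le_mul_of_nonneg_right <;> linarith
  have f1 : δ * P ≤ 1 / 12 * P := by apply mul_le_mul_of_nonneg_right <;> linarith
  have f2 : δ * T ≤ 1 / 12 * T := by apply mul_le_mul_of_nonneg_right <;> linarith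
  have f3 : δ * m ≤ 1 / 12 * m := by apply mul_le_mul_of_nonneg_right <;> linarith
  have key : -(d * (1 + 2 * β.re)) * (l + 1 : ℕ) + -(d * (2 * (1 - α.re))) * (i : ℕ) +
      -2 * α.re * (g + m : ℕ) = -(P + d) + 2 * (-β.re * (P + d)) - 2 * T + 2 * (α.re * T) +
      2 * (-α.re * (g + m)) := by
    rw [hP, hT]
    push_cast
    ring
  rw [key]
  have hx' : (g : ℝ) + 2 * m ≤ 2 * T ∨ (g : ℝ) < i ∧ (m : ℝ) ≤ g + T := by
    rw [hT]
    exact_mod_cast hx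
  rcases hx' with h | ⟨h, h'⟩ <;> linarith

variable (q) in
/-- The terms of the contour expansion that match main terms of the double sum over primes. -/
def mainIdx (g N d : ℕ) : Finset (ℕ × ℕ × ℕ) :=
  (Finset.range N ×ˢ Finset.range (g + 1) ×ˢ Finset.range (N + d * g + 1)).filter fun x =>
    2 * (g + x.2.2) + 2 * d * (x.1 + 1) ≤ N + 2 * d * x.2.1 ∧
      g + 2 * (d * x.2.1) < 2 * (g + x.2.2)

lemma norm_sub_sum_le_of_hasSum {ι : Type*} {f : ι → ℂ} {b : ι → ℝ} {a : ℂ} {B : ℝ} {s : Finset ι}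
    (hf : HasSum f a) (hb : HasSum b B) (hb0 : ∀ x, 0 ≤ b x) (h : ∀ x ∉ s, ‖f x‖ ≤ b x) :
    ‖a - ∑ x ∈ s, f x‖ ≤ B := by
  have h1 : HasSum (fun x => if x ∈ s then f x else 0) (∑ x ∈ s, f x) := by
    have : HasSum (fun x => if x ∈ s then f x else 0) (∑ x ∈ s, if x ∈ s then f x else 0) :=
      hasSum_sum_of_ne_finset_zero fun x hx => if_neg hx
    rwa [Finset.sum_congr rfl fun x hx => if_pos hx] at this
  have h2 := hf.sub h1
  rw [← h2.tsum_eq]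
  refine tsum_of_norm_bounded hb fun x => ?_
  split_ifs with hx
  · simpa using hb0 x
  · simpa using h x hx

lemma norm_sub_sum_mainIdx_le {g N d : ℕ} (hg : 12 ≤ g) (hN : N < 4 * g) (hd : 0 < d) (hdg : d < g)
    {α β J : ℂ} (ha : |α.re| ≤ 1 / (g : ℝ)) (hb : |β.re| ≤ 1 / (g : ℝ))
    (hJ : HasSum (fun x : ℕ × ℕ × ℕ =>
        if 2 * (g + x.2.2) + 2 * d * (x.1 + 1) ≤ N + 2 * d * x.2.1 then
          (d : ℂ) * (1 - ((q : ℂ) ^ d)⁻¹) * cTerm q g d α β x else 0) J) :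
    ‖J - ∑ x ∈ mainIdx g N d, (d : ℂ) * (1 - ((q : ℂ) ^ d)⁻¹) * cTerm q g d α β x‖ ≤
      d * ((q : ℝ) ^ d)⁻¹ * ((q : ℝ) ^ 4 * ((1 - (q : ℝ) ^ (-(1 / 4) : ℝ))⁻¹) ^ 3) *
        (q : ℝ) ^ (-(g : ℝ) / 2) := by
  have hq := two_le_cast q
  have hq0 : (0 : ℝ) < q := by linarith
  set ρ : ℝ := (q : ℝ) ^ (-(1 / 4) : ℝ) with hρ
  have hρ0 : 0 < ρ := Real.rpow_pos_of_pos hq0 _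
  have hρ1 : ρ < 1 := Real.rpow_lt_one_of_one_lt_of_neg (by linarith) (by norm_num)
  have hgeo := hasSum_geometric_of_lt_one hρ0.le hρ1
  have hs : Summable fun n => ‖ρ ^ n‖ := by
    simpa only [norm_pow] using
      summable_geometric_of_lt_one (norm_nonneg ρ) (by rwa [Real.norm_of_nonneg hρ0.le])
  obtain ⟨hs2, hgeo2⟩ := hasSum_mul_prod hs hs hgeo hgeo
  have hgeo3 := (hasSum_mul_prod (f := fun n : ℕ => ρ ^ n)
    (g := fun y : ℕ × ℕ => ρ ^ y.1 * ρ ^ y.2) hs hs2 hgeo hgeo2).2.mul_left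
    (d * ((q : ℝ) ^ (4 - (d : ℝ) - (g : ℝ) / 2)))
  have hval : (d * ((q : ℝ) ^ (4 - (d : ℝ) - (g : ℝ) / 2))) *
      ((1 - ρ)⁻¹ * ((1 - ρ)⁻¹ * (1 - ρ)⁻¹)) = d * ((q : ℝ) ^ d)⁻¹ *
      ((q : ℝ) ^ 4 * ((1 - ρ)⁻¹) ^ 3) * (q : ℝ) ^ (-(g : ℝ) / 2) := by
    have : (q : ℝ) ^ (4 - (d : ℝ) - (g : ℝ) / 2) =
        (q : ℝ) ^ 4 * ((q : ℝ) ^ d)⁻¹ * (q : ℝ) ^ (-(g : ℝ) / 2) := by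
      rw [← Real.rpow_natCast _ d, ← Real.rpow_natCast _ 4, ← Real.rpow_neg hq0.le,
        ← Real.rpow_add hq0, ← Real.rpow_add hq0]
      congr 1
      push_cast
      ring
    rw [this]
    ring
  rw [hval] at hgeo3
  have hsum : ∑ x ∈ mainIdx g N d, (d : ℂ) * (1 - ((q : ℂ) ^ d)⁻¹) * cTerm q g d α β x =
      ∑ x ∈ mainIdx g N d, if 2 * (g + x.2.2) + 2 * d * (x.1 + 1) ≤ N + 2 * d * x.2.1 then
          (d : ℂ) * (1 - ((q : ℂ) ^ d)⁻¹) * cTerm q g d α β x else 0 := by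
    refine Finset.sum_congr rfl fun x hx => ?_
    rw [if_pos (Finset.mem_filter.1 hx).2.1]
  rw [hsum]
  refine norm_sub_sum_le_of_hasSum hJ hgeo3 (fun x => by positivity) ?_
  rintro ⟨l, i, m⟩ hx
  split_ifs with hc
  · have hcase : g + 2 * m ≤ 2 * (d * i) ∨ g < i ∧ m ≤ g + d * i := by
      simp only at hc
      by_contra! hcon
      refine hx ?_
      simp only [mainIdx, Finset.mem_filter, Finset.mem_product, Finset.mem_range]
      rw [mul_assoc, mul_assoc] at hc
      have h1 : l + 1 ≤ d * (l + 1) := Nat.le_mul_of_pos_left _ hd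
      have hig : i ≤ g := by
        by_contra! h
        have := hcon.2 h
        omega
      have h2 : d * i ≤ d * g := Nat.mul_le_mul_left _ hig
      rw [mul_assoc, mul_assoc]
      omega
    rw [norm_mul, norm_mul, mul_assoc]
    have hn : ‖(1 : ℂ) - ((q : ℂ) ^ d)⁻¹‖ ≤ 1 := by
      have h1 : (1 : ℂ) - ((q : ℂ) ^ d)⁻¹ = ((1 - ((q : ℝ) ^ d)⁻¹ : ℝ) : ℂ) := by push_cast; rfl
      have h2 : ((q : ℝ) ^ d)⁻¹ ≤ 1 := inv_le_one_of_one_le₀ (one_le_pow₀ (by linarith))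
      have h3 : 0 < ((q : ℝ) ^ d)⁻¹ := by positivity
      rw [h1, Complex.norm_real, Real.norm_of_nonneg (by linarith)]
      linarith
    rw [Complex.norm_natCast, mul_assoc]
    refine mul_le_mul_of_nonneg_left ?_ (Nat.cast_nonneg d)
    refine (mul_le_of_le_one_left (norm_nonneg _) hn).trans
      ((norm_cTerm_le hg hd hdg ha hb hcase).trans (le_of_eq ?_))
    simp only [hρ, ← Real.rpow_mul_natCast hq0.le]
    rw [← Real.rpow_add hq0, ← Real.rpow_add hq0, ← Real.rpow_add hq0]
    congr 1
    ring
  · rw [norm_zero]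
    positivity

variable (q) in
/-- The weight `|P|^{-(1/2 + α)}` of a polynomial of degree `n`. -/
def aWt (α : ℂ) (n : ℕ) : ℂ := ((q : ℂ) ^ ((n : ℂ) * (1 / 2 + α)))⁻¹

variable (q) in
/-- The weight `|Q|^{-(1 + 2β)}` of a polynomial of degree `n`. -/
def bWt (β : ℂ) (n : ℕ) : ℂ := ((q : ℂ) ^ ((n : ℂ) * (1 + 2 * β)))⁻¹

lemma natCast_ne_zero_complex : (q : ℂ) ≠ 0 := by
  have := (Fact.out : q.Prime).ne_zero
  exact_mod_cast this

lemma cTerm_eq {g d l i m ν : ℕ} (h : ν + d * i = g + m) (α β : ℂ) :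
    cTerm q g d α β (l, i, m) = bWt q β ((l + 1) * d) *
      (((q : ℂ) ^ (2 * d * i))⁻¹ * (coefA q m : ℂ) * ((q : ℂ) ^ (-2 * α)) ^ ν) := by
  have hqc := natCast_ne_zero_complex (q := q)
  have hZ : (q : ℂ) ^ ((d : ℂ) * (2 * (1 - α))) = (q : ℂ) ^ (2 * d) * ((q : ℂ) ^ (-2 * α)) ^ d := by
    rw [← Complex.cpow_nat_mul, ← Complex.cpow_natCast, ← Complex.cpow_add _ _ hqc]
    congr 1
    push_cast
    ring
  have hW : ((q : ℂ) ^ ((d : ℂ) * (1 + 2 * β)))⁻¹ ^ (l + 1) = bWt q β ((l + 1) * d) := by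
    rw [bWt, inv_pow, ← Complex.cpow_nat_mul]
    congr 2
    push_cast
    ring
  have hA0 : (q : ℂ) ^ (-2 * α) ≠ 0 := by simp [Complex.cpow_eq_zero_iff, hqc]
  simp only [cTerm]
  rw [hZ, hW, ← h]
  generalize (q : ℂ) ^ (-2 * α) = A at hA0
  simp only [mul_inv, inv_pow, mul_pow, ← pow_mul, pow_add]
  field_simp

lemma mainW_mul_aWt (g ν d : ℕ) (α : ℂ) :
    (mainW q g (2 * ν) d : ℂ) / ((q : ℂ) ^ (2 * g) * ((q : ℂ) - 1)) * aWt q α (2 * ν) =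
      (1 - ((q : ℂ) ^ d)⁻¹) * ∑ i ∈ Finset.range (g + 1), ((q : ℂ) ^ (2 * d * i))⁻¹ *
        (coefA q ((ν : ℤ) - g + d * i) : ℂ) * ((q : ℂ) ^ (-2 * α)) ^ ν := by
  have hq := two_le_cast q
  have hqc := natCast_ne_zero_complex (q := q)
  have hq1 : (q : ℂ) - 1 ≠ 0 := by
    have : (q : ℝ) - 1 ≠ 0 := by linarith
    exact_mod_cast this
  have ha : aWt q α (2 * ν) = ((q : ℂ) ^ ν)⁻¹ * ((q : ℂ) ^ (-2 * α)) ^ ν := by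
    rw [aWt, ← Complex.cpow_nat_mul, ← Complex.cpow_natCast, ← Complex.cpow_neg, ← Complex.cpow_neg,
      ← Complex.cpow_add _ _ hqc]
    congr 1
    push_cast
    ring
  rw [ha, mainW, if_pos (even_two_mul ν), Nat.mul_div_cancel_left _ two_pos, ← Finset.sum_mul]
  push_cast
  rw [pow_add]
  field_simp

lemma sum_mainIdx (g N d : ℕ) (α β : ℂ) :
    ∑ x ∈ mainIdx g N d, (1 - ((q : ℂ) ^ d)⁻¹) * cTerm q g d α β x =
      ∑ l ∈ Finset.range N, ∑ n ∈ Finset.range (N + 1),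
        if g < n ∧ n + 2 * ((l + 1) * d) ≤ N then
          (mainW q g n d : ℂ) / ((q : ℂ) ^ (2 * g) * ((q : ℂ) - 1)) * aWt q α n *
            bWt q β ((l + 1) * d) else 0 := by
  rw [mainIdx, Finset.sum_filter, Finset.sum_product]
  refine Finset.sum_congr rfl fun l hl => ?_
  rw [Finset.sum_product]
  set D : ℂ := 1 - ((q : ℂ) ^ d)⁻¹ with hD
  have h1 : ∀ n : ℕ, (if g < n ∧ n + 2 * ((l + 1) * d) ≤ N then
      (mainW q g n d : ℂ) / ((q : ℂ) ^ (2 * g) * ((q : ℂ) - 1)) * aWt q α n *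
        bWt q β ((l + 1) * d) else 0) = ∑ i ∈ Finset.range (g + 1),
      if g < n ∧ n + 2 * ((l + 1) * d) ≤ N ∧ Even n ∧ g ≤ n / 2 + d * i then
        D * cTerm q g d α β (l, i, n / 2 + d * i - g) else 0 := by
    intro n
    by_cases hn : g < n ∧ n + 2 * ((l + 1) * d) ≤ N
    · rw [if_pos hn]
      by_cases he : Even n
      · obtain ⟨ν, rfl⟩ := even_iff_two_dvd.1 he
        rw [mainW_mul_aWt, mul_assoc, Finset.sum_mul, Finset.mul_sum]
        refine Finset.sum_congr rfl fun i _ => ?_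
        rw [Nat.mul_div_cancel_left _ two_pos]
        by_cases hi : g ≤ ν + d * i
        · rw [if_pos ⟨hn.1, hn.2, he, hi⟩, cTerm_eq (ν := ν) (by omega),
            show (ν : ℤ) - g + d * i = ((ν + d * i - g : ℕ) : ℤ) by
              push_cast [Nat.cast_sub hi]; ring]
          ring
        · rw [if_neg fun h => hi h.2.2.2]
          have : (ν : ℤ) - g + d * i < 0 := by
            push Not at hi
            zify at hi
            linarith
          rw [coefA, if_pos this]
          simp
      · rw [mainW, if_neg he, Finset.sum_eq_zero fun i _ => if_neg fun h => he h.2.2.1]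
        simp
    · rw [if_neg hn, Finset.sum_eq_zero fun i _ => if_neg fun h => hn ⟨h.1, h.2.1⟩]
  refine Eq.trans ?_ (Finset.sum_comm.trans (Finset.sum_congr rfl fun n _ => (h1 n).symm))
  refine Finset.sum_congr rfl fun i hi => ?_
  rw [Finset.mem_range] at hi hl
  rw [← Finset.sum_filter, ← Finset.sum_filter]
  have hdi : d * i ≤ d * g := Nat.mul_le_mul_left _ (by omega)
  symm
  refine Finset.sum_nbij' (fun n => n / 2 + d * i - g) (fun m => 2 * (g + m - d * i)) ?_ ?_ ?_ ?_ ?_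
  all_goals
    intro n hn
    simp only [Finset.mem_filter, Finset.mem_range, mul_assoc, Nat.even_iff] at hn ⊢
  · rw [mul_comm d (l + 1)]
    omega
  · rw [mul_comm d (l + 1)] at hn
    omega
  · omega
  · omega

variable (q) in
/-- The main terms of the average over `D`, restricted to primes of degree `< g`. -/
def mainSum (g N : ℕ) (α β : ℂ) : ℂ :=
  ∑ d ∈ Finset.Ico 1 g, ((irrFin q d).card : ℂ) * ((d : ℂ) * ∑ l ∈ Finset.range N,
    ∑ n ∈ Finset.range (N + 1), if g < n ∧ n + 2 * ((l + 1) * d) ≤ N then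
      (mainW q g n d : ℂ) / ((q : ℂ) ^ (2 * g) * ((q : ℂ) - 1)) * aWt q α n *
        bWt q β ((l + 1) * d) else 0)

variable (q) in
lemma norm_contour_sub_mainSum_le {ε : ℝ} (h0 : 0 < ε) {g N : ℕ} (hg : 12 ≤ g) (hN : N < 4 * g)
    (hgε : 1 / (g : ℝ) < ε) (hgε' : 1 / (g : ℝ) < 1 - ε) {α β : ℂ} (hα : ‖α‖ ≤ 1 / (g : ℝ))
    (hβ : ‖β‖ ≤ 1 / (g : ℝ)) :
    ‖(1 / (2 * Real.pi * Complex.I) * ∮ u in C(0, (q : ℝ) ^ (-ε)),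
          (q : ℂ) ^ (-2 * (g : ℂ) * α) * u ^ (2 * g) * A2 q u α * Kfun q g α β u /
            (u ^ (N + 1) * (1 - u))) - mainSum q g N α β‖ ≤
      (q : ℝ) ^ 4 * ((1 - (q : ℝ) ^ (-(1 / 4) : ℝ))⁻¹) ^ 3 * (g * (q : ℝ) ^ (-(g : ℝ) / 2)) := by
  have hq := two_le_cast q
  have ha := (Complex.abs_re_le_norm α).trans hα
  have hb := (Complex.abs_re_le_norm β).trans hβ
  obtain ⟨ha1, ha2⟩ := abs_le.1 ha
  obtain ⟨hb1, hb2⟩ := abs_le.1 hb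
  have hg' : (12 : ℝ) ≤ g := by exact_mod_cast hg
  have hδ12 : 1 / (g : ℝ) ≤ 1 / 12 := one_div_le_one_div_of_le (by norm_num) hg'
  obtain ⟨J, hJ, hJd⟩ := exists_contour_eq_sum q h0 g N (α := α) (β := β) (by linarith)
    (by linarith) (by linarith)
  have hρ1 : (q : ℝ) ^ (-(1 / 4) : ℝ) < 1 :=
    Real.rpow_lt_one_of_one_lt_of_neg (by linarith) (by norm_num)
  set M : ℝ := (q : ℝ) ^ 4 * ((1 - (q : ℝ) ^ (-(1 / 4) : ℝ))⁻¹) ^ 3 with hM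
  have hM0 : 0 ≤ M := by
    have : 0 < 1 - (q : ℝ) ^ (-(1 / 4) : ℝ) := by linarith
    positivity
  rw [hJ, mainSum, ← Finset.sum_sub_distrib]
  have hterm : ∀ d ∈ Finset.Ico 1 g, ‖((irrFin q d).card : ℂ) * J d -
      ((irrFin q d).card : ℂ) * ((d : ℂ) * ∑ l ∈ Finset.range N,
        ∑ n ∈ Finset.range (N + 1), if g < n ∧ n + 2 * ((l + 1) * d) ≤ N then
          (mainW q g n d : ℂ) / ((q : ℂ) ^ (2 * g) * ((q : ℂ) - 1)) * aWt q α n *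
            bWt q β ((l + 1) * d) else 0)‖ ≤ M * (q : ℝ) ^ (-(g : ℝ) / 2) := by
    intro d hd
    obtain ⟨hd1, hd2⟩ := Finset.mem_Ico.1 hd
    have h1 := norm_sub_sum_mainIdx_le hg hN hd1 hd2 ha hb (hJd d hd)
    rw [← sum_mainIdx g N d, ← mul_sub, norm_mul, Complex.norm_natCast, Finset.mul_sum]
    simp only [mul_assoc] at h1 ⊢
    refine (mul_le_mul_of_nonneg_left h1 (Nat.cast_nonneg _)).trans ?_
    have h2 : (d : ℝ) * (irrFin q d).card ≤ (q : ℝ) ^ d := by exact_mod_cast card_irrFin_le hd1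
    have h3 : (d : ℝ) * (irrFin q d).card * ((q : ℝ) ^ d)⁻¹ ≤ 1 := by
      rw [← div_eq_mul_inv]
      exact div_le_one_of_le₀ h2 (by positivity)
    calc _ = (d : ℝ) * (irrFin q d).card * ((q : ℝ) ^ d)⁻¹ * (M * (q : ℝ) ^ (-(g : ℝ) / 2)) := by
          rw [hM]
          ring
      _ ≤ _ := mul_le_of_le_one_left (by positivity) h3
  refine (norm_sum_le_of_le _ hterm).trans ?_
  rw [Finset.sum_const, nsmul_eq_mul, Nat.card_Ico]
  have : ((g - 1 : ℕ) : ℝ) ≤ g := by exact_mod_cast Nat.sub_le g 1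
  calc _ ≤ (g : ℝ) * (M * (q : ℝ) ^ (-(g : ℝ) / 2)) := by gcongr
    _ = _ := by ring

end Compare

section ISide

variable {q : ℕ} [Fact q.Prime]

lemma jacSym_odd_even {P Q : (ZMod q)[X]} (hP : P.Monic) (hPi : Irreducible P) (hQ : Q.Monic)
    (hQi : Irreducible Q) (D : (ZMod q)[X]) (k l : ℕ) :
    jacSym q D (P ^ (2 * k + 1) * Q ^ (2 * (l + 1))) =
      resSym q D P * if Q ∣ D then 0 else 1 := by
  have hP1 : resSym q D P ^ (2 * k + 1) = resSym q D P := by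
    unfold resSym
    split_ifs <;> simp [pow_succ, pow_mul]
  have hQ1 : resSym q D Q ^ (2 * (l + 1)) = if Q ∣ D then 0 else 1 := by
    unfold resSym
    split_ifs <;> simp [pow_mul]
  have hP0 := pow_ne_zero (2 * k + 1) hPi.ne_zero
  have hQ0 := pow_ne_zero (2 * (l + 1)) hQi.ne_zero
  rw [jacSym, if_neg (mul_ne_zero hP0 hQ0), normalizedFactors_mul hP0 hQ0, normalizedFactors_pow,
    normalizedFactors_pow, normalizedFactors_irreducible hPi, normalizedFactors_irreducible hQi,
    hP.normalize_eq_self, hQ.normalize_eq_self, Multiset.map_add, Multiset.prod_add,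
    Multiset.map_nsmul, Multiset.map_nsmul, Multiset.prod_nsmul, Multiset.prod_nsmul]
  simp [hP1, hQ1]

lemma sum_jacSym_odd_even {P Q : (ZMod q)[X]} (hP : P.Monic) (hPi : Irreducible P) (hQ : Q.Monic)
    (hQi : Irreducible Q) (m k l : ℕ) :
    ∑ D ∈ sqfFin q m, jacSym q D (P ^ (2 * k + 1) * Q ^ (2 * (l + 1))) = tSumQ P Q m := by
  rw [tSumQ, Finset.sum_filter]
  refine Finset.sum_congr rfl fun D _ => ?_
  rw [jacSym_odd_even hP hPi hQ hQi]
  split_ifs <;> simp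

lemma sum_biUnion_irrFin {M : Type*} [AddCommMonoid M] (s : Finset ℕ) (F : (ZMod q)[X] → M) :
    ∑ P ∈ s.biUnion (irrFin q), F P = ∑ n ∈ s, ∑ P ∈ irrFin q n, F P := by
  refine Finset.sum_biUnion fun a _ b _ hab => Finset.disjoint_left.2 fun P hP hP' => hab ?_
  rw [mem_irrFin] at hP hP'
  exact hP.2.1.symm.trans hP'.2.1

/-- A sum over pairs of prime powers of bounded total degree, organised by degrees. -/
lemma tsum_prime_pairs_eq (N : ℕ) (F : (ZMod q)[X] → (ZMod q)[X] → ℕ → ℕ → ℂ) :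
    (∑' x : Polynomial (ZMod q) × Polynomial (ZMod q) × ℕ × ℕ,
      if x.1.Monic ∧ Irreducible x.1 ∧ x.2.1.Monic ∧ Irreducible x.2.1 ∧
          (2 * x.2.2.1 + 1) * x.1.natDegree + 2 * (x.2.2.2 + 1) * x.2.1.natDegree ≤ N
      then F x.1 x.2.1 x.2.2.1 x.2.2.2 else 0) =
    ∑ n ∈ Finset.range (N + 1), ∑ d ∈ Finset.range (N + 1), ∑ k ∈ Finset.range N,
      ∑ l ∈ Finset.range N, if (2 * k + 1) * n + 2 * ((l + 1) * d) ≤ N then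
        ∑ P ∈ irrFin q n, ∑ Q ∈ irrFin q d, F P Q k l else 0 := by
  set U := (Finset.range (N + 1)).biUnion (irrFin q) with hU
  have hmem : ∀ {P : (ZMod q)[X]}, P.Monic → Irreducible P → P.natDegree ≤ N → P ∈ U := by
    intro P hP hPi hn
    exact Finset.mem_biUnion.2 ⟨P.natDegree, Finset.mem_range.2 (by omega),
      mem_irrFin.2 ⟨hP, rfl, hPi⟩⟩
  rw [tsum_eq_sum (s := U ×ˢ U ×ˢ Finset.range N ×ˢ Finset.range N)]
  · rw [Finset.sum_product, hU, sum_biUnion_irrFin]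
    refine Finset.sum_congr rfl fun n _ => ?_
    have h1 : ∀ P ∈ irrFin q n, (∑ y ∈ U ×ˢ Finset.range N ×ˢ Finset.range N,
        if P.Monic ∧ Irreducible P ∧ y.1.Monic ∧ Irreducible y.1 ∧
          (2 * y.2.1 + 1) * P.natDegree + 2 * (y.2.2 + 1) * y.1.natDegree ≤ N
        then F P y.1 y.2.1 y.2.2 else 0) = ∑ d ∈ Finset.range (N + 1), ∑ k ∈ Finset.range N,
          ∑ l ∈ Finset.range N, if (2 * k + 1) * n + 2 * ((l + 1) * d) ≤ N then
            ∑ Q ∈ irrFin q d, F P Q k l else 0 := by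
      intro P hP
      rw [mem_irrFin] at hP
      rw [Finset.sum_product, hU, sum_biUnion_irrFin]
      refine Finset.sum_congr rfl fun d _ => ?_
      have h2 : ∀ Q ∈ irrFin q d, (∑ y ∈ Finset.range N ×ˢ Finset.range N,
          if P.Monic ∧ Irreducible P ∧ Q.Monic ∧ Irreducible Q ∧
            (2 * y.1 + 1) * P.natDegree + 2 * (y.2 + 1) * Q.natDegree ≤ N
          then F P Q y.1 y.2 else 0) = ∑ k ∈ Finset.range N, ∑ l ∈ Finset.range N,
            if (2 * k + 1) * n + 2 * ((l + 1) * d) ≤ N then F P Q k l else 0 := by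
        intro Q hQ
        rw [mem_irrFin] at hQ
        rw [Finset.sum_product]
        refine Finset.sum_congr rfl fun k _ => Finset.sum_congr rfl fun l _ =>
          if_congr ?_ rfl rfl
        simp only [hP, hQ, true_and, mul_assoc]
      rw [Finset.sum_congr rfl h2, Finset.sum_comm]
      refine Finset.sum_congr rfl fun k _ => ?_
      rw [Finset.sum_comm]
      refine Finset.sum_congr rfl fun l _ => ?_
      split_ifs
      · rfl
      · simp
    rw [Finset.sum_congr rfl h1, Finset.sum_comm]
    refine Finset.sum_congr rfl fun d _ => ?_
    rw [Finset.sum_comm]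
    refine Finset.sum_congr rfl fun k _ => ?_
    rw [Finset.sum_comm]
    refine Finset.sum_congr rfl fun l _ => ?_
    split_ifs
    · rfl
    · simp
  · rintro ⟨P, Q, k, l⟩ hx
    refine if_neg ?_
    rintro ⟨hP, hPi, hQ, hQi, h⟩
    refine hx ?_
    have hn := hPi.natDegree_pos
    have hd := hQi.natDegree_pos
    simp only at h hn hd
    have h1 : 2 * k + 1 ≤ (2 * k + 1) * P.natDegree := Nat.le_mul_of_pos_right _ hn
    have h2 : P.natDegree ≤ (2 * k + 1) * P.natDegree := Nat.le_mul_of_pos_left _ (by omega)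
    have h3 : 2 * (l + 1) ≤ 2 * (l + 1) * Q.natDegree := Nat.le_mul_of_pos_right _ hd
    have h4 : Q.natDegree ≤ 2 * (l + 1) * Q.natDegree := Nat.le_mul_of_pos_left _ (by omega)
    simp only [Finset.mem_product, Finset.mem_range]
    exact ⟨hmem hP hPi (by omega), hmem hQ hQi (by omega), by omega, by omega⟩

variable (q) in
/-- The odd-even contribution to the two-level density sum. -/
def oddEven (g N : ℕ) (α β : ℂ) : ℂ :=
  (1 / ((q : ℂ) ^ (2 * g + 1) - (q : ℂ) ^ (2 * g))) *
    sumH q g (fun D =>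
      ∑' x : Polynomial (ZMod q) × Polynomial (ZMod q) × ℕ × ℕ,
        if x.1.Monic ∧ Irreducible x.1 ∧ x.2.1.Monic ∧ Irreducible x.2.1 ∧
            (2 * x.2.2.1 + 1) * x.1.natDegree + 2 * (x.2.2.2 + 1) * x.2.1.natDegree ≤ N
        then
          (x.1.natDegree : ℂ) * (x.2.1.natDegree : ℂ) *
            (jacSym q D (x.1 ^ (2 * x.2.2.1 + 1) * x.2.1 ^ (2 * (x.2.2.2 + 1))) : ℂ) /
            ((q : ℂ) ^ ((((2 * x.2.2.1 + 1) * x.1.natDegree : ℕ) : ℂ) * (1 / 2 + α)) *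
              (q : ℂ) ^ ((((x.2.2.2 + 1) * x.2.1.natDegree : ℕ) : ℂ) * (1 + 2 * β)))
        else 0)

variable (q) in
/-- The part of `oddEven` in which `d(P) = n`, `d(Q) = d` and the exponents are `2k + 1` and
`2l + 2`. -/
def oddEvenTerm (g : ℕ) (α β : ℂ) (n d k l : ℕ) : ℂ :=
  ∑ Q ∈ irrFin q d, (d : ℂ) * ((avgW g n Q : ℂ) / ((q : ℂ) ^ (2 * g) * ((q : ℂ) - 1)) *
    aWt q α ((2 * k + 1) * n) * bWt q β ((l + 1) * d))

lemma oddEven_eq (g N : ℕ) (α β : ℂ) :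
    oddEven q g N α β = ∑ n ∈ Finset.range (N + 1), ∑ d ∈ Finset.range (N + 1),
      ∑ k ∈ Finset.range N, ∑ l ∈ Finset.range N,
        if (2 * k + 1) * n + 2 * ((l + 1) * d) ≤ N then oddEvenTerm q g α β n d k l else 0 := by
  have h1 : ∀ D : (ZMod q)[X], _ = _ := fun D => tsum_prime_pairs_eq N fun P Q k l =>
    (P.natDegree : ℂ) * (Q.natDegree : ℂ) *
      (jacSym q D (P ^ (2 * k + 1) * Q ^ (2 * (l + 1))) : ℂ) /
      ((q : ℂ) ^ ((((2 * k + 1) * P.natDegree : ℕ) : ℂ) * (1 / 2 + α)) *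
        (q : ℂ) ^ ((((l + 1) * Q.natDegree : ℕ) : ℂ) * (1 + 2 * β)))
  rw [oddEven, sumH_eq, Finset.sum_congr rfl fun D _ => h1 D, Finset.sum_comm, Finset.mul_sum]
  refine Finset.sum_congr rfl fun n _ => ?_
  rw [Finset.sum_comm, Finset.mul_sum]
  refine Finset.sum_congr rfl fun d _ => ?_
  rw [Finset.sum_comm, Finset.mul_sum]
  refine Finset.sum_congr rfl fun k _ => ?_
  rw [Finset.sum_comm, Finset.mul_sum]
  refine Finset.sum_congr rfl fun l _ => ?_
  split_ifs with hc
  · rw [oddEvenTerm, Finset.sum_comm]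
    simp_rw [Finset.sum_comm (s := sqfFin q (2 * g + 1)) (t := irrFin q d)]
    rw [Finset.sum_comm, Finset.mul_sum]
    refine Finset.sum_congr rfl fun Q hQ => ?_
    rw [mem_irrFin] at hQ
    have h2 : ∀ P ∈ irrFin q n, (∑ D ∈ sqfFin q (2 * g + 1),
        (P.natDegree : ℂ) * (Q.natDegree : ℂ) *
          (jacSym q D (P ^ (2 * k + 1) * Q ^ (2 * (l + 1))) : ℂ) /
          ((q : ℂ) ^ ((((2 * k + 1) * P.natDegree : ℕ) : ℂ) * (1 / 2 + α)) *
            (q : ℂ) ^ ((((l + 1) * Q.natDegree : ℕ) : ℂ) * (1 + 2 * β)))) =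
        (d : ℂ) * (aWt q α ((2 * k + 1) * n) * bWt q β ((l + 1) * d)) *
          ((n : ℂ) * (tSumQ P Q (2 * g + 1) : ℂ)) := by
      intro P hP
      rw [mem_irrFin] at hP
      rw [← Finset.sum_div, ← Finset.mul_sum, ← Int.cast_sum,
        sum_jacSym_odd_even hP.1 hP.2.2 hQ.1 hQ.2.2, hP.2.1, hQ.2.1, aWt, bWt]
      rw [div_eq_mul_inv, mul_inv]
      ring
    rw [Finset.sum_congr rfl h2, ← Finset.mul_sum, avgW]
    push_cast
    rw [show (q : ℂ) ^ (2 * g + 1) - (q : ℂ) ^ (2 * g) = (q : ℂ) ^ (2 * g) * ((q : ℂ) - 1) by ring]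
    ring
  · simp

end ISide

section Bound

variable {q : ℕ} [Fact q.Prime]

lemma norm_aWt_le {g n : ℕ} (hg : 0 < g) (hn : n ≤ 4 * g) {α : ℂ} (hα : ‖α‖ ≤ 1 / (g : ℝ)) :
    ‖aWt q α n‖ ≤ (q : ℝ) ^ (4 - (n : ℝ) / 2) := by
  have hq := two_le_cast q
  have hq0 : (0 : ℝ) < q := by linarith
  have hg0 : (0 : ℝ) < g := by exact_mod_cast hg
  rw [aWt, norm_inv, norm_cpow_natCast, ← Real.rpow_neg hq0.le]
  refine Real.rpow_le_rpow_of_exponent_le (by linarith) ?_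
  have h1 := (abs_le.1 ((Complex.abs_re_le_norm α).trans hα)).1
  have hre : ((n : ℂ) * (1 / 2 + α)).re = n * (1 / 2 + α.re) := by simp
  rw [hre]
  have h2 : (n : ℝ) ≤ 4 * g := by exact_mod_cast hn
  have h3 : -α.re * n ≤ 1 / (g : ℝ) * n := by
    gcongr
    linarith
  have h4 : 1 / (g : ℝ) * n ≤ 4 := by
    rw [one_div_mul_eq_div, div_le_iff₀ hg0]
    linarith
  linarith

lemma norm_bWt_le {g n : ℕ} (hg : 0 < g) (hn : 2 * n ≤ 4 * g) {β : ℂ} (hβ : ‖β‖ ≤ 1 / (g : ℝ)) :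
    ‖bWt q β n‖ ≤ (q : ℝ) ^ (4 - (n : ℝ)) := by
  have h := norm_aWt_le (q := q) hg hn hβ
  have h2 : aWt q β (2 * n) = bWt q β n := by
    rw [aWt, bWt]
    congr 2
    push_cast
    ring
  rw [h2] at h
  convert h using 2
  push_cast
  ring

lemma abs_mainW_le_of_le {g n d : ℕ} (hdg : g ≤ d) (hn : n < 2 * g) :
    |mainW q g n d| ≤ ((q : ℝ) - 1) * ((g + 1) * (q : ℝ) ^ ((n : ℝ) / 2)) := by
  have hq := two_le_cast q
  have hq0 : (0 : ℝ) < q := by linarith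
  have hq1 : (0 : ℝ) ≤ q - 1 := by linarith
  rw [mainW]
  split_ifs with he
  · obtain ⟨ν, rfl⟩ := even_iff_two_dvd.1 he
    rw [Nat.mul_div_cancel_left _ two_pos]
    have h1 : |∑ i ∈ Finset.range (g + 1), ((q : ℝ) ^ (2 * d * i))⁻¹ *
        coefA q ((ν : ℤ) - g + d * i)| ≤ (g + 1) * ((q : ℝ) ^ (2 * g))⁻¹ := by
      refine (Finset.abs_sum_le_sum_abs _ _).trans ?_
      have : ∀ i ∈ Finset.range (g + 1), |((q : ℝ) ^ (2 * d * i))⁻¹ *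
          coefA q ((ν : ℤ) - g + d * i)| ≤ ((q : ℝ) ^ (2 * g))⁻¹ := by
        intro i _
        rcases Nat.eq_zero_or_pos i with rfl | hi
        · rw [coefA, if_pos (by push_cast; omega)]
          simp
        · rw [abs_mul, abs_of_nonneg (by positivity)]
          refine (mul_le_of_le_one_right (by positivity) (abs_coefA_le _)).trans ?_
          exact inv_anti₀ (by positivity) (pow_le_pow_right₀ (by linarith)
            ((Nat.mul_le_mul_left 2 hdg).trans (Nat.le_mul_of_pos_right _ hi)))
      refine (Finset.sum_le_card_nsmul _ _ _ this).trans (le_of_eq ?_)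
      rw [Finset.card_range, nsmul_eq_mul]
      push_cast
      rfl
    have h2 : |1 - ((q : ℝ) ^ d)⁻¹| ≤ 1 := by
      have h3 : ((q : ℝ) ^ d)⁻¹ ≤ 1 := inv_le_one_of_one_le₀ (one_le_pow₀ (by linarith))
      have h4 : 0 < ((q : ℝ) ^ d)⁻¹ := by positivity
      rw [abs_le]
      constructor <;> linarith
    have h3 : (q : ℝ) ^ (((2 * ν : ℕ) : ℝ) / 2) = (q : ℝ) ^ ν := by
      rw [← Real.rpow_natCast]
      congr 1
      push_cast
      ring
    rw [abs_mul, abs_mul, abs_mul, abs_of_nonneg hq1, abs_of_nonneg (by positivity), h3]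
    calc _ ≤ ((q : ℝ) - 1) * (q : ℝ) ^ (ν + 2 * g) * 1 * ((g + 1) * ((q : ℝ) ^ (2 * g))⁻¹) := by
          gcongr
      _ = _ := by
          rw [pow_add]
          field_simp
  · rw [abs_zero]
    positivity

lemma mainSum_eq (g N : ℕ) (α β : ℂ) :
    mainSum q g N α β = ∑ n ∈ Finset.range (N + 1), ∑ d ∈ Finset.range (N + 1),
      ∑ k ∈ Finset.range N, ∑ l ∈ Finset.range N,
        if (2 * k + 1) * n + 2 * ((l + 1) * d) ≤ N then
          if k = 0 ∧ g < n ∧ d < g then ∑ Q ∈ irrFin q d, (d : ℂ) * ((mainW q g n Q.natDegree : ℂ) /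
            ((q : ℂ) ^ (2 * g) * ((q : ℂ) - 1)) * aWt q α ((2 * k + 1) * n) *
              bWt q β ((l + 1) * d)) else 0 else 0 := by
  rw [Finset.sum_comm]
  set G : ℕ → ℂ := fun d => ∑ n ∈ Finset.range (N + 1), ∑ k ∈ Finset.range N, ∑ l ∈ Finset.range N,
    if (2 * k + 1) * n + 2 * ((l + 1) * d) ≤ N then
      if k = 0 ∧ g < n ∧ d < g then ∑ Q ∈ irrFin q d, (d : ℂ) * ((mainW q g n Q.natDegree : ℂ) /
        ((q : ℂ) ^ (2 * g) * ((q : ℂ) - 1)) * aWt q α ((2 * k + 1) * n) *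
          bWt q β ((l + 1) * d)) else 0 else 0 with hG
  have h1 : mainSum q g N α β = ∑ d ∈ Finset.Ico 1 g, G d := by
    refine Finset.sum_congr rfl fun d hd => ?_
    have hd' := (Finset.mem_Ico.1 hd).2
    rw [hG]
    dsimp only
    rw [← mul_assoc, Finset.sum_comm, Finset.mul_sum]
    refine Finset.sum_congr rfl fun n _ => ?_
    rw [Finset.sum_comm, Finset.mul_sum]
    refine Finset.sum_congr rfl fun l hl => ?_
    have hN : 0 ∈ Finset.range N := by
      rw [Finset.mem_range] at hl ⊢
      omega
    rw [Finset.sum_eq_single_of_mem 0 hN]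
    · rw [mul_zero, zero_add, one_mul]
      by_cases hn : g < n
      · by_cases hc : n + 2 * ((l + 1) * d) ≤ N
        · rw [if_pos ⟨hn, hc⟩, if_pos hc, if_pos ⟨rfl, hn, hd'⟩, Finset.sum_congr rfl
            (g := fun _ => (d : ℂ) * ((mainW q g n d : ℂ) / ((q : ℂ) ^ (2 * g) * ((q : ℂ) - 1)) *
              aWt q α n * bWt q β ((l + 1) * d)))]
          · rw [Finset.sum_const, nsmul_eq_mul, mul_assoc]
          · intro Q hQ
            rw [(mem_irrFin.1 hQ).2.1]
        · rw [if_neg fun h => hc h.2, if_neg hc, mul_zero]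
      · rw [if_neg fun h => hn h.1, if_neg (c := 0 = 0 ∧ g < n ∧ d < g) fun h => hn h.2.1, ite_self,
          mul_zero]
    · intro k _ hk
      rw [if_neg (c := k = 0 ∧ g < n ∧ d < g) fun h => hk h.1, ite_self]
  rw [h1]
  have hsub1 : Finset.Ico 1 g ⊆ Finset.range (g + N + 1) := fun d hd => by
    rw [Finset.mem_Ico] at hd
    rw [Finset.mem_range]
    omega
  have hsub2 : Finset.range (N + 1) ⊆ Finset.range (g + N + 1) :=
    Finset.range_subset_range.2 (by omega)
  rw [Finset.sum_subset hsub1, Finset.sum_subset hsub2]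
  · intro d _ hd
    rw [Finset.mem_range, not_lt] at hd
    refine Finset.sum_eq_zero fun n _ => Finset.sum_eq_zero fun k _ => Finset.sum_eq_zero
      fun l _ => if_neg ?_
    have : d ≤ (l + 1) * d := Nat.le_mul_of_pos_left _ (by omega)
    omega
  · intro d _ hd
    refine Finset.sum_eq_zero fun n _ => Finset.sum_eq_zero fun k _ => Finset.sum_eq_zero
      fun l _ => ?_
    rcases Nat.eq_zero_or_pos d with rfl | h
    · simp [irrFin_zero]
    · rw [if_neg (c := k = 0 ∧ g < n ∧ d < g), ite_self]
      rintro ⟨-, -, h'⟩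
      exact hd (Finset.mem_Ico.2 ⟨h, h'⟩)

end Bound

section Term

variable {q : ℕ} [Fact q.Prime]

lemma norm_sum_irrFin_le {g n l d : ℕ} (hg : 0 < g) (hn : n ≤ 4 * g)
    (hl : 2 * ((l + 1) * d) ≤ 4 * g) {α β : ℂ} (hα : ‖α‖ ≤ 1 / (g : ℝ)) (hβ : ‖β‖ ≤ 1 / (g : ℝ))
    {f : Polynomial (ZMod q) → ℝ} {M s : ℝ} (hM : 0 ≤ M)
    (hf : ∀ Q ∈ irrFin q d, |f Q| ≤ M * (q : ℝ) ^ s) :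
    ‖∑ Q ∈ irrFin q d, (d : ℂ) * ((f Q : ℂ) / ((q : ℂ) ^ (2 * g) * ((q : ℂ) - 1)) *
      aWt q α n * bWt q β ((l + 1) * d))‖
      ≤ M * (q : ℝ) ^ (8 + s - 2 * g - (n : ℝ) / 2 - (l : ℝ) * d) := by
  have hq := two_le_cast q
  have hq0 : (0 : ℝ) < q := by linarith
  rcases Nat.eq_zero_or_pos d with rfl | hd
  · rw [irrFin_zero, Finset.sum_empty, norm_zero]
    positivity
  have hq1 : 1 ≤ ‖(q : ℂ) - 1‖ := by
    have : ((q : ℂ) - 1) = (((q : ℝ) - 1 : ℝ) : ℂ) := by push_cast; rfl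
    rw [this, Complex.norm_real, Real.norm_eq_abs, abs_of_nonneg] <;> linarith
  have hterm : ∀ Q ∈ irrFin q d, ‖(d : ℂ) * ((f Q : ℂ) / ((q : ℂ) ^ (2 * g) * ((q : ℂ) - 1)) *
      aWt q α n * bWt q β ((l + 1) * d))‖ ≤ d * (M * (q : ℝ) ^ s / ((q : ℝ) ^ (2 * g) * 1) *
        (q : ℝ) ^ (4 - (n : ℝ) / 2) * (q : ℝ) ^ (4 - (((l + 1) * d : ℕ) : ℝ))) := by
    intro Q hQ
    rw [norm_mul, norm_mul, norm_mul, norm_div, norm_mul, norm_pow, Complex.norm_natCast,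
      Complex.norm_natCast, Complex.norm_real, Real.norm_eq_abs]
    have h1 := hf Q hQ
    have h2 := norm_aWt_le (q := q) hg hn hα
    have h3 := norm_bWt_le (q := q) hg hl hβ
    gcongr
  refine (norm_sum_le _ _).trans ((Finset.sum_le_card_nsmul _ _ _ hterm).trans ?_)
  rw [nsmul_eq_mul, ← mul_assoc]
  have hc : ((irrFin q d).card : ℝ) * d ≤ (q : ℝ) ^ (d : ℝ) := by
    rw [mul_comm, Real.rpow_natCast]
    exact_mod_cast card_irrFin_le hd
  have he : (q : ℝ) ^ (8 + s - 2 * g - (n : ℝ) / 2 - (l : ℝ) * d) =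
      (q : ℝ) ^ (d : ℝ) * ((q : ℝ) ^ s / ((q : ℝ) ^ (2 * g) * 1) *
        (q : ℝ) ^ (4 - (n : ℝ) / 2) * (q : ℝ) ^ (4 - (((l + 1) * d : ℕ) : ℝ))) := by
    rw [mul_one, ← Real.rpow_natCast (q : ℝ) (2 * g), ← Real.rpow_sub hq0, ← Real.rpow_add hq0,
      ← Real.rpow_add hq0, ← Real.rpow_add hq0]
    congr 1
    push_cast
    ring
  rw [he]
  calc _ ≤ (q : ℝ) ^ (d : ℝ) * (M * (q : ℝ) ^ s / ((q : ℝ) ^ (2 * g) * 1) *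
        (q : ℝ) ^ (4 - (n : ℝ) / 2) * (q : ℝ) ^ (4 - (((l + 1) * d : ℕ) : ℝ))) := by
        gcongr
    _ = _ := by ring

lemma norm_oddEvenTerm_le (hq2 : q ≠ 2) {g n d k l : ℕ} (hg : 0 < g)
    (h : (2 * k + 1) * n + 2 * ((l + 1) * d) ≤ 4 * g) {α β : ℂ} (hα : ‖α‖ ≤ 1 / (g : ℝ))
    (hβ : ‖β‖ ≤ 1 / (g : ℝ)) :
    ‖oddEvenTerm q g α β n d k l‖ ≤ (2 * g + 2) * (q + 1) *
      (q : ℝ) ^ (8 + 2 * n - 2 * g - (((2 * k + 1) * n : ℕ) : ℝ) / 2 - (l : ℝ) * d) := by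
  have hq := two_le_cast q
  have hq0 : (0 : ℝ) < q := by linarith
  refine norm_sum_irrFin_le hg (by omega) (by omega) hα hβ (by positivity) fun Q hQ => ?_
  obtain ⟨hQm, hQd, hQi⟩ := mem_irrFin.1 hQ
  refine (abs_avgW_le hq2 hQm hQi g n).trans (le_of_eq ?_)
  rw [← Real.rpow_natCast, ← Real.rpow_add hq0]
  congr 2
  ring

lemma norm_oddEvenTerm_sub_le (hq2 : q ≠ 2) {g N n d k l : ℕ} (hg : 0 < g) (hN : N < 4 * g)
    (h : (2 * k + 1) * n + 2 * ((l + 1) * d) ≤ N) {α β : ℂ} (hα : ‖α‖ ≤ 1 / (g : ℝ))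
    (hβ : ‖β‖ ≤ 1 / (g : ℝ)) :
    ‖oddEvenTerm q g α β n d k l - (if k = 0 ∧ g < n ∧ d < g then ∑ Q ∈ irrFin q d,
        (d : ℂ) * ((mainW q g n Q.natDegree : ℂ) / ((q : ℂ) ^ (2 * g) * ((q : ℂ) - 1)) *
          aWt q α ((2 * k + 1) * n) * bWt q β ((l + 1) * d)) else 0)‖
      ≤ (if k = 0 then 240 * (2 + 2 * q) * (N : ℝ) ^ 2 * (q : ℝ) ^ (8 + (N : ℝ) / 2 - 2 * g -
          ((N : ℝ) - n) / 4 - (d : ℝ) / 4 - (l : ℝ) / 4) else 0) +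
        (2 * g + 2) * (q + 1) * (q : ℝ) ^ (8 - (g : ℝ) / 2) := by
  have hq := two_le_cast q
  have hq0 : (0 : ℝ) < q := by linarith
  have hq1 : (1 : ℝ) ≤ q := by linarith
  have hif : 0 ≤ (if k = 0 then 240 * (2 + 2 * q) * (N : ℝ) ^ 2 * (q : ℝ) ^ (8 + (N : ℝ) / 2 -
      2 * g - ((N : ℝ) - n) / 4 - (d : ℝ) / 4 - (l : ℝ) / 4) else 0) := by
    split_ifs <;> positivity
  have hNg : (N : ℝ) < 4 * g := by exact_mod_cast hN
  have hn0 : (0 : ℝ) ≤ n := Nat.cast_nonneg _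
  have hld0 : (0 : ℝ) ≤ (l : ℝ) * d := by positivity
  have hg0 : (0 : ℝ) ≤ g := Nat.cast_nonneg _
  have hR : ((2 * k + 1) * n : ℝ) + 2 * ((l + 1) * d) ≤ N := by exact_mod_cast h
  rcases Nat.eq_zero_or_pos d with rfl | hd
  · rw [oddEvenTerm, irrFin_zero, Finset.sum_empty, Finset.sum_empty, ite_self, sub_self, norm_zero]
    positivity
  have hd1 : (1 : ℝ) ≤ d := by exact_mod_cast hd
  by_cases hA : k = 0 ∧ g < n
  · obtain ⟨rfl, hgn⟩ := hA
    rw [if_pos rfl]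
    have hgn' : (g : ℝ) < n := by exact_mod_cast hgn
    simp only [CharP.cast_eq_zero, mul_zero, zero_add, one_mul] at hR
    have hN1 : (1 : ℝ) ≤ N := by nlinarith
    have hld : (l : ℝ) ≤ l * d := le_mul_of_one_le_right (Nat.cast_nonneg _) hd1
    have hdN : (n : ℝ) + 2 * d ≤ N := by nlinarith
    have hsub : ‖∑ Q ∈ irrFin q d, (d : ℂ) * (((avgW g n Q - mainW q g n Q.natDegree : ℝ) : ℂ) /
        ((q : ℂ) ^ (2 * g) * ((q : ℂ) - 1)) * aWt q α ((2 * 0 + 1) * n) * bWt q β ((l + 1) * d))‖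
        ≤ 240 * (2 + 2 * q) * (N : ℝ) ^ 2 * (q : ℝ) ^ (8 + (N : ℝ) / 2 - 2 * g -
          ((N : ℝ) - n) / 4 - (d : ℝ) / 4 - (l : ℝ) / 4) := by
      refine (norm_sum_irrFin_le (M := 240 * (2 + 2 * q) * (N : ℝ) ^ 2) (s := n) hg (by omega)
        (by omega) hα hβ (by positivity) fun Q hQ => ?_).trans ?_
      · obtain ⟨hQm, hQd, hQi⟩ := mem_irrFin.1 hQ
        refine (abs_avgW_sub_mainW_le hq2 hQm hQi hgn).trans ?_
        rw [hQd, Real.rpow_natCast]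
        have hgN : (2 * g + 2 : ℝ) ≤ 2 * N := by
          have : g + 1 ≤ N := by nlinarith
          have : (g + 1 : ℝ) ≤ N := by exact_mod_cast this
          linarith
        calc _ ≤ (2 * N : ℝ) * (30 * (4 * N) * (2 + 2 * q) * (q : ℝ) ^ n) := by
              gcongr
              linarith
          _ = _ := by ring
      · refine mul_le_mul_of_nonneg_left (Real.rpow_le_rpow_of_exponent_le hq1 ?_) (by positivity)
        push_cast
        nlinarith
    by_cases hdg : d < g
    · rw [if_pos ⟨rfl, hgn, hdg⟩, oddEvenTerm, ← Finset.sum_sub_distrib]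
      refine (le_of_eq ?_).trans (hsub.trans (le_add_of_nonneg_right (by positivity)))
      congr 1
      refine Finset.sum_congr rfl fun Q _ => ?_
      push_cast
      ring
    · rw [if_neg fun h => hdg h.2.2, sub_zero]
      rw [not_lt] at hdg
      have hmain : ‖∑ Q ∈ irrFin q d, (d : ℂ) * ((mainW q g n Q.natDegree : ℂ) /
          ((q : ℂ) ^ (2 * g) * ((q : ℂ) - 1)) * aWt q α ((2 * 0 + 1) * n) *
            bWt q β ((l + 1) * d))‖ ≤ (2 * g + 2) * (q + 1) * (q : ℝ) ^ (8 - (g : ℝ) / 2) := by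
        refine (norm_sum_irrFin_le (M := (2 * g + 2) * (q + 1)) (s := (n : ℝ) / 2) hg (by omega)
          (by omega) hα hβ (by positivity) fun Q hQ => ?_).trans ?_
        · rw [(mem_irrFin.1 hQ).2.1]
          have hdl : d ≤ (l + 1) * d := Nat.le_mul_of_pos_left _ (by omega)
          refine (abs_mainW_le_of_le hdg (by omega)).trans ?_
          rw [← mul_assoc]
          exact mul_le_mul_of_nonneg_right (by nlinarith) (by positivity)
        · refine mul_le_mul_of_nonneg_left (Real.rpow_le_rpow_of_exponent_le hq1 ?_) (by positivity)
          push_cast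
          linarith
      have hadd : oddEvenTerm q g α β n d 0 l = ∑ Q ∈ irrFin q d, (d : ℂ) *
          (((avgW g n Q - mainW q g n Q.natDegree : ℝ) : ℂ) / ((q : ℂ) ^ (2 * g) *
            ((q : ℂ) - 1)) * aWt q α ((2 * 0 + 1) * n) * bWt q β ((l + 1) * d)) +
          ∑ Q ∈ irrFin q d, (d : ℂ) * ((mainW q g n Q.natDegree : ℂ) / ((q : ℂ) ^ (2 * g) *
            ((q : ℂ) - 1)) * aWt q α ((2 * 0 + 1) * n) * bWt q β ((l + 1) * d)) := by
        rw [oddEvenTerm, ← Finset.sum_add_distrib]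
        refine Finset.sum_congr rfl fun Q _ => ?_
        push_cast
        ring
      rw [hadd]
      exact (norm_add_le _ _).trans (add_le_add hsub hmain)
  · rw [if_neg fun h => hA ⟨h.1, h.2.1⟩, sub_zero]
    refine (norm_oddEvenTerm_le hq2 hg (by omega) hα hβ).trans (le_add_of_nonneg_of_le hif ?_)
    refine mul_le_mul_of_nonneg_left (Real.rpow_le_rpow_of_exponent_le hq1 ?_) (by positivity)
    push_cast
    rcases Nat.eq_zero_or_pos k with rfl | hk
    · have hng : (n : ℝ) ≤ g := by
        have : ¬ g < n := fun h => hA ⟨rfl, h⟩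
        exact_mod_cast not_lt.1 this
      push_cast
      linarith
    · have hk1 : (1 : ℝ) ≤ k := by exact_mod_cast hk
      nlinarith [mul_le_mul_of_nonneg_right hk1 hn0]

end Term

section Final

variable {q : ℕ} [Fact q.Prime]

lemma sum_range_pow_le_inv {ρ : ℝ} (h0 : 0 ≤ ρ) (h1 : ρ < 1) (n : ℕ) :
    ∑ i ∈ Finset.range n, ρ ^ i ≤ (1 - ρ)⁻¹ := by
  rw [← tsum_geometric_of_lt_one h0 h1]
  exact (summable_geometric_of_lt_one h0 h1).sum_le_tsum _ fun i _ => pow_nonneg h0 i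

lemma norm_sum_range_le_of_geom {f : ℕ → ℂ} {ρ X Y : ℝ} (h0 : 0 ≤ ρ) (h1 : ρ < 1) (hX : 0 ≤ X)
    {n : ℕ} (hf : ∀ i ∈ Finset.range n, ‖f i‖ ≤ X * ρ ^ i + Y) :
    ‖∑ i ∈ Finset.range n, f i‖ ≤ X * (1 - ρ)⁻¹ + n * Y := by
  refine (norm_sum_le_of_le _ hf).trans ?_
  rw [Finset.sum_add_distrib, ← Finset.mul_sum, Finset.sum_const, Finset.card_range, nsmul_eq_mul]
  exact add_le_add_left (mul_le_mul_of_nonneg_left (sum_range_pow_le_inv h0 h1 n) hX) _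

lemma norm_oddEven_sub_mainSum_le (hq2 : q ≠ 2) {g N : ℕ} (hg : 0 < g) (hN : N < 4 * g) {α β : ℂ}
    (hα : ‖α‖ ≤ 1 / (g : ℝ)) (hβ : ‖β‖ ≤ 1 / (g : ℝ)) :
    ‖oddEven q g N α β - mainSum q g N α β‖ ≤
      240 * (2 + 2 * q) * (N : ℝ) ^ 2 * (q : ℝ) ^ (8 + (N : ℝ) / 2 - 2 * g) *
        (1 - (q : ℝ) ^ (-(1 / 4) : ℝ))⁻¹ * (1 - (q : ℝ) ^ (-(1 / 4) : ℝ))⁻¹ *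
        (1 - (q : ℝ) ^ (-(1 / 4) : ℝ))⁻¹ + (N + 1 : ℕ) * ((N + 1 : ℕ) * (N * (N *
          ((2 * g + 2) * (q + 1) * (q : ℝ) ^ (8 - (g : ℝ) / 2))))) := by
  have hq := two_le_cast q
  have hq0 : (0 : ℝ) < q := by linarith
  set ρ := (q : ℝ) ^ (-(1 / 4) : ℝ) with hρ
  have hρ0 : 0 ≤ ρ := by positivity
  have hρ1 : ρ < 1 := Real.rpow_lt_one_of_one_lt_of_neg (by linarith) (by norm_num)
  have hS : 0 ≤ (1 - ρ)⁻¹ := inv_nonneg.2 (by linarith)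
  set X := 240 * (2 + 2 * q) * (N : ℝ) ^ 2 * (q : ℝ) ^ (8 + (N : ℝ) / 2 - 2 * g) with hX
  set Y := (2 * g + 2) * (q + 1) * (q : ℝ) ^ (8 - (g : ℝ) / 2) with hY
  have hX0 : 0 ≤ X := by positivity
  have hY0 : 0 ≤ Y := by positivity
  rw [oddEven_eq, mainSum_eq]
  simp only [← Finset.sum_sub_distrib]
  rw [← Finset.sum_range_reflect]
  refine norm_sum_range_le_of_geom hρ0 hρ1 (by positivity) fun n' hn' => ?_
  have hn'' : n' ≤ N := Nat.lt_succ_iff.1 (Finset.mem_range.1 hn')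
  obtain ⟨n, hn⟩ : ∃ n, n = N + 1 - 1 - n' := ⟨_, rfl⟩
  rw [← hn]
  have hnN : (n' : ℝ) = N - n := by
    rw [eq_sub_iff_add_eq]
    exact_mod_cast (by omega : n' + n = N)
  refine (norm_sum_range_le_of_geom (X := X * (1 - ρ)⁻¹ * ρ ^ n') hρ0 hρ1 (by positivity)
    (Y := N * (N * Y)) fun d hd => ?_).trans (le_of_eq (by ring))
  have hk : ∀ k ∈ Finset.range N, ‖∑ l ∈ Finset.range N,
      ((if (2 * k + 1) * n + 2 * ((l + 1) * d) ≤ N then oddEvenTerm q g α β n d k l else 0) -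
        if (2 * k + 1) * n + 2 * ((l + 1) * d) ≤ N then
          if k = 0 ∧ g < n ∧ d < g then ∑ Q ∈ irrFin q d, (d : ℂ) *
            ((mainW q g n Q.natDegree : ℂ) / ((q : ℂ) ^ (2 * g) * ((q : ℂ) - 1)) *
              aWt q α ((2 * k + 1) * n) * bWt q β ((l + 1) * d)) else 0 else 0)‖ ≤
      (if k = 0 then X * ρ ^ n' * ρ ^ d * (1 - ρ)⁻¹ else 0) + N * Y := by
    intro k _
    have h1 : (if k = 0 then X * ρ ^ n' * ρ ^ d * (1 - ρ)⁻¹ else 0) =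
        (if k = 0 then X * ρ ^ n' * ρ ^ d else 0) * (1 - ρ)⁻¹ := by
      rw [ite_mul, zero_mul]
    have h0 : 0 ≤ if k = 0 then X * ρ ^ n' * ρ ^ d else 0 := by
      split_ifs <;> positivity
    rw [h1]
    refine norm_sum_range_le_of_geom hρ0 hρ1 h0 fun l _ => ?_
    by_cases hc : (2 * k + 1) * n + 2 * ((l + 1) * d) ≤ N
    · rw [if_pos hc, if_pos hc]
      refine (norm_oddEvenTerm_sub_le hq2 hg hN hc hα hβ).trans (add_le_add_left (le_of_eq ?_) _)
      rw [ite_mul, zero_mul]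
      congr 1
      have he : (q : ℝ) ^ (8 + (N : ℝ) / 2 - 2 * g - ((N : ℝ) - n) / 4 - (d : ℝ) / 4 -
          (l : ℝ) / 4) =
          (q : ℝ) ^ (8 + (N : ℝ) / 2 - 2 * g) * ρ ^ n' * ρ ^ d * ρ ^ l := by
        rw [hρ, ← Real.rpow_mul_natCast hq0.le, ← Real.rpow_mul_natCast hq0.le,
          ← Real.rpow_mul_natCast hq0.le, ← Real.rpow_add hq0, ← Real.rpow_add hq0,
          ← Real.rpow_add hq0, hnN]
        congr 1
        ring
      rw [he, hX]
      ring
    · rw [if_neg hc, if_neg hc, sub_zero, norm_zero]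
      positivity
  refine (norm_sum_le_of_le _ hk).trans ?_
  rw [Finset.sum_add_distrib, Finset.sum_const, Finset.card_range, nsmul_eq_mul,
    Finset.sum_ite_eq']
  refine add_le_add_left ?_ _
  split_ifs
  · exact le_of_eq (by ring)
  · positivity

lemma exists_oddEven_bound (hq2 : q ≠ 2) {g N : ℕ} (hg : 0 < g) (hN : N < 4 * g) :
    ∃ C : ℝ, ∀ α β : ℂ, ‖α‖ ≤ 1 / (g : ℝ) → ‖β‖ ≤ 1 / (g : ℝ) → ‖oddEven q g N α β‖ ≤ C := by
  refine ⟨∑ n ∈ Finset.range (N + 1), ∑ d ∈ Finset.range (N + 1), ∑ k ∈ Finset.range N,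
    ∑ l ∈ Finset.range N, (2 * g + 2) * (q + 1) *
      (q : ℝ) ^ (8 + 2 * n - 2 * g - (((2 * k + 1) * n : ℕ) : ℝ) / 2 - (l : ℝ) * d),
    fun α β hα hβ => ?_⟩
  rw [oddEven_eq]
  refine norm_sum_le_of_le _ fun n _ => norm_sum_le_of_le _ fun d _ => norm_sum_le_of_le _
    fun k _ => norm_sum_le_of_le _ fun l _ => ?_
  split_ifs with h
  · exact norm_oddEvenTerm_le hq2 hg (by omega) hα hβ
  · rw [norm_zero]
    positivity

lemma exists_pow_four_le {ε : ℝ} (hε : 0 < ε) :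
    ∃ K : ℝ, 0 ≤ K ∧ ∀ g : ℕ, (g : ℝ) ^ 4 ≤ K * (q : ℝ) ^ (ε * g) := by
  have hq := two_le_cast q
  have hq0 : (0 : ℝ) < q := by linarith
  have h1 : 1 < (q : ℝ) ^ ε := Real.one_lt_rpow (by linarith) hε
  obtain ⟨K, hK⟩ := (tendsto_pow_const_div_const_pow_of_one_lt 4 h1).bddAbove_range
  refine ⟨|K|, abs_nonneg _, fun g => ?_⟩
  have h2 := (hK (Set.mem_range_self g)).trans (le_abs_self K)
  rw [Real.rpow_mul_natCast hq0.le]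
  exact (div_le_iff₀ (by positivity)).1 h2

lemma exists_norm_oddEven_sub_contour_le (hq2 : q ≠ 2) {ε : ℝ} (hε0 : 0 < ε) :
    ∃ C : ℝ, 0 ≤ C ∧ ∀ g N : ℕ, 12 ≤ g → 1 / (g : ℝ) < ε → 1 / (g : ℝ) < 1 - ε → N < 4 * g →
      ∀ α β : ℂ, ‖α‖ ≤ 1 / (g : ℝ) → ‖β‖ ≤ 1 / (g : ℝ) →
      ‖oddEven q g N α β - (1 / (2 * Real.pi * Complex.I)) * ∮ u in C(0, (q : ℝ) ^ (-ε)),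
        (q : ℂ) ^ (-2 * (g : ℂ) * α) * u ^ (2 * g) * A2 q u α * Kfun q g α β u /
          (u ^ (N + 1) * (1 - u))‖ ≤ C * ((N : ℝ) ^ 2 * (q : ℝ) ^ ((N : ℝ) / 2 - 2 * g)
            + (g : ℝ) * (q : ℝ) ^ (-(g : ℝ) / 2 + ε * g)) := by
  have hq := two_le_cast q
  have hq0 : (0 : ℝ) < q := by linarith
  obtain ⟨K, hK0, hK⟩ := exists_pow_four_le (q := q) hε0
  have hρ1 : (q : ℝ) ^ (-(1 / 4) : ℝ) < 1 :=
    Real.rpow_lt_one_of_one_lt_of_neg (by linarith) (by norm_num)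
  set S := (1 - (q : ℝ) ^ (-(1 / 4) : ℝ))⁻¹ with hS
  have hS0 : 0 ≤ S := inv_nonneg.2 (by linarith)
  set C₁ := 240 * (2 + 2 * q) * (q : ℝ) ^ (8 : ℝ) * S * S * S with hC₁
  set C₂ := 1024 * (q + 1) * (q : ℝ) ^ (8 : ℝ) * K + (q : ℝ) ^ 4 * S ^ 3 with hC₂
  have hC₁0 : 0 ≤ C₁ := by positivity
  have hC₂0 : 0 ≤ C₂ := by positivity
  refine ⟨C₁ + C₂, by positivity, fun g N hg hgε hgε' hN α β hα hβ => ?_⟩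
  have hg1 : (1 : ℝ) ≤ g := by exact_mod_cast (by omega : 1 ≤ g)
  have hNg : (N + 1 : ℝ) ≤ 4 * g := by exact_mod_cast hN
  have h1 := norm_oddEven_sub_mainSum_le hq2 (by omega) hN hα hβ
  have h2 := norm_contour_sub_mainSum_le q hε0 hg hN hgε hgε' hα hβ
  set I := (1 / (2 * Real.pi * Complex.I)) * ∮ u in C(0, (q : ℝ) ^ (-ε)),
        (q : ℂ) ^ (-2 * (g : ℂ) * α) * u ^ (2 * g) * A2 q u α * Kfun q g α β u /
          (u ^ (N + 1) * (1 - u)) with hI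
  have h3 : 240 * (2 + 2 * q) * (N : ℝ) ^ 2 * (q : ℝ) ^ (8 + (N : ℝ) / 2 - 2 * g) * S * S * S =
      C₁ * ((N : ℝ) ^ 2 * (q : ℝ) ^ ((N : ℝ) / 2 - 2 * g)) := by
    rw [hC₁, add_sub_assoc, Real.rpow_add hq0]
    ring
  have hE : (q : ℝ) ^ (-(g : ℝ) / 2 + ε * g) = (q : ℝ) ^ (-(g : ℝ) / 2) * (q : ℝ) ^ (ε * g) :=
    Real.rpow_add hq0 _ _
  have h4 : (N + 1 : ℕ) * ((N + 1 : ℕ) * (N * (N *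
      ((2 * g + 2) * (q + 1) * (q : ℝ) ^ (8 - (g : ℝ) / 2))))) ≤
      1024 * (q + 1) * (q : ℝ) ^ (8 : ℝ) * K * (g * (q : ℝ) ^ (-(g : ℝ) / 2 + ε * g)) := by
    have he : (q : ℝ) ^ (8 - (g : ℝ) / 2) = (q : ℝ) ^ (8 : ℝ) * (q : ℝ) ^ (-(g : ℝ) / 2) := by
      rw [← Real.rpow_add hq0]
      congr 1
      ring
    rw [he, hE]
    push_cast
    calc _ ≤ (4 * g : ℝ) * ((4 * g) * ((4 * g) * ((4 * g) * ((2 * g + 2 * g) * (q + 1) *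
          ((q : ℝ) ^ (8 : ℝ) * (q : ℝ) ^ (-(g : ℝ) / 2)))))) := by
          gcongr <;> linarith
      _ = 1024 * (q + 1) * (q : ℝ) ^ (8 : ℝ) * (g * (q : ℝ) ^ (-(g : ℝ) / 2)) * (g : ℝ) ^ 4 := by
          ring
      _ ≤ 1024 * (q + 1) * (q : ℝ) ^ (8 : ℝ) * (g * (q : ℝ) ^ (-(g : ℝ) / 2)) *
          (K * (q : ℝ) ^ (ε * g)) := by
          gcongr
          exact hK g
      _ = _ := by ring
  have h5 : (q : ℝ) ^ 4 * S ^ 3 * (g * (q : ℝ) ^ (-(g : ℝ) / 2)) ≤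
      (q : ℝ) ^ 4 * S ^ 3 * (g * (q : ℝ) ^ (-(g : ℝ) / 2 + ε * g)) := by
    have : (q : ℝ) ^ (-(g : ℝ) / 2) ≤ (q : ℝ) ^ (-(g : ℝ) / 2 + ε * g) :=
      Real.rpow_le_rpow_of_exponent_le (by linarith) (le_add_of_nonneg_right (by positivity))
    gcongr
  set T₁ := (N : ℝ) ^ 2 * (q : ℝ) ^ ((N : ℝ) / 2 - 2 * g) with hT₁
  set T₂ := (g : ℝ) * (q : ℝ) ^ (-(g : ℝ) / 2 + ε * g) with hT₂
  have hT₁0 : 0 ≤ T₁ := by positivity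
  have hT₂0 : 0 ≤ T₂ := by positivity
  calc ‖oddEven q g N α β - I‖ = ‖(oddEven q g N α β - mainSum q g N α β) -
        (I - mainSum q g N α β)‖ := by rw [sub_sub_sub_cancel_right]
    _ ≤ C₁ * T₁ + C₂ * T₂ := by
        refine (norm_sub_le _ _).trans ?_
        rw [hC₂, add_mul, ← add_assoc]
        exact add_le_add (h1.trans (add_le_add h3.le h4)) (h2.trans h5)
    _ ≤ (C₁ + C₂) * (T₁ + T₂) := by nlinarith [mul_nonneg hC₁0 hT₂0, mul_nonneg hC₂0 hT₁0]

lemma exists_norm_oddEven_sub_contour_le_of_fixed (hq2 : q ≠ 2) {ε : ℝ} (hε0 : 0 < ε) (hε1 : ε < 1)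
    {g N : ℕ} (hg : 1 ≤ g) (hN : N < 4 * g) :
    ∃ C : ℝ, ∀ α β : ℂ, ‖α‖ ≤ 1 / (g : ℝ) → ‖β‖ ≤ 1 / (g : ℝ) →
      ‖oddEven q g N α β - (1 / (2 * Real.pi * Complex.I)) * ∮ u in C(0, (q : ℝ) ^ (-ε)),
        (q : ℂ) ^ (-2 * (g : ℂ) * α) * u ^ (2 * g) * A2 q u α * Kfun q g α β u /
          (u ^ (N + 1) * (1 - u))‖ ≤ C := by
  obtain ⟨C, hC⟩ := exists_oddEven_bound (N := N) hq2 hg hN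
  obtain ⟨D, hD⟩ := exists_contour_bound (q := q) hε0 hε1 hg N
  refine ⟨C + ‖1 / (2 * Real.pi * Complex.I)‖ * D, fun α β hα hβ => (norm_sub_le _ _).trans ?_⟩
  rw [norm_mul]
  exact add_le_add (hC α β hα hβ) (mul_le_mul_of_nonneg_left (hD α β hα hβ) (norm_nonneg _))

lemma exists_norm_oddEven_sub_contour_le_of_lt (hq2 : q ≠ 2) {ε : ℝ} (hε0 : 0 < ε) (hε1 : ε < 1)
    (G : ℕ) :
    ∃ C : ℝ, 0 ≤ C ∧ ∀ g N : ℕ, 1 ≤ g → g < G → N < 4 * g →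
      ∀ α β : ℂ, ‖α‖ ≤ 1 / (g : ℝ) → ‖β‖ ≤ 1 / (g : ℝ) →
      ‖oddEven q g N α β - (1 / (2 * Real.pi * Complex.I)) * ∮ u in C(0, (q : ℝ) ^ (-ε)),
        (q : ℂ) ^ (-2 * (g : ℂ) * α) * u ^ (2 * g) * A2 q u α * Kfun q g α β u /
          (u ^ (N + 1) * (1 - u))‖ ≤ C * ((g : ℝ) * (q : ℝ) ^ (-(g : ℝ) / 2 + ε * g)) := by
  have hq := two_le_cast q
  choose! B hB using fun g N => fun h : 1 ≤ g ∧ N < 4 * g =>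
    exists_norm_oddEven_sub_contour_le_of_fixed hq2 hε0 hε1 h.1 h.2
  have hnn : ∀ g N : ℕ, 0 ≤ |B g N| / ((g : ℝ) * (q : ℝ) ^ (-(g : ℝ) / 2 + ε * g)) := by
    intro g N
    positivity
  refine ⟨∑ g ∈ Finset.range G, ∑ N ∈ Finset.range (4 * G),
    |B g N| / ((g : ℝ) * (q : ℝ) ^ (-(g : ℝ) / 2 + ε * g)),
    Finset.sum_nonneg fun g _ => Finset.sum_nonneg fun N _ => hnn g N,
    fun g N hg hgG hN α β hα hβ => ?_⟩
  refine (hB g N ⟨hg, hN⟩ α β hα hβ).trans ((le_abs_self _).trans ?_)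
  have hg0 : (0 : ℝ) < g := by exact_mod_cast hg
  rw [← div_le_iff₀ (by positivity)]
  refine (Finset.single_le_sum (f := fun N => |B g N| / ((g : ℝ) *
    (q : ℝ) ^ (-(g : ℝ) / 2 + ε * g))) (fun N _ => hnn g N) (Finset.mem_range.2 ?_)).trans
    (Finset.single_le_sum (f := fun g => ∑ N ∈ Finset.range (4 * G), |B g N| / ((g : ℝ) *
    (q : ℝ) ^ (-(g : ℝ) / 2 + ε * g))) (fun g _ => Finset.sum_nonneg fun N _ => hnn g N)
    (Finset.mem_range.2 hgG))
  omega

end Final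

/-- the odd-even Type-I contribution `I_2^{oe}` to the two level
density: for every `ε ∈ (0,1)` there is `C(ε,q)` such that for `1 ≤ g`, `1 ≤ N < 4g`,
`|α|, |β| ≤ 1/g`, with `r = q^{-ε}`,
`I_2^{oe}(N;α,β) = (1/2πi) ∮_{|u|=r} q^{-2gα} u^{2g} A₂(u,α) K(u;α,β) du/(u^{N+1}(1-u))
  + O(N² q^{N/2-2g} + g q^{-g/2+εg})`. -/
theorem statement18 (q : ℕ) [Fact q.Prime] (hq4 : q % 4 = 1)
    (ε : ℝ) (hε0 : 0 < ε) (hε1 : ε < 1) :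
    ∃ C : ℝ, 0 < C ∧ ∀ g N : ℕ, 1 ≤ g → 1 ≤ N → N < 4 * g →
      ∀ α β : ℂ, ‖α‖ ≤ 1 / (g : ℝ) → ‖β‖ ≤ 1 / (g : ℝ) →
      ‖(1 / ((q : ℂ) ^ (2 * g + 1) - (q : ℂ) ^ (2 * g))) *
            sumH q g (fun D =>
              ∑' x : Polynomial (ZMod q) × Polynomial (ZMod q) × ℕ × ℕ,
                if x.1.Monic ∧ Irreducible x.1 ∧ x.2.1.Monic ∧ Irreducible x.2.1 ∧
                    (2 * x.2.2.1 + 1) * x.1.natDegree + 2 * (x.2.2.2 + 1) * x.2.1.natDegree ≤ N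
                then
                  (x.1.natDegree : ℂ) * (x.2.1.natDegree : ℂ) *
                    (jacSym q D (x.1 ^ (2 * x.2.2.1 + 1) * x.2.1 ^ (2 * (x.2.2.2 + 1))) : ℂ) /
                    ((q : ℂ) ^ ((((2 * x.2.2.1 + 1) * x.1.natDegree : ℕ) : ℂ) * (1 / 2 + α)) *
                      (q : ℂ) ^ ((((x.2.2.2 + 1) * x.2.1.natDegree : ℕ) : ℂ) * (1 + 2 * β)))
                else 0)
          - (1 / (2 * Real.pi * Complex.I)) *
              ∮ u in C(0, (q : ℝ) ^ (-ε)),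
                (q : ℂ) ^ (-2 * (g : ℂ) * α) * u ^ (2 * g) * A2 q u α * Kfun q g α β u /
                  (u ^ (N + 1) * (1 - u))‖
        ≤ C * ((N : ℝ) ^ 2 * (q : ℝ) ^ ((N : ℝ) / 2 - 2 * g)
            + (g : ℝ) * (q : ℝ) ^ (-(g : ℝ) / 2 + ε * g)) := by
  have hq2 : q ≠ 2 := by
    rintro rfl
    omega
  have hq := two_le_cast q
  obtain ⟨m, hm⟩ := exists_nat_one_div_lt (lt_min hε0 (sub_pos.2 hε1))
  obtain ⟨C, hC0, hC⟩ := exists_norm_oddEven_sub_contour_le hq2 hε0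
  obtain ⟨D, hD0, hD⟩ := exists_norm_oddEven_sub_contour_le_of_lt hq2 hε0 hε1 (m + 12)
  refine ⟨C + D + 1, by positivity, fun g N hg hN1 hN α β hα hβ => ?_⟩
  have hT₁ : 0 ≤ (N : ℝ) ^ 2 * (q : ℝ) ^ ((N : ℝ) / 2 - 2 * g) := by positivity
  have hT₂ : 0 ≤ (g : ℝ) * (q : ℝ) ^ (-(g : ℝ) / 2 + ε * g) := by positivity
  rcases lt_or_ge g (m + 12) with h | h
  · refine (hD g N hg h hN α β hα hβ).trans (mul_le_mul ?_ ?_ hT₂ (by positivity)) <;> linarith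
  · have hgm : 1 / (g : ℝ) < min ε (1 - ε) := by
      refine lt_of_le_of_lt (one_div_le_one_div_of_le (by positivity) ?_) hm
      exact_mod_cast (by omega : m + 1 ≤ g)
    refine (hC g N (by omega) (lt_min_iff.1 hgm).1 (lt_min_iff.1 hgm).2 hN α β hα hβ).trans ?_
    exact mul_le_mul_of_nonneg_right (by linarith) (add_nonneg hT₁ hT₂)
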